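/- Let G be a connected reductive algebraic group over an algebraically closed field of characteristic 0, T a maximal torus, and V1, V2 finite-dimensional minuscule representations of G (i.e., every irreducible factor has Weyl group acting transitively on its weights). If Hom_T(V1, V2) is nonzero, then Hom_G(V1, V2) is nonzero. -/

import Mathlib

/-! Concrete model of linear algebraic groups: Zariski-closed subgroups of `GL n F`. -/

variable {F : Type} [Field F]

/-- A subset of `GL n F` is Zariski closed if it is the vanishing locus (inside
`GL n F`) of a family of polynomials in the matrix entries. -/
def IsZClosed {n : ℕ} (S : Set (GL (Fin n) F)) : Prop :=
  ∃ I : Set (MvPolynomial (Fin n × Fin n) F),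
    S = {g | ∀ p ∈ I, MvPolynomial.eval
      (fun q => ((g : GL (Fin n) F) : Matrix (Fin n) (Fin n) F) q.1 q.2) p = 0}

/-- Connectedness of a subset of `GL n F` for the Zariski topology. -/
def IsZConnected {n : ℕ} (S : Set (GL (Fin n) F)) : Prop :=
  ∀ C₁ C₂ : Set (GL (Fin n) F), IsZClosed C₁ → IsZClosed C₂ → S ⊆ C₁ ∪ C₂ →
    (S ∩ C₁).Nonempty → (S ∩ C₂).Nonempty → (S ∩ (C₁ ∩ C₂)).Nonempty

/-- `C` is the Zariski closure of `S`. -/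
def IsZClosure {n : ℕ} (S C : Set (GL (Fin n) F)) : Prop :=
  IsZClosed C ∧ S ⊆ C ∧ ∀ D : Set (GL (Fin n) F), IsZClosed D → S ⊆ D → C ⊆ D

/-- An element of `GL n F` is unipotent. -/
def IsUnipotentElem {n : ℕ} (g : GL (Fin n) F) : Prop :=
  ((g : Matrix (Fin n) (Fin n) F) - 1) ^ n = 0

/-- An element of `GL n F` is semisimple (diagonalizable; over an algebraically closed
field of characteristic zero this is the usual notion). -/
def IsSemisimpleElem {n : ℕ} (g : GL (Fin n) F) : Prop :=
  ∃ P : GL (Fin n) F,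
    Matrix.IsDiag ((P⁻¹ * g * P : GL (Fin n) F) : Matrix (Fin n) (Fin n) F)

/-- A closed subgroup `G` is reductive if its only Zariski-closed connected normal
subgroup consisting of unipotent elements is trivial. -/
def IsReductive {n : ℕ} (G : Subgroup (GL (Fin n) F)) : Prop :=
  ∀ H : Subgroup (GL (Fin n) F), H ≤ G → IsZClosed (H : Set (GL (Fin n) F)) →
    IsZConnected (H : Set (GL (Fin n) F)) → (∀ h ∈ H, IsUnipotentElem h) →
    (∀ g ∈ G, ∀ h ∈ H, g * h * g⁻¹ ∈ H) → H = ⊥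

/-- A torus: a Zariski-closed connected commutative subgroup all of whose elements are
semisimple. -/
def IsTorus {n : ℕ} (T : Subgroup (GL (Fin n) F)) : Prop :=
  IsZClosed (T : Set (GL (Fin n) F)) ∧ IsZConnected (T : Set (GL (Fin n) F)) ∧
    (∀ t ∈ T, IsSemisimpleElem t) ∧ ∀ a ∈ T, ∀ b ∈ T, a * b = b * a

/-- A maximal torus of `G`. -/
def IsMaximalTorus {n : ℕ} (G T : Subgroup (GL (Fin n) F)) : Prop :=
  T ≤ G ∧ IsTorus T ∧ ∀ T' : Subgroup (GL (Fin n) F), T' ≤ G → IsTorus T' → T ≤ T' → T' = T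

/-- `G0` is the identity component of `G`. -/
def IsIdentityComponent {n : ℕ} (G0 G : Subgroup (GL (Fin n) F)) : Prop :=
  G0 ≤ G ∧ IsZClosed (G0 : Set (GL (Fin n) F)) ∧ IsZConnected (G0 : Set (GL (Fin n) F)) ∧
    ∀ H : Subgroup (GL (Fin n) F), H ≤ G → IsZClosed (H : Set (GL (Fin n) F)) →
      IsZConnected (H : Set (GL (Fin n) F)) → H ≤ G0

/-- A representation `ρ : G → GL m F` is algebraic: its matrix entries are polynomial
functions of the matrix entries of `g` and of `g⁻¹`. -/
def IsAlgebraicRep {n m : ℕ} (G : Subgroup (GL (Fin n) F)) (ρ : G →* GL (Fin m) F) : Prop :=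
  ∀ i j : Fin m, ∃ p : MvPolynomial ((Fin n × Fin n) ⊕ (Fin n × Fin n)) F, ∀ g : G,
    ((ρ g : GL (Fin m) F) : Matrix (Fin m) (Fin m) F) i j =
      MvPolynomial.eval (Sum.elim
        (fun q => (((g : GL (Fin n) F)) : Matrix (Fin n) (Fin n) F) q.1 q.2)
        (fun q => (((g : GL (Fin n) F)⁻¹) : Matrix (Fin n) (Fin n) F) q.1 q.2)) p

/-- A submodule invariant under the representation. -/
def RepInvariant {n m : ℕ} {G : Subgroup (GL (Fin n) F)} (ρ : G →* GL (Fin m) F)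
    (U : Submodule F (Fin m → F)) : Prop :=
  ∀ g : G, ∀ v ∈ U, Matrix.mulVec ((ρ g : GL (Fin m) F) : Matrix (Fin m) (Fin m) F) v ∈ U

/-- `U` is a nonzero irreducible subrepresentation. -/
def IsIrreducibleOn {n m : ℕ} {G : Subgroup (GL (Fin n) F)} (ρ : G →* GL (Fin m) F)
    (U : Submodule F (Fin m → F)) : Prop :=
  U ≠ ⊥ ∧ RepInvariant ρ U ∧
    ∀ U' : Submodule F (Fin m → F), U' ≤ U → RepInvariant ρ U' → U' = ⊥ ∨ U' = U

/-- `v ∈ U` is a weight vector for the torus `T` with weight (character) `c`; the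
character is recorded as a function on all of `GL n F`, only its values on `T`
being relevant. -/
def IsWeightVector {n m : ℕ} {G : Subgroup (GL (Fin n) F)} (T : Subgroup (GL (Fin n) F))
    (ρ : G →* GL (Fin m) F) (U : Submodule F (Fin m → F)) (c : GL (Fin n) F → F)
    (v : Fin m → F) : Prop :=
  v ∈ U ∧ v ≠ 0 ∧ ∀ t : G, (t : GL (Fin n) F) ∈ T →
    Matrix.mulVec ((ρ t : GL (Fin m) F) : Matrix (Fin m) (Fin m) F) v = c t • v

/-- The subrepresentation `U` is minuscule: the Weyl group `N_G(T)/T` acts transitively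
on its `T`-weights. -/
def IsMinusculeOn {n m : ℕ} (G : Subgroup (GL (Fin n) F)) (T : Subgroup (GL (Fin n) F))
    (ρ : G →* GL (Fin m) F) (U : Submodule F (Fin m → F)) : Prop :=
  ∀ (c c' : GL (Fin n) F → F) (v v' : Fin m → F),
    IsWeightVector T ρ U c v → IsWeightVector T ρ U c' v' →
    ∃ w : GL (Fin n) F, w ∈ G ∧ w ∈ Subgroup.normalizer T ∧
      ∀ t ∈ T, c' t = c (w * t * w⁻¹)

/-- A representation is minuscule if all its irreducible factors are. -/
def IsMinuscule {n m : ℕ} (G : Subgroup (GL (Fin n) F)) (T : Subgroup (GL (Fin n) F))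
    (ρ : G →* GL (Fin m) F) : Prop :=
  ∀ U : Submodule F (Fin m → F), IsIrreducibleOn ρ U → IsMinusculeOn G T ρ U

set_option linter.all false
namespace Minu
open Module

section replica
variable {F : Type} [Field F] {M N : Type} [AddCommGroup M] [Module F M]
  [AddCommGroup N] [Module F N]

/-- The second element is the `φ`-replica of `x`. -/
def IsRep (φ : F → F) (x x' : Module.End F M) : Prop :=
  ∀ μ v, v ∈ x.maxGenEigenspace μ → x' v = φ μ • v

/-- the generalized eigenspaces span. -/
def Spl (x : Module.End F M) : Prop := ⨆ μ, x.maxGenEigenspace μ = ⊤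

theorem spl_of_fd [IsAlgClosed F] [FiniteDimensional F M] (x : Module.End F M) : Spl x :=
  Module.End.iSup_maxGenEigenspace_eq_top x

theorem Spl.induction {x : Module.End F M} (h : Spl x) {P : M → Prop} (v : M)
    (h1 : ∀ μ v, v ∈ x.maxGenEigenspace μ → P v) (h0 : P 0)
    (hadd : ∀ v w, P v → P w → P (v + w)) : P v :=
  Submodule.iSup_induction (fun μ => x.maxGenEigenspace μ) (motive := P)
    (x := v) (by rw [show (⨆ μ, x.maxGenEigenspace μ) = ⊤ from h]; trivial) h1 h0 hadd

theorem exists_isRep {x : Module.End F M} (h : Spl x) (φ : F → F) : ∃ x', IsRep φ x x' := by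
  classical
  have hI : DirectSum.IsInternal (fun μ => x.maxGenEigenspace μ) :=
    DirectSum.isInternal_submodule_of_iSupIndep_of_iSup_eq_top
      (Module.End.independent_maxGenEigenspace x) h
  let e := LinearEquiv.ofBijective
    (DirectSum.coeLinearMap (fun μ => x.maxGenEigenspace μ)) hI
  let g := DirectSum.toModule F F M (fun μ => φ μ • (x.maxGenEigenspace μ).subtype)
  refine ⟨g ∘ₗ e.symm.toLinearMap, fun μ v hv => ?_⟩
  have : e.symm v = DirectSum.lof F F (fun μ => x.maxGenEigenspace μ) μ ⟨v, hv⟩ := by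
    rw [LinearEquiv.symm_apply_eq]
    exact (DirectSum.coeLinearMap_lof (fun μ => x.maxGenEigenspace μ) (i := μ) ⟨v, hv⟩).symm
  simp [this, g]

theorem map_maxGen {x : Module.End F M} {y : Module.End F N} (L : M →ₗ[F] N)
    (hL : ∀ v, L (x v) = y (L v)) {μ : F} {v : M} (hv : v ∈ x.maxGenEigenspace μ) :
    L v ∈ y.maxGenEigenspace μ := by
  rw [Module.End.mem_maxGenEigenspace] at hv ⊢
  obtain ⟨k, hk⟩ := hv
  refine ⟨k, ?_⟩
  have : ∀ k v, L (((x - μ • (1 : Module.End F M)) ^ k) v) =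
      ((y - μ • (1 : Module.End F N)) ^ k) (L v) := by
    intro k
    induction k with
    | zero => intro v; simp
    | succ k ih => intro v; rw [pow_succ, pow_succ, Module.End.mul_apply, ih]; simp [hL]
  rw [← this, hk, map_zero]

theorem IsRep.intertwine {φ : F → F} {x x' : Module.End F M} {y y' : Module.End F N}
    (hs : Spl x) (hx : IsRep φ x x') (hy : IsRep φ y y') (L : M →ₗ[F] N)
    (hL : ∀ v, L (x v) = y (L v)) (v : M) : L (x' v) = y' (L v) := by
  refine hs.induction (P := fun v => L (x' v) = y' (L v)) v ?_ (by simp) ?_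
  · intro μ v hv
    rw [hx μ v hv, hy μ _ (map_maxGen L hL hv), map_smul]
  · intro v w h1 h2; simp [h1, h2]

theorem IsRep.unique {φ : F → F} {x x' x'' : Module.End F M}
    (hs : Spl x) (hx : IsRep φ x x') (hy : IsRep φ x x'') : x' = x'' :=
  LinearMap.ext fun v => hx.intertwine hs hy LinearMap.id (by simp) v

/-- restriction of replicas to a stable subspace, abstractly. -/
theorem IsRep.of_injective {φ : F → F} {x x' : Module.End F M} {y y' : Module.End F N}
    (hy : IsRep φ y y') (L : M →ₗ[F] N) (hinj : Function.Injective L)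
    (hL : ∀ v, L (x v) = y (L v)) (hL' : ∀ v, L (x' v) = y' (L v)) : IsRep φ x x' := by
  intro μ v hv
  apply hinj
  rw [hL', hy μ _ (map_maxGen L hL hv), map_smul]

theorem mem_maxGen_of_sub {z : Module.End F M} {μ : F} {v : M}
    (h : z v - μ • v ∈ z.maxGenEigenspace μ) : v ∈ z.maxGenEigenspace μ := by
  rw [Module.End.mem_maxGenEigenspace] at h ⊢
  obtain ⟨k, hk⟩ := h
  refine ⟨k + 1, ?_⟩
  rw [pow_succ, Module.End.mul_apply]
  simpa using hk

theorem bilin_maxGen {P : Type} [AddCommGroup P] [Module F P] (β : M →ₗ[F] N →ₗ[F] P)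
    {x : Module.End F M} {y : Module.End F N} {z : Module.End F P}
    (hβ : ∀ m n, z (β m n) = β (x m) n + β m (y n)) {μ ν : F} {m : M} {n : N}
    (hm : m ∈ x.maxGenEigenspace μ) (hn : n ∈ y.maxGenEigenspace ν) :
    β m n ∈ z.maxGenEigenspace (μ + ν) := by
  rw [Module.End.mem_maxGenEigenspace] at hm hn
  obtain ⟨k, hk⟩ := hm
  obtain ⟨l, hl⟩ := hn
  induction hs : k + l generalizing k l m n with
  | zero =>
    obtain rfl : k = 0 := by omega
    obtain rfl : m = 0 := by simpa using hk
    simp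
  | succ s ih =>
    apply mem_maxGen_of_sub
    have e : z (β m n) - (μ + ν) • β m n =
        β ((x - μ • (1 : Module.End F M)) m) n + β m ((y - ν • (1 : Module.End F N)) n) := by
      rw [hβ]; simp [add_smul]; abel
    rw [e]
    refine add_mem ?_ ?_
    · rcases k with _ | k
      · obtain rfl : m = 0 := by simpa using hk
        simp
      · exact ih k (by rw [pow_succ] at hk; exact hk) l hl (by omega)
    · rcases l with _ | l
      · obtain rfl : n = 0 := by simpa using hl
        simp
      · exact ih k hk l (by rw [pow_succ] at hl; exact hl) (by omega)

/-- The adjoint action. -/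
def adE (x : Module.End F M) : Module.End F (Module.End F M) :=
  LinearMap.mulLeft F x - LinearMap.mulRight F x

theorem adE_apply (x b : Module.End F M) : adE x b = x * b - b * x := by simp [adE]

theorem apply_mem_maxGen {x b : Module.End F M} {μ ν : F} {v : M}
    (hb : b ∈ (adE x).maxGenEigenspace μ)
    (hv : v ∈ x.maxGenEigenspace ν) : b v ∈ x.maxGenEigenspace (μ + ν) :=
  bilin_maxGen (LinearMap.id : (M →ₗ[F] M) →ₗ[F] (M →ₗ[F] M)) (x := adE x) (y := x) (z := x)
    (fun m n => by simp [adE_apply]) hb hv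

theorem IsRep.ad {φ : F → F} (hφ : ∀ a b, φ (a + b) = φ a + φ b) {x x' : Module.End F M}
    (hs : Spl x) (hx : IsRep φ x x') :
    IsRep φ (adE x) (adE x') := by
  intro μ b hb
  refine LinearMap.ext fun v => ?_
  refine hs.induction (P := fun v => ((adE x') b) v = (φ μ • b) v) v
    ?_ (by simp) ?_
  · intro ν v hv
    have h1 := hx _ _ (apply_mem_maxGen hb hv)
    have h2 := hx _ _ hv
    simp only [adE_apply, LinearMap.sub_apply, Module.End.mul_apply,
      LinearMap.smul_apply, h1, h2, map_smul, hφ, add_smul]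
    abel
  · intro v w h1 h2; simp only [map_add, h1, h2]

theorem IsRep.comm {φ : F → F} {x x' : Module.End F M}
    (hs : Spl x) (hx : IsRep φ x x') {z : Module.End F M} (hz : Commute z x) : Commute z x' :=
  LinearMap.ext fun v => hx.intertwine hs hx z (fun v => LinearMap.congr_fun hz.eq v) v

end replica

section trace
variable {F : Type} [Field F] [IsAlgClosed F] [CharZero F]
  {M : Type} [AddCommGroup M] [Module F M] [FiniteDimensional F M]

theorem finite_maxGen (x : Module.End F M) : {μ | x.maxGenEigenspace μ ≠ ⊥}.Finite :=
  WellFoundedGT.finite_ne_bot_of_iSupIndep (Module.End.independent_maxGenEigenspace x)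

theorem isInternal_maxGen [DecidableEq F] (x : Module.End F M) :
    DirectSum.IsInternal (fun μ => x.maxGenEigenspace μ) := by
  exact DirectSum.isInternal_submodule_of_iSupIndep_of_iSup_eq_top
      (Module.End.independent_maxGenEigenspace x) (spl_of_fd x)

theorem trace_restrict_maxGen (x : Module.End F M) (μ : F) 
    (h : Set.MapsTo x (x.maxGenEigenspace μ) (x.maxGenEigenspace μ)) :
    LinearMap.trace F (x.maxGenEigenspace μ) (x.restrict h) =
      finrank F (x.maxGenEigenspace μ) * μ := by
  have h2 := Module.End.isNilpotent_restrict_maxGenEigenspace_sub_algebraMap x μ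
  have h3 := (LinearMap.isNilpotent_trace_of_isNilpotent h2).eq_zero
  have h4 : x.restrict h = LinearMap.restrict (x - algebraMap F (Module.End F M) μ)
      (Module.End.mapsTo_maxGenEigenspace_of_comm (Algebra.mul_sub_algebraMap_commutes x μ) μ) +
      μ • 1 := by
    refine LinearMap.ext fun v => Subtype.ext ?_
    change x v.1 = (x v.1 - μ • v.1) + μ • v.1
    abel
  rw [h4, map_add, h3, map_smul, LinearMap.trace_one]; simp [mul_comm]

theorem trace_mul_rep {φ : F → F} {x x' : Module.End F M} (hx : IsRep φ x x') :
    LinearMap.trace F M (x * x') = ∑ μ ∈ (finite_maxGen x).toFinset,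
      φ μ * (finrank F (x.maxGenEigenspace μ) * μ) := by
  classical
  have hc := hx.comm (spl_of_fd x) (Commute.refl x)
  have hm : ∀ μ, Set.MapsTo x (x.maxGenEigenspace μ) (x.maxGenEigenspace μ) := fun μ =>
    Module.End.mapsTo_maxGenEigenspace_of_comm (Commute.refl x) μ
  rw [LinearMap.trace_eq_sum_trace_restrict' (isInternal_maxGen x) (finite_maxGen x)
    (f := x * x') (fun μ => Module.End.mapsTo_maxGenEigenspace_of_comm
      ((Commute.refl x).mul_right hc) μ)]
  refine Finset.sum_congr rfl fun μ _ => ?_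
  rw [← trace_restrict_maxGen x μ (hm μ)]
  refine Eq.trans ?_ (map_smul (LinearMap.trace F (x.maxGenEigenspace μ)) (φ μ) _)
  congr 1
  refine LinearMap.ext fun v => Subtype.ext ?_
  change x (x' v.1) = φ μ • x v.1
  rw [hx μ v.1 v.2, map_smul]

theorem nilp_of_eig {x : Module.End F M} (h : ∀ μ, x.maxGenEigenspace μ ≠ ⊥ → μ = 0) :
    IsNilpotent x := by
  have : x.maxGenEigenspace 0 = ⊤ := by
    rw [eq_top_iff, ← show _ = _ from spl_of_fd x]
    refine iSup_le fun μ => ?_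
    by_cases hμ : x.maxGenEigenspace μ = ⊥
    · rw [hμ]; exact bot_le
    · rw [h μ hμ]
  rw [Module.End.maxGenEigenspace_eq_genEigenspace_finrank] at this
  refine ⟨finrank F M, LinearMap.ext fun v => ?_⟩
  have : v ∈ x.genEigenspace 0 (finrank F M) := by rw [this]; trivial
  rw [Module.End.mem_genEigenspace_nat] at this
  simpa using this

theorem nilp_of_trace {x : Module.End F M}
    (h : ∀ φ : F →ₗ[ℚ] ℚ, ∃ x', IsRep (fun μ => ((φ μ : ℚ) : F)) x x' ∧
      LinearMap.trace F M (x * x') = 0) : IsNilpotent x := by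
  apply nilp_of_eig
  intro μ hμ
  by_contra hne
  obtain ⟨φ, hφ⟩ : ∃ φ : F →ₗ[ℚ] ℚ, φ μ ≠ 0 := by
    by_contra hc
    push Not at hc
    exact hne ((Module.forall_dual_apply_eq_zero_iff ℚ μ).1 hc)
  obtain ⟨x', hx', htr⟩ := h φ
  rw [trace_mul_rep hx'] at htr
  have h2 := congrArg φ htr
  rw [map_sum, map_zero] at h2
  have h3 : ∀ ν : F, φ (((φ ν : ℚ) : F) * (finrank F (x.maxGenEigenspace ν) * ν)) =
      (finrank F (x.maxGenEigenspace ν) : ℚ) * (φ ν) ^ 2 := by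
    intro ν
    have : (((φ ν : ℚ) : F) * (finrank F (x.maxGenEigenspace ν) * ν)) =
      ((φ ν) * (finrank F (x.maxGenEigenspace ν) : ℚ)) • ν := by
      rw [Algebra.smul_def, eq_ratCast]; push_cast; ring
    rw [this, map_smul, smul_eq_mul]; ring
  rw [Finset.sum_congr rfl (fun ν _ => h3 ν), Finset.sum_eq_zero_iff_of_nonneg
    (fun ν _ => by positivity)] at h2
  have h4 := h2 μ (by simpa using hμ)
  have h5 : (finrank F (x.maxGenEigenspace μ) : ℚ) ≠ 0 := by
    rw [Nat.cast_ne_zero]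
    intro h0
    exact hμ (Submodule.finrank_eq_zero.1 h0)
  rcases mul_eq_zero.1 h4 with h6 | h6
  · exact h5 h6
  · exact hφ (by simpa using h6)

end trace
end Minu

set_option linter.all false
namespace Minu
open Module

section compred
variable {F : Type} [Field F] [IsAlgClosed F] [CharZero F]
  {R : Type} [AddCommGroup R] [Module F R] [FiniteDimensional F R]

/-- reductive-like Lie algebra of endomorphisms -/
structure LL {L : Type} [AddCommGroup L] [Module F L] (ι : L →ₗ[F] Module.End F R) where
  inj : Function.Injective ι
  b : L → L →ₗ[F] L
  b_val : ∀ z x, ι (b z x) = ι z * ι x - ι x * ι z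
  rep : ∀ φ : F →ₗ[ℚ] F, ∀ x, ∀ x', IsRep φ (ι x) x' → ∃ y, ι y = x'
  nil : ∀ a : Submodule F L, (∀ z x, x ∈ a → b z x ∈ a) → (∀ y ∈ a, IsNilpotent (ι y)) → a = ⊥

/-- an action on `W` compatible with brackets and replicas -/
structure Act {W : Type} [AddCommGroup W] [Module F W]
    {L : Type} [AddCommGroup L] [Module F L] {ι : L →ₗ[F] Module.End F R} (H : LL ι)
    (θ : L →ₗ[F] Module.End F W) : Prop where
  br : ∀ x y, θ (H.b x y) = θ x * θ y - θ y * θ x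
  rep : ∀ φ : F →ₗ[ℚ] F, ∀ x x', IsRep φ (ι x) (ι x') → IsRep φ (θ x) (θ x')

variable {L : Type} [AddCommGroup L] [Module F L] [FiniteDimensional F L]
    {ι : L →ₗ[F] Module.End F R}

/-- rational functional as a linear map to `F` -/
def ratc (φ : F →ₗ[ℚ] ℚ) : F →ₗ[ℚ] F := Algebra.linearMap ℚ F ∘ₗ φ

theorem ratc_coe (φ : F →ₗ[ℚ] ℚ) : (ratc φ : F → F) = fun μ => ((φ μ : ℚ) : F) := by
  funext μ; simp [ratc]

theorem LL.nilideal (H : LL ι) (a : Submodule F L)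
    (hid : ∀ z x, x ∈ a → H.b z x ∈ a)
    (htr : ∀ x ∈ a, ∀ φ : F →ₗ[ℚ] ℚ, ∀ x', IsRep (ratc φ) (ι x) (ι x') →
      LinearMap.trace F R (ι x * ι x') = 0) : a = ⊥ := by
  refine H.nil a hid fun y hy => ?_
  apply nilp_of_trace
  intro φ
  obtain ⟨x', hx'⟩ := exists_isRep (spl_of_fd (ι y)) (ratc φ)
  obtain ⟨z, rfl⟩ := H.rep _ _ _ hx'
  exact ⟨_, by rw [← ratc_coe]; exact hx', htr y hy φ z hx'⟩

/-- trace form of an action -/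
noncomputable def trB {W : Type} [AddCommGroup W] [Module F W] 
    (θ : L →ₗ[F] Module.End F W) : LinearMap.BilinForm F L :=
  ((LinearMap.mul F (Module.End F W)).compl₁₂ θ θ).compr₂ (LinearMap.trace F W)

section
variable {W : Type} [AddCommGroup W] [Module F W] 
    (θ : L →ₗ[F] Module.End F W)

theorem trB_apply (x y : L) : trB θ x y = LinearMap.trace F W (θ x * θ y) := by
  simp [trB]

theorem trB_symm : (trB θ).IsSymm := by
  constructor
  intro x y
  simp [trB_apply, LinearMap.trace_mul_comm F (θ x)]

theorem trB_inv (H : LL ι) {θ : L →ₗ[F] Module.End F W} (hθ : Act H θ) (z x y : L) :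
    trB θ (H.b z x) y + trB θ x (H.b z y) = 0 := by
  rw [trB_apply, trB_apply, hθ.br z x, hθ.br z y, ← map_add]
  have : (θ z * θ x - θ x * θ z) * θ y + θ x * (θ z * θ y - θ y * θ z) =
    θ z * (θ x * θ y) - (θ x * θ y) * θ z := by noncomm_ring
  rw [this, map_sub, LinearMap.trace_mul_comm, sub_self]

theorem casimir [FiniteDimensional F W] (H : LL ι) {θ : L →ₗ[F] Module.End F W}
    (hθ : Act H θ) (l : Submodule F L) (hid : ∀ z x, x ∈ l → H.b z x ∈ l)
    (hnd : ∀ x ∈ l, (∀ y ∈ l, trB θ x y = 0) → x = 0) :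
    ∃ Ω : Module.End F W, (∀ z, Commute (θ z) Ω) ∧ LinearMap.trace F W Ω = finrank F l ∧
      ∀ U : Submodule F W, (∀ x w, θ x w ∈ U) → ∀ w, Ω w ∈ U := by
  classical
  let Bf := (trB θ).restrict l
  have hBf : ∀ x y : l, Bf x y = trB θ x.1 y.1 := fun x y => rfl
  have hsym : Bf.IsSymm := ⟨fun x y => (trB_symm θ).eq x.1 y.1⟩
  have hB : Bf.Nondegenerate := by
    have h1 : LinearMap.ker Bf = ⊥ := by
      rw [LinearMap.ker_eq_bot']
      intro x hx
      exact Subtype.ext (hnd x.1 x.2 fun y hy => LinearMap.congr_fun hx ⟨y, hy⟩)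
    exact LinearMap.BilinForm.IsSymm.isRefl hsym |>.nondegenerate_iff_separatingLeft.2
      (LinearMap.separatingLeft_iff_ker_eq_bot.2 h1)
  let b := Module.finBasis F l
  let d := Bf.dualBasis hB b
  have hd : ∀ x : l, x = ∑ j, Bf x (b j) • d j := by
    intro x
    conv_lhs => rw [← d.sum_repr x]
    refine Finset.sum_congr rfl fun j _ => ?_
    rw [LinearMap.BilinForm.dualBasis_repr_apply]
  have hbd : ∀ i j, Bf (d i) (b j) = if j = i then 1 else 0 := fun i j =>
    LinearMap.BilinForm.apply_dualBasis_left hB b i j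
  have hb : ∀ x : l, x = ∑ j, Bf x (d j) • b j := by
    intro x
    conv_lhs => rw [← b.sum_repr x]
    refine Finset.sum_congr rfl fun j _ => ?_
    congr 1
    rw [hsym.eq]
    have e : Bf (d j) x = Bf (d j) (∑ i, b.repr x i • b i) := by rw [b.sum_repr]
    rw [e, map_sum]
    simp only [map_smul, hbd, smul_eq_mul, mul_ite, mul_one, mul_zero]
    simp
  refine ⟨∑ i, θ (b i).1 * θ (d i).1, ?_, ?_, ?_⟩
  · intro z
    rw [commute_iff_eq, ← sub_eq_zero, Finset.mul_sum, Finset.sum_mul, ← Finset.sum_sub_distrib]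
    have e1 : ∀ i, θ z * (θ (b i).1 * θ (d i).1) - θ (b i).1 * θ (d i).1 * θ z =
        θ (H.b z (b i).1) * θ (d i).1 + θ (b i).1 * θ (H.b z (d i).1) := by
      intro i
      rw [hθ.br z _, hθ.br z _]; noncomm_ring
    have e2 : ∀ i, θ (H.b z (b i).1) = ∑ j, trB θ (H.b z (b i).1) (d j).1 • θ (b j).1 := by
      intro i
      have := congrArg Subtype.val (hb ⟨H.b z (b i).1, hid z _ (b i).2⟩)
      conv_lhs => rw [show H.b z (b i).1 = _ from this]
      simp [hBf]
    have e3 : ∀ i, θ (H.b z (d i).1) = ∑ j, trB θ (H.b z (d i).1) (b j).1 • θ (d j).1 := by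
      intro i
      have := congrArg Subtype.val (hd ⟨H.b z (d i).1, hid z _ (d i).2⟩)
      conv_lhs => rw [show H.b z (d i).1 = _ from this]
      simp [hBf]
    rw [Finset.sum_congr rfl fun i _ => e1 i, Finset.sum_add_distrib]
    simp_rw [e2, e3, Finset.sum_mul, Finset.mul_sum]
    rw [Finset.sum_comm, ← Finset.sum_add_distrib]
    refine Finset.sum_eq_zero fun j _ => ?_
    rw [← Finset.sum_add_distrib]
    refine Finset.sum_eq_zero fun i _ => ?_
    rw [smul_mul_assoc, mul_smul_comm, ← add_smul]
    have h1 := trB_inv H hθ z (b i).1 (d j).1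
    rw [(trB_symm θ).eq (b i).1] at h1
    rw [h1, zero_smul]
  · rw [map_sum]
    have : ∀ i, LinearMap.trace F W (θ (b i).1 * θ (d i).1) = 1 := by
      intro i
      rw [← trB_apply, ← hBf, hsym.eq, hbd]; simp
    rw [Finset.sum_congr rfl fun i _ => this i]
    simp
  · intro U hU w
    simp only [LinearMap.sum_apply, Module.End.mul_apply]
    exact U.sum_mem fun i _ => hU _ _
end

theorem rep_nilp {W : Type} [AddCommGroup W] [Module F W] {φ : F → F} (hφ : φ 0 = 0)
    {x y : Module.End F W}
    (hx : IsNilpotent x) (h : IsRep φ x y) : y = 0 := by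
  ext v
  obtain ⟨k, hk⟩ := hx
  rw [h 0 v (by rw [Module.End.mem_maxGenEigenspace]; exact ⟨k, by simp [hk]⟩), hφ]; simp

theorem act_self (H : LL ι) : Act H ι := ⟨H.b_val, fun _ _ _ h => h⟩

theorem act_nilp {W : Type} [AddCommGroup W] [Module F W] [FiniteDimensional F W] (H : LL ι)
    {θ : L →ₗ[F] Module.End F W} (hθ : Act H θ) {x : L} (hx : ∀ y, trB θ x y = 0) :
    IsNilpotent (θ x) := by
  apply nilp_of_trace
  intro φ
  obtain ⟨x', hx'⟩ := exists_isRep (spl_of_fd (ι x)) (ratc φ)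
  obtain ⟨z, rfl⟩ := H.rep _ _ _ hx'
  exact ⟨θ z, by rw [← ratc_coe]; exact hθ.rep _ _ _ hx', by rw [← trB_apply]; exact hx z⟩

theorem ortho_ideal (H : LL ι) (a : Submodule F L) (ha : ∀ z x, x ∈ a → H.b z x ∈ a) (z x : L)
    (hx : x ∈ (trB ι).orthogonal a) : H.b z x ∈ (trB ι).orthogonal a := by
  rw [LinearMap.BilinForm.mem_orthogonal_iff] at hx ⊢
  intro y hy
  have h1 := trB_inv H (act_self H) z y x
  have h2 := hx _ (ha z y hy)
  rwa [h2, zero_add] at h1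

/-- vanishing of first cohomology, in the form needed -/
theorem fixed_vector (H : LL ι) : ∀ (k : ℕ) {W : Type} [AddCommGroup W] [Module F W]
    [FiniteDimensional F W] (hk : finrank F W = k)
    {θ : L →ₗ[F] Module.End F W} (hθ : Act H θ) (U : Submodule F W) (hU : U ≠ ⊤)
    (hθU : ∀ x w, θ x w ∈ U), ∃ v, v ∉ U ∧ ∀ x, θ x v = 0 := by
  intro k
  induction k using Nat.strong_induction_on with
  | _ k ih =>
  intro W _ _ _ hk θ hθ U hU hθU
  let K : Submodule F L := LinearMap.ker (trB θ)
  have hKmem : ∀ x, x ∈ K ↔ ∀ y, trB θ x y = 0 := fun x => by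
    simp only [K, LinearMap.mem_ker, LinearMap.ext_iff, LinearMap.zero_apply]
  have hKid : ∀ z x, x ∈ K → H.b z x ∈ K := by
    intro z x hx
    rw [hKmem] at hx ⊢
    intro y
    have := trB_inv H hθ z x y
    rwa [hx, add_zero] at this
  let l := (trB ι).orthogonal K
  have hlid : ∀ z x, x ∈ l → H.b z x ∈ l := ortho_ideal H K hKid
  have hdisj : K ⊓ l = ⊥ := by
    apply H.nilideal
    · intro z x hx; exact ⟨hKid z x hx.1, hlid z x hx.2⟩
    · intro x hx φ x' hx'
      have h1 := act_nilp H hθ ((hKmem x).1 hx.1)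
      have h2 := rep_nilp (by simp) h1 (hθ.rep _ _ _ hx')
      have h3 : x' ∈ K := by rw [hKmem]; intro y; rw [trB_apply, h2]; simp
      have h4 := (LinearMap.BilinForm.mem_orthogonal_iff.1 hx.2) x' h3
      rw [trB_apply] at h4
      rw [LinearMap.trace_mul_comm]; exact h4
  have hcompl : IsCompl K l :=
    (LinearMap.BilinForm.isCompl_orthogonal_iff_disjoint (trB_symm ι).isRefl).2
      (disjoint_iff.2 hdisj)
  by_cases hl : l = ⊥
  · have hKtop : K = ⊤ := by have := hcompl.sup_eq_top; rwa [hl, sup_bot_eq] at this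
    have hnil : ∀ x, IsNilpotent (θ x) := fun x =>
      act_nilp H hθ ((hKmem x).1 (by rw [hKtop]; trivial))
    let N := LinearMap.ker θ
    have hNid : ∀ z x, x ∈ N → H.b z x ∈ N := by
      intro z x hx
      rw [LinearMap.mem_ker] at hx ⊢
      rw [hθ.br, hx]; simp
    have hNo : (trB ι).orthogonal N = ⊥ := by
      apply H.nilideal
      · exact ortho_ideal H N hNid
      · intro x hx φ x' hx'
        have h3 : x' ∈ N := rep_nilp (by simp) (hnil x) (hθ.rep _ _ _ hx')
        have h4 := (LinearMap.BilinForm.mem_orthogonal_iff.1 hx) x' h3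
        rw [trB_apply] at h4
        rw [LinearMap.trace_mul_comm]; exact h4
    have hNc : IsCompl N ((trB ι).orthogonal N) :=
      (LinearMap.BilinForm.isCompl_orthogonal_iff_disjoint (trB_symm ι).isRefl).2
        (by rw [hNo]; exact disjoint_bot_right)
    have hNtop : N = ⊤ := by have := hNc.sup_eq_top; rwa [hNo, sup_bot_eq] at this
    obtain ⟨v, hv⟩ : ∃ v, v ∉ U := by
      by_contra hc
      push Not at hc
      exact hU (eq_top_iff.2 fun v _ => hc v)
    refine ⟨v, hv, fun x => ?_⟩
    have : x ∈ N := by rw [hNtop]; trivial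
    rw [LinearMap.mem_ker.1 this]; simp
  · obtain ⟨Ω, hcomm, htr, hΩU⟩ := casimir H hθ l hlid (by
      intro x hx hxl
      have : x ∈ K ⊓ l := by
        refine ⟨?_, hx⟩
        refine (hKmem x).2 fun y => ?_
        obtain ⟨a, ha, b, hb, rfl⟩ := Submodule.mem_sup.1
          (show y ∈ K ⊔ l by rw [hcompl.sup_eq_top]; trivial)
        rw [map_add, hxl b hb, (trB_symm θ).eq, (hKmem a).1 ha, add_zero]
      rw [hdisj] at this
      exact this)
    have hl0 : finrank F l ≠ 0 := fun h0 => hl (Submodule.finrank_eq_zero.1 h0)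
    obtain ⟨m, hm1, hm⟩ : ∃ m, 1 ≤ m ∧ IsCompl (LinearMap.ker (Ω ^ m)) (LinearMap.range (Ω ^ m)) :=
      ((Filter.eventually_ge_atTop 1).and
        (LinearMap.eventually_isCompl_ker_pow_range_pow Ω)).exists
    have hne : Ω ^ m ≠ 0 := by
      intro h0
      have := (LinearMap.isNilpotent_trace_of_isNilpotent ⟨m, h0⟩ : IsNilpotent
        (LinearMap.trace F W Ω)).eq_zero
      rw [htr] at this
      exact hl0 (by exact_mod_cast this)
    let W0 := LinearMap.ker (Ω ^ m)
    have hW0 : ∀ x, ∀ w ∈ W0, θ x w ∈ W0 := by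
      intro x w hw
      have := LinearMap.congr_fun ((hcomm x).pow_right m).eq w
      rw [LinearMap.mem_ker] at hw ⊢
      rw [Module.End.mul_apply, Module.End.mul_apply, hw, map_zero] at this
      exact this.symm
    have hlt : finrank F W0 < k := by
      rw [← hk]
      apply Submodule.finrank_lt
      intro ht
      exact hne (LinearMap.ker_eq_top.1 ht)
    let θ0 : L →ₗ[F] Module.End F W0 :=
      { toFun := fun x => (θ x).restrict (hW0 x)
        map_add' := fun x y => by ext w; simp
        map_smul' := fun c x => by ext w; simp }
    have hθ0 : ∀ x (w : W0), (θ0 x w).1 = θ x w.1 := fun x w => rfl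
    have hact : Act H θ0 := by
      constructor
      · intro x y
        refine LinearMap.ext fun w => Subtype.ext ?_
        rw [hθ0, hθ.br]; rfl
      · intro φ x x' h
        exact (hθ.rep φ x x' h).of_injective W0.subtype W0.subtype_injective
          (fun v => rfl) (fun v => rfl)
    obtain ⟨v, hv, hv0⟩ := ih _ hlt rfl hact (U.comap W0.subtype) (by
      intro ht
      apply hU
      rw [eq_top_iff, ← hm.sup_eq_top]
      refine sup_le ?_ ?_
      · intro w hw
        have : (⟨w, hw⟩ : W0) ∈ U.comap W0.subtype := by rw [ht]; trivial
        exact this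
      · rintro _ ⟨w, rfl⟩
        obtain ⟨j, rfl⟩ : ∃ j, m = j + 1 := ⟨m - 1, by omega⟩
        rw [pow_succ', Module.End.mul_apply]
        exact hΩU U hθU _) (fun x w => hθU x w.1)
    exact ⟨v.1, hv, fun x => congrArg Subtype.val (hv0 x)⟩

/-- complete reducibility -/
theorem exists_proj (H : LL ι) (U : Submodule F R) (hU : ∀ x, ∀ u ∈ U, ι x u ∈ U) :
    ∃ π : Module.End F R, (∀ x, Commute (ι x) π) ∧ (∀ v, π v ∈ U) ∧ ∀ u ∈ U, π u = u := by
  by_cases hU0 : U = ⊥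
  · exact ⟨0, fun x => Commute.zero_right _, fun v => by simp, fun u hu => by
      rw [hU0] at hu; simp [(Submodule.mem_bot F).1 hu]⟩
  let Y : Submodule F (Module.End F R) :=
    { carrier := {f | (∀ v, f v ∈ U) ∧ ∃ c : F, ∀ u ∈ U, f u = c • u}
      add_mem' := by
        rintro f g ⟨h1, c, h2⟩ ⟨h3, d, h4⟩
        exact ⟨fun v => U.add_mem (h1 v) (h3 v), c + d, fun u hu => by
          rw [LinearMap.add_apply, h2 u hu, h4 u hu, add_smul]⟩
      zero_mem' := ⟨fun v => U.zero_mem, 0, fun u hu => by simp⟩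
      smul_mem' := by
        rintro a f ⟨h1, c, h2⟩
        exact ⟨fun v => U.smul_mem _ (h1 v), a * c, fun u hu => by
          rw [LinearMap.smul_apply, h2 u hu, smul_smul]⟩ }
  have hYmem : ∀ f, f ∈ Y ↔ (∀ v, f v ∈ U) ∧ ∃ c : F, ∀ u ∈ U, f u = c • u := fun f => Iff.rfl
  have key : ∀ x, ∀ f ∈ Y, (∀ v, adE (ι x) f v ∈ U) ∧ ∀ u ∈ U, adE (ι x) f u = 0 := by
    intro x f hf
    obtain ⟨h1, c, h2⟩ := (hYmem f).1 hf
    constructor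
    · intro v
      simp only [adE_apply, LinearMap.sub_apply, Module.End.mul_apply]
      exact U.sub_mem (hU _ _ (h1 _)) (h1 _)
    · intro u hu
      simp only [adE_apply, LinearMap.sub_apply, Module.End.mul_apply]
      rw [h2 u hu, h2 _ (hU x u hu), map_smul, sub_self]
  have hY : ∀ x, ∀ f ∈ Y, adE (ι x) f ∈ Y := fun x f hf =>
    (hYmem _).2 ⟨(key x f hf).1, 0, fun u hu => by rw [(key x f hf).2 u hu, zero_smul]⟩
  let U' : Submodule F Y :=
    { carrier := {f | ∀ u ∈ U, f.1 u = 0}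
      add_mem' := by
        intro f g h1 h2 u hu
        change f.1 u + g.1 u = 0
        rw [h1 u hu, h2 u hu, add_zero]
      zero_mem' := fun u hu => rfl
      smul_mem' := by
        intro a f h1 u hu
        change a • f.1 u = 0
        rw [h1 u hu, smul_zero] }
  let θ : L →ₗ[F] Module.End F Y :=
    { toFun := fun x => (adE (ι x)).restrict (hY x)
      map_add' := fun x y => by
        refine LinearMap.ext fun f => Subtype.ext ?_
        change adE (ι (x + y)) f.1 = adE (ι x) f.1 + adE (ι y) f.1
        simp only [adE_apply, map_add]; noncomm_ring
      map_smul' := fun c x => by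
        refine LinearMap.ext fun f => Subtype.ext ?_
        change adE (ι (c • x)) f.1 = c • adE (ι x) f.1
        simp [adE_apply, map_smul, smul_sub] }
  have hθ : ∀ x (f : Y), (θ x f).1 = adE (ι x) f.1 := fun x w => rfl
  have hact : Act H θ := by
    constructor
    · intro x y
      refine LinearMap.ext fun f => Subtype.ext ?_
      change adE (ι (H.b x y)) f.1 = adE (ι x) (adE (ι y) f.1) - adE (ι y) (adE (ι x) f.1)
      simp only [adE_apply, H.b_val]; noncomm_ring
    · intro φ x x' h
      exact (h.ad (fun a b => map_add φ a b) (spl_of_fd _)).of_injective Y.subtype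
        Y.subtype_injective (fun v => rfl) (fun v => rfl)
  obtain ⟨p, hp⟩ := U.exists_isCompl
  obtain ⟨v, hv, hv0⟩ := fixed_vector H _ rfl hact U' (by
    intro ht
    obtain ⟨q, hq⟩ := Submodule.exists_isCompl U
    let pr : Module.End F R := U.subtype ∘ₗ U.projectionOnto q hq
    have hpr : pr ∈ Y := by
      rw [hYmem]
      refine ⟨fun v => (U.projectionOnto q hq v).2, 1, fun u hu => ?_⟩
      change ((U.projectionOnto q hq u : U) : R) = _
      have := Submodule.projectionOnto_apply_left hq ⟨u, hu⟩
      rw [one_smul]; exact congrArg Subtype.val this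
    apply hU0
    rw [eq_bot_iff]
    intro u hu
    have h1 : (⟨pr, hpr⟩ : Y) ∈ U' := by rw [ht]; trivial
    have h2 := h1 u hu
    have := congrArg Subtype.val (Submodule.projectionOnto_apply_left hq ⟨u, hu⟩)
    change ((U.projectionOnto q hq u : U) : R) = 0 at h2
    rw [Submodule.mem_bot, ← h2]; exact this.symm)
    (fun x f u hu => (key x f.1 f.2).2 u hu)
  obtain ⟨h1, c, h2⟩ := (hYmem _).1 v.2
  have hc : c ≠ 0 := by
    rintro rfl
    exact hv fun u hu => by rw [h2 u hu, zero_smul]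
  refine ⟨c⁻¹ • v.1, fun x => ?_, fun w => U.smul_mem _ (h1 w), fun u hu => ?_⟩
  · have := congrArg Subtype.val (hv0 x)
    rw [hθ, adE_apply] at this
    exact Commute.smul_right (sub_eq_zero.1 this) _
  · rw [LinearMap.smul_apply, h2 u hu, smul_smul, inv_mul_cancel₀ hc, one_smul]

end compred
end Minu

set_option linter.all false
namespace Minu
open Module

section trarg
variable {F : Type} [Field F] [CharZero F] {E : Type} [Ring E] [Algebra F E]

theorem spread (τ : E →ₗ[F] F) (x b : E) (S : Submodule F E)
    (hS : ∀ u ∈ S, x * u - u * x ∈ S)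
    (hsum : ∀ u ∈ S, ∀ i, ∑ a ∈ Finset.range (i + 1), τ (x ^ a * u * x ^ (i - a) * b) = 0) :
    ∀ i, ∀ u ∈ S, ∀ a c, a + c = i → τ (x ^ a * u * x ^ c * b) = 0 := by
  intro i
  induction i with
  | zero =>
    intro u hu a c h
    obtain ⟨rfl, rfl⟩ : a = 0 ∧ c = 0 := by omega
    simpa using hsum u hu 0
  | succ i ih =>
    intro u hu
    have step : ∀ a c, a + c = i → τ (x ^ (a + 1) * u * x ^ c * b) =
        τ (x ^ a * u * x ^ (c + 1) * b) := by
      intro a c hac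
      have := ih _ (hS u hu) a c hac
      rw [← sub_eq_zero, ← map_sub, ← this]
      congr 1
      rw [pow_succ x a, pow_succ' x c]; noncomm_ring
    have all : ∀ a ≤ i + 1, τ (x ^ a * u * x ^ (i + 1 - a) * b) =
        τ (x ^ 0 * u * x ^ (i + 1) * b) := by
      intro a
      induction a with
      | zero => intro _; simp
      | succ a iha =>
        intro ha
        rw [← iha (by omega), step a (i + 1 - (a + 1)) (by omega)]
        congr 5; omega
    have h1 := hsum u hu (i + 1)
    rw [Finset.sum_congr rfl (fun a ha => all a (by simpa [Nat.lt_succ_iff] using ha))] at h1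
    rw [Finset.sum_const, Finset.card_range, nsmul_eq_mul] at h1
    have h2 := (mul_eq_zero.1 h1).resolve_left (Nat.cast_ne_zero.2 (Nat.succ_ne_zero _))
    intro a c hac
    rw [← h2, ← all a (by omega)]
    congr 4; omega

open Polynomial in
theorem poly_coeff (x u : E) (m : ℕ) : ((C x + C u * X : E[X]) ^ m).coeff 0 = x ^ m ∧
    ((C x + C u * X : E[X]) ^ (m + 1)).coeff 1 =
      ∑ a ∈ Finset.range (m + 1), x ^ a * u * x ^ (m - a) := by
  have h0 : ∀ m, ((C x + C u * X : E[X]) ^ m).coeff 0 = x ^ m := by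
    intro m
    induction m with
    | zero => simp
    | succ m ih => rw [pow_succ, mul_coeff_zero, ih]; simp [pow_succ]
  refine ⟨h0 m, ?_⟩
  induction m with
  | zero => simp
  | succ m ih =>
    rw [pow_succ, mul_coeff_one, ih, h0, Finset.sum_range_succ _ (m + 1)]
    simp only [coeff_add, coeff_C_zero, coeff_mul_X_zero, coeff_C_succ, coeff_mul_X, zero_add,
      add_zero, Nat.sub_self, pow_zero, mul_one]
    rw [add_comm, Finset.sum_mul]
    congr 1
    refine Finset.sum_congr rfl fun a ha => ?_
    have : m + 1 - a = (m - a) + 1 := by have := Finset.mem_range.1 ha; omega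
    rw [this, pow_succ]; noncomm_ring

open Polynomial in
theorem deriv_zero (τ : E →ₗ[F] F) (x u b : E) (m : ℕ)
    (h : ∀ r : F, τ ((x + r • u) ^ (m + 1) * b) = 0) :
    ∑ a ∈ Finset.range (m + 1), τ (x ^ a * u * x ^ (m - a) * b) = 0 := by
  set P : E[X] := (C x + C u * X : E[X]) ^ (m + 1) with hP
  let p : F[X] := ∑ k ∈ Finset.range (P.natDegree + 2), monomial k (τ (P.coeff k * b))
  have hp : p = 0 := by
    apply Polynomial.funext
    intro r
    rw [eval_zero, ← h r]
    let e : E[X] →+* E := eval₂RingHom' (RingHom.id E) (algebraMap F E r)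
      (fun a => (Algebra.commutes r a).symm)
    have heC : ∀ y, e (C y) = y := fun y => eval₂_C (RingHom.id E) _
    have heX : e X = algebraMap F E r := eval₂_X (RingHom.id E) _
    have he : e P = (x + r • u) ^ (m + 1) := by
      rw [hP, map_pow, map_add, map_mul]
      rw [heC, heC, heX, Algebra.smul_def, Algebra.commutes]
    have he2 : e P = ∑ k ∈ Finset.range (P.natDegree + 2), P.coeff k * (algebraMap F E r) ^ k := by
      change eval₂ (RingHom.id E) (algebraMap F E r) P = _
      rw [eval₂_eq_sum_range' (RingHom.id E) (n := P.natDegree + 2) (by omega)]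
      rfl
    rw [← he, he2, Finset.sum_mul, map_sum]
    simp only [p, eval_finset_sum, eval_monomial]
    refine Finset.sum_congr rfl fun k _ => ?_
    rw [← map_pow, ← Algebra.commutes, mul_assoc, ← Algebra.smul_def, map_smul, smul_eq_mul,
      mul_comm]
  have h1 : p.coeff 1 = τ (P.coeff 1 * b) := by
    simp only [p, finset_sum_coeff, coeff_monomial]
    rw [Finset.sum_ite_eq' (Finset.range (P.natDegree + 2)) 1, if_pos (by simp)]
  rw [hp, coeff_zero, hP, (poly_coeff x u m).2, Finset.sum_mul, map_sum] at h1
  exact h1.symm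

theorem telescope (w h : E) (i : ℕ) :
    ∑ a ∈ Finset.range (i + 1), h ^ a * (w * h - h * w) * h ^ (i - a) =
      w * h ^ (i + 1) - h ^ (i + 1) * w := by
  have := Finset.sum_range_sub' (fun a => h ^ a * w * h ^ (i + 1 - a)) (i + 1)
  simp only [pow_zero, one_mul, Nat.sub_zero, Nat.sub_self, mul_one] at this
  rw [← this]
  refine Finset.sum_congr rfl fun a ha => ?_
  have h1 : i + 1 - a = (i - a) + 1 := by have := Finset.mem_range.1 ha; omega
  have h2 : i + 1 - (a + 1) = i - a := by omega
  rw [h1, h2, pow_succ' h (i - a), pow_succ h a]; noncomm_ring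

/-- submodule of brackets with `h`. -/
def brh (h : E) (g : Submodule F E) : Submodule F E :=
  g.map (LinearMap.mulRight F h - LinearMap.mulLeft F h)

theorem mem_brh {h : E} {g : Submodule F E} {u : E} :
    u ∈ brh h g ↔ ∃ w ∈ g, w * h - h * w = u := by
  simp [brh]

theorem pow_br (g : Submodule F E) (hbr : ∀ x ∈ g, ∀ y ∈ g, x * y - y * x ∈ g)
    (w : E) (hw : w ∈ g) (j : ℕ) : ∀ b ∈ (1 ⊔ g) ^ j, b * w - w * b ∈ (1 ⊔ g) ^ j := by
  induction j with
  | zero =>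
    intro b hb
    rw [pow_zero, Submodule.mem_one] at hb ⊢
    obtain ⟨y, rfl⟩ := hb
    exact ⟨0, by rw [Algebra.commutes, sub_self, map_zero]⟩
  | succ j ih =>
    intro b hb
    rw [pow_succ'] at hb ⊢
    induction hb using Submodule.mul_induction_on' with
    | mem_mul_mem m hm n hn =>
      have e : m * n * w - w * (m * n) = m * (n * w - w * n) + (m * w - w * m) * n := by
        noncomm_ring
      rw [e]
      refine add_mem (Submodule.mul_mem_mul hm (ih n hn)) (Submodule.mul_mem_mul ?_ hn)
      obtain ⟨y, hy, z, hz, rfl⟩ := Submodule.mem_sup.1 hm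
      rw [Submodule.mem_one] at hy
      obtain ⟨y, rfl⟩ := hy
      have : (algebraMap F E y + z) * w - w * (algebraMap F E y + z) = z * w - w * z := by
        rw [add_mul, mul_add, Algebra.commutes]; abel
      rw [this]
      exact Submodule.mem_sup_right (hbr _ hz _ hw)
    | add x hx y hy h1 h2 =>
      have : (x + y) * w - w * (x + y) = (x * w - w * x) + (y * w - w * y) := by noncomm_ring
      rw [this]; exact add_mem h1 h2

theorem trace_argument (τ : E →ₗ[F] F) (g c : Submodule F E) (hcg : c ≤ g)
    (hg : ∀ x ∈ g, ∀ y ∈ g, x * y - y * x ∈ g) (hc : ∀ x ∈ c, ∀ y ∈ c, x * y - y * x ∈ c)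
    (hτ : ∀ w ∈ g, ∀ b, τ (w * b) = τ (b * w))
    (h : E) (hh : h ∈ c) (hgc : g ≤ c ⊔ brh h g)
    (hpow : ∀ x ∈ c, ∀ k, τ (x ^ k) = 0) :
    ∀ a ∈ Algebra.adjoin F (g : Set E), τ a = 0 := by
  -- step A
  have hA : ∀ l, ∀ b ∈ c ^ l, ∀ x ∈ c, ∀ i, τ (x ^ i * b) = 0 := by
    intro l
    induction l with
    | zero =>
      intro b hb x hx i
      rw [pow_zero, Submodule.mem_one] at hb
      obtain ⟨y, rfl⟩ := hb
      rw [← Algebra.commutes, ← Algebra.smul_def, map_smul, hpow x hx, smul_zero]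
    | succ l ih =>
      intro b hb
      rw [pow_succ'] at hb
      induction hb using Submodule.mul_induction_on' with
      | mem_mul_mem u hu b hb =>
        intro x hx i
        have := spread τ x b c (fun u hu => hc x hx u hu) (fun u hu i =>
          deriv_zero τ x u b i fun r => ih b hb _ (add_mem hx (c.smul_mem r hu)) _)
            i u hu i 0 (by omega)
        rw [← this, pow_zero, mul_one, mul_assoc]
      | add y hy z hz h1 h2 =>
        intro x hx i
        rw [mul_add, map_add, h1 x hx, h2 x hx, add_zero]
  set B : ℕ → Submodule F E := fun j => (1 ⊔ g) ^ j with hB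
  have hBsucc : ∀ j, B (j + 1) = (1 ⊔ g) * B j := fun j => pow_succ' _ _
  have hBle : ∀ j, B j ≤ B (j + 1) := by
    intro j b hb
    rw [hBsucc, ← one_mul b]
    exact Submodule.mul_mem_mul (Submodule.mem_sup_left (Submodule.mem_one.2 ⟨1, map_one _⟩)) hb
  have hgB : ∀ j, ∀ u ∈ g, ∀ b ∈ B j, u * b ∈ B (j + 1) := fun j u hu b hb => by
    rw [hBsucc]; exact Submodule.mul_mem_mul (Submodule.mem_sup_right hu) hb
  have hbrhg : brh h g ≤ g := by
    intro u hu
    obtain ⟨w, hw, rfl⟩ := mem_brh.1 hu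
    exact hg _ hw _ (hcg hh)
  -- decomposition
  have hdec : ∀ j, B (j + 1) ≤ c ^ (j + 1) ⊔ brh h g * B j ⊔ B j := by
    intro j
    have key : ∀ u ∈ c, ∀ b ∈ B j, u * b ∈ c ^ (j + 1) ⊔ brh h g * B j ⊔ B j := by
      induction j with
      | zero =>
        intro u hu b hb
        refine Submodule.mem_sup_left (Submodule.mem_sup_left ?_)
        rw [pow_succ']
        exact Submodule.mul_mem_mul hu hb
      | succ j ih =>
        have hstep : B (j + 1) ≤ c ^ (j + 1) ⊔ brh h g * B j ⊔ B j := by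
          rw [hBsucc]
          refine Submodule.mul_le.2 fun u hu b hb => ?_
          obtain ⟨y, hy, z, hz, rfl⟩ := Submodule.mem_sup.1 hu
          rw [add_mul]
          refine add_mem ?_ ?_
          · obtain ⟨y, rfl⟩ := Submodule.mem_one.1 hy
            rw [← Algebra.smul_def]
            exact Submodule.mem_sup_right ((B j).smul_mem y hb)
          · obtain ⟨p, hp, q, hq, rfl⟩ := Submodule.mem_sup.1 (hgc hz)
            rw [add_mul]
            exact add_mem (ih p hp b hb)
              (Submodule.mem_sup_left (Submodule.mem_sup_right (Submodule.mul_mem_mul hq hb)))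
        intro u hu b hb
        obtain ⟨y, hy, b2, hb2, rfl⟩ := Submodule.mem_sup.1 (hstep hb)
        obtain ⟨b0, hb0, b1, hb1, rfl⟩ := Submodule.mem_sup.1 hy
        rw [mul_add, mul_add]
        refine add_mem (add_mem ?_ ?_) ?_
        · refine Submodule.mem_sup_left (Submodule.mem_sup_left ?_)
          rw [pow_succ' c (j + 1)]
          exact Submodule.mul_mem_mul hu hb0
        · clear hb hy
          induction hb1 using Submodule.mul_induction_on' with
          | mem_mul_mem v hv b hb =>
            have : u * (v * b) = v * (u * b) + (u * v - v * u) * b := by noncomm_ring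
            rw [this]
            refine add_mem ?_ ?_
            · exact Submodule.mem_sup_left (Submodule.mem_sup_right (Submodule.mul_mem_mul hv
                (hgB j u (hcg hu) b hb)))
            · exact Submodule.mem_sup_right
                (hgB j _ (hg _ (hcg hu) _ (hbrhg hv)) b hb)
          | add y hy z hz h1 h2 => rw [mul_add]; exact add_mem h1 h2
        · exact Submodule.mem_sup_right (hgB j u (hcg hu) _ hb2)
    rw [hBsucc]
    refine Submodule.mul_le.2 fun u hu b hb => ?_
    obtain ⟨y, hy, z, hz, rfl⟩ := Submodule.mem_sup.1 hu
    rw [add_mul]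
    refine add_mem ?_ ?_
    · obtain ⟨y, rfl⟩ := Submodule.mem_one.1 hy
      rw [← Algebra.smul_def]
      exact Submodule.mem_sup_right ((B j).smul_mem y hb)
    · obtain ⟨p, hp, q, hq, rfl⟩ := Submodule.mem_sup.1 (hgc hz)
      rw [add_mul]
      exact add_mem (key p hp b hb)
        (Submodule.mem_sup_left (Submodule.mem_sup_right (Submodule.mul_mem_mul hq hb)))
  -- step B
  have hBz : ∀ j, ∀ b ∈ B j, ∀ i, τ (h ^ i * b) = 0 := by
    intro j
    induction j with
    | zero => exact fun b hb i => hA 0 b (by simpa [hB] using hb) h hh i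
    | succ j ih =>
      intro b hb
      obtain ⟨y, hy, b2, hb2, rfl⟩ := Submodule.mem_sup.1 (hdec j hb)
      obtain ⟨b0, hb0, b1, hb1, rfl⟩ := Submodule.mem_sup.1 hy
      intro i
      rw [mul_add, mul_add, map_add, map_add, ih _ hb2, hA _ _ hb0 h hh, zero_add, add_zero]
      clear hy hb
      induction hb1 using Submodule.mul_induction_on' with
      | mem_mul_mem u hu b hb =>
        have := spread τ h b (brh h g) (fun u hu => by
          rw [mem_brh]
          exact ⟨-u, neg_mem (hbrhg hu), by noncomm_ring⟩) (fun u hu i => by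
          obtain ⟨w, hw, rfl⟩ := mem_brh.1 hu
          rw [← map_sum, ← Finset.sum_mul, telescope, sub_mul, map_sub, mul_assoc w, hτ w hw,
            ← map_sub]
          have : h ^ (i + 1) * b * w - h ^ (i + 1) * w * b = h ^ (i + 1) * (b * w - w * b) := by
            noncomm_ring
          rw [this]
          exact ih _ (pow_br g hg w hw j b hb) _)
            i u hu i 0 (by omega)
        rw [← this, pow_zero, mul_one, mul_assoc]
      | add y hy z hz h1 h2 => rw [mul_add, map_add, h1, h2, add_zero]
  -- adjoin
  have hadj : ∀ a ∈ Algebra.adjoin F (g : Set E), ∃ j, a ∈ B j := by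
    intro a ha
    have hmono : Monotone B := monotone_nat_of_le_succ hBle
    induction ha using Algebra.adjoin_induction with
    | mem x hx =>
      exact ⟨1, by simp only [hB, pow_one]; exact Submodule.mem_sup_right hx⟩
    | algebraMap r => exact ⟨0, by simp [hB]⟩
    | add x y _ _ h1 h2 =>
      obtain ⟨i, hi⟩ := h1
      obtain ⟨j, hj⟩ := h2
      exact ⟨max i j, add_mem (hmono (le_max_left _ _) hi) (hmono (le_max_right _ _) hj)⟩
    | mul x y _ _ h1 h2 =>
      obtain ⟨i, hi⟩ := h1
      obtain ⟨j, hj⟩ := h2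
      exact ⟨i + j, by simp only [hB]; rw [pow_add]; exact Submodule.mul_mem_mul hi hj⟩
  intro a ha
  obtain ⟨j, hj⟩ := hadj a ha
  simpa using hBz j a hj 0

end trarg
end Minu

set_option linter.all false
namespace Minu
open Module

section density
variable {F : Type} [Field F] [CharZero F]
  {R : Type} [AddCommGroup R] [Module F R] [FiniteDimensional F R]

theorem semisimple_prod {A M N : Type} [Ring A] [AddCommGroup M] [AddCommGroup N] [Module A M]
    [Module A N] [IsSemisimpleModule A M] [IsSemisimpleModule A N] :
    IsSemisimpleModule A (M × N) := by
  have h1 : IsSemisimpleModule A (LinearMap.range (LinearMap.inl A M N)) :=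
    IsSemisimpleModule.range _
  have h2 : IsSemisimpleModule A (LinearMap.range (LinearMap.inr A M N)) :=
    IsSemisimpleModule.range _
  have h3 := IsSemisimpleModule.sup h1 h2
  rw [LinearMap.sup_range_inl_inr] at h3
  exact IsSemisimpleModule.congr (Submodule.topEquiv (R := A) (M := M × N)).symm

theorem end_hom (g : Submodule F (Module.End F R)) (U₁ U₂ : Submodule F R)
    (π₁ π₂ : Module.End F R)
    (hU₁ : ∀ x ∈ g, ∀ u ∈ U₁, x u ∈ U₁) (hU₂ : ∀ x ∈ g, ∀ u ∈ U₂, x u ∈ U₂)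
    (hne₁ : U₁ ≠ ⊥) (hne₂ : U₂ ≠ ⊥)
    (hs₁ : ∀ U ≤ U₁, (∀ x ∈ g, ∀ u ∈ U, x u ∈ U) → U = ⊥ ∨ U = U₁)
    (hs₂ : ∀ U ≤ U₂, (∀ x ∈ g, ∀ u ∈ U, x u ∈ U) → U = ⊥ ∨ U = U₂)
    (hc₁ : ∀ x ∈ g, Commute x π₁)
    (hr₁ : ∀ v, π₁ v ∈ U₁) (hr₂ : ∀ v, π₂ v ∈ U₂)
    (hi₁ : ∀ u ∈ U₁, π₁ u = u) (hi₂ : ∀ u ∈ U₂, π₂ u = u)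
    (d₁ d₂ : F) (hd₂ : d₂ ≠ 0)
    (htr : ∀ a ∈ Algebra.adjoin F (g : Set (Module.End F R)),
      d₂ * LinearMap.trace F R (a * π₁) = d₁ * LinearMap.trace F R (a * π₂)) :
    ∃ ψ : Module.End F R, ψ ≠ 0 ∧ (∀ x ∈ g, Commute x ψ) ∧ (∀ v, ψ v ∈ U₂) ∧
      ∀ v, ψ (π₁ v) = ψ v := by
  classical
  let A := Algebra.adjoin F (g : Set (Module.End F R))
  have hmem : ∀ U : Submodule F R, (∀ x ∈ g, ∀ u ∈ U, x u ∈ U) → ∀ a : A, ∀ u ∈ U, a.1 u ∈ U := by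
    rintro U hU ⟨a, ha⟩
    induction ha using Algebra.adjoin_induction with
    | mem x hx => exact hU x hx
    | algebraMap r => exact fun u hu => U.smul_mem r hu
    | add x y _ _ h1 h2 => exact fun u hu => U.add_mem (h1 u hu) (h2 u hu)
    | mul x y _ _ h1 h2 => exact fun u hu => h1 _ (h2 u hu)
  let mk : ∀ U : Submodule F R, (∀ x ∈ g, ∀ u ∈ U, x u ∈ U) → Submodule A R := fun U hU =>
    { carrier := U
      add_mem' := fun h1 h2 => U.add_mem h1 h2
      zero_mem' := U.zero_mem
      smul_mem' := fun a u hu => hmem U hU a u hu }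
  have simple : ∀ U : Submodule F R, ∀ hU : (∀ x ∈ g, ∀ u ∈ U, x u ∈ U), U ≠ ⊥ →
      (∀ U' ≤ U, (∀ x ∈ g, ∀ u ∈ U', x u ∈ U') → U' = ⊥ ∨ U' = U) →
      IsSimpleModule A (mk U hU) := by
    intro U hU hne hs
    rw [isSimpleModule_iff_isAtom]
    constructor
    · intro h
      apply hne
      rw [eq_bot_iff]
      intro u hu
      have : u ∈ mk U hU := hu
      rw [h] at this
      simpa using this
    · intro N hN
      have h1 : N.restrictScalars F ≤ U := fun u hu => hN.le hu
      rcases hs _ h1 (fun x hx u hu => N.smul_mem (⟨x, Algebra.subset_adjoin hx⟩ : A) hu) with h | h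
      · rw [eq_bot_iff]
        intro u hu
        have : u ∈ N.restrictScalars F := hu
        rw [h] at this
        simpa using this
      · exfalso
        apply hN.not_ge
        intro u hu
        have : u ∈ N.restrictScalars F := by rw [h]; exact hu
        exact this
  let M₁ := mk U₁ hU₁
  let M₂ := mk U₂ hU₂
  haveI : IsSimpleModule A M₁ := simple U₁ hU₁ hne₁ hs₁
  haveI : IsSimpleModule A M₂ := simple U₂ hU₂ hne₂ hs₂
  by_cases hψ : ∃ ψ : M₁ →ₗ[A] M₂, ψ ≠ 0
  · obtain ⟨ψ, hψ⟩ := hψ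
    have hA : ∀ x (hx : x ∈ g) (v : R) (hv : v ∈ U₁) (hv' : x v ∈ U₁),
        (ψ ⟨x v, hv'⟩ : R) = x (ψ ⟨v, hv⟩ : R) := by
      intro x hx v hv hv'
      exact congrArg Subtype.val (ψ.map_smul (⟨x, Algebra.subset_adjoin hx⟩ : A) ⟨v, hv⟩)
    let f : Module.End F R :=
      { toFun := fun v => (ψ ⟨π₁ v, hr₁ v⟩ : R)
        map_add' := fun v w => by
          rw [← Submodule.coe_add, ← map_add]; congr 2
          exact Subtype.ext (map_add π₁ v w)
        map_smul' := fun c v => by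
          have := ψ.map_smul (algebraMap F A c) ⟨π₁ v, hr₁ v⟩
          have h2 := congrArg Subtype.val this
          change _ = c • (ψ ⟨π₁ v, hr₁ v⟩ : R) at h2
          rw [RingHom.id_apply, ← h2]
          congr 2
          exact Subtype.ext (map_smul π₁ c v) }
    have hf : ∀ v, f v = (ψ ⟨π₁ v, hr₁ v⟩ : R) := fun v => rfl
    refine ⟨f, ?_, ?_, fun v => (ψ ⟨π₁ v, hr₁ v⟩).2, ?_⟩
    · intro h0
      apply hψ
      ext ⟨u, hu⟩
      have := LinearMap.congr_fun h0 u
      rw [hf] at this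
      simp only [hi₁ u hu] at this
      exact this
    · intro x hx
      refine LinearMap.ext fun v => ?_
      rw [Module.End.mul_apply, Module.End.mul_apply, hf, hf]
      have hcv : π₁ (x v) = x (π₁ v) := (LinearMap.congr_fun (hc₁ x hx).eq v).symm
      simp only [hcv]
      exact (hA x hx _ _ _).symm
    · intro v
      rw [hf, hf]; simp only [hi₁ _ (hr₁ v)]
  · push Not at hψ
    exfalso
    have hψ' : ∀ ψ : M₂ →ₗ[A] M₁, ψ = 0 := by
      intro ψ
      by_contra hne
      let e := LinearEquiv.ofBijective ψ (LinearMap.bijective_of_ne_zero hne)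
      have := hψ e.symm.toLinearMap
      apply hne
      ext m
      have h2 := LinearMap.congr_fun this (ψ m)
      have h3 : e.symm (ψ m) = m := e.symm_apply_apply m
      have h4 : m = 0 := by rw [← h3]; exact h2
      rw [h4]; simp
    haveI : IsSemisimpleModule A (M₁ × M₂) := semisimple_prod
    let f : Module.End (Module.End A (M₁ × M₂)) (M₁ × M₂) :=
      { toFun := fun m => (m.1, 0)
        map_add' := fun m m' => by ext <;> simp
        map_smul' := fun φ m => by
          have e1 := LinearMap.congr_fun
            (hψ ((LinearMap.snd A M₁ M₂) ∘ₗ φ ∘ₗ (LinearMap.inl A M₁ M₂))) m.1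
          have e2 := LinearMap.congr_fun
            (hψ' ((LinearMap.fst A M₁ M₂) ∘ₗ φ ∘ₗ (LinearMap.inr A M₁ M₂))) m.2
          simp only [LinearMap.comp_apply, LinearMap.zero_apply, LinearMap.snd_apply,
            LinearMap.fst_apply, LinearMap.inl_apply, LinearMap.inr_apply] at e1 e2
          have e3 : φ m = φ (m.1, 0) + φ (0, m.2) := by rw [← map_add]; simp
          simp only [RingHom.id_apply, Module.End.smul_def]
          ext
          · rw [e3]; simp [e2]
          · simp [e1] }
    let s : Finset (M₁ × M₂) :=
      Finset.image (fun i => ((⟨(Module.finBasis F U₁ i : R), (Module.finBasis F U₁ i).2⟩, 0) :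
        M₁ × M₂)) Finset.univ ∪
      Finset.image (fun i => ((0, ⟨(Module.finBasis F U₂ i : R), (Module.finBasis F U₂ i).2⟩) :
        M₁ × M₂)) Finset.univ
    obtain ⟨a, ha⟩ := jacobson_density f s
    have ha1 : ∀ u ∈ U₁, a.1 u = u := by
      intro u hu
      have : ∀ i, a.1 (Module.finBasis F U₁ i : R) = (Module.finBasis F U₁ i : R) := by
        intro i
        have := ha (⟨(Module.finBasis F U₁ i : R), (Module.finBasis F U₁ i).2⟩, 0)
          (Finset.mem_union_left _ (Finset.mem_image_of_mem _ (Finset.mem_univ i)))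
        exact (congrArg (fun m : M₁ × M₂ => (m.1 : R)) this).symm
      have h2 : a.1 ∘ₗ U₁.subtype = U₁.subtype := (Module.finBasis F U₁).ext fun i => this i
      exact LinearMap.congr_fun h2 ⟨u, hu⟩
    have ha2 : ∀ u ∈ U₂, a.1 u = 0 := by
      intro u hu
      have : ∀ i, a.1 (Module.finBasis F U₂ i : R) = 0 := by
        intro i
        have := ha (0, ⟨(Module.finBasis F U₂ i : R), (Module.finBasis F U₂ i).2⟩)
          (Finset.mem_union_right _ (Finset.mem_image_of_mem _ (Finset.mem_univ i)))
        exact (congrArg (fun m : M₁ × M₂ => (m.2 : R)) this).symm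
      have h2 : a.1 ∘ₗ U₂.subtype = 0 := (Module.finBasis F U₂).ext fun i => this i
      exact LinearMap.congr_fun h2 ⟨u, hu⟩
    have h := htr a.1 a.2
    have e1 : a.1 * π₁ = π₁ := LinearMap.ext fun v => ha1 _ (hr₁ v)
    have e2 : a.1 * π₂ = 0 := LinearMap.ext fun v => ha2 _ (hr₂ v)
    rw [e1, e2, map_zero, mul_zero, LinearMap.IsProj.trace (p := U₁) ⟨hr₁, hi₁⟩] at h
    rcases mul_eq_zero.1 h with h | h
    · exact hd₂ h
    · exact hne₁ (Submodule.finrank_eq_zero.1 (by exact_mod_cast h))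

end density
end Minu

set_option linter.all false
namespace Minu
open Module

section ag
variable {F : Type} [Field F] {Γ : Type} [Group Γ]

/-- abstract coordinate rings of algebraic groups -/
structure AG (A : Subalgebra F (Γ → F)) : Prop where
  comul : ∀ f : A, ∃ (s : ℕ) (a b : Fin s → A), ∀ g h : Γ,
    (f : Γ → F) (g * h) = ∑ i, (a i : Γ → F) g * (b i : Γ → F) h
  noeth : IsNoetherianRing A
  pts : ∀ χ : A →ₐ[F] F, ∃ g : Γ, ∀ f : A, χ f = (f : Γ → F) g
  conn : ∀ C₁ C₂ : Set A,
    (∀ g : Γ, (∀ f ∈ C₁, (f : Γ → F) g = 0) ∨ (∀ f ∈ C₂, (f : Γ → F) g = 0)) →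
    (∃ g : Γ, ∀ f ∈ C₁, (f : Γ → F) g = 0) → (∃ g : Γ, ∀ f ∈ C₂, (f : Γ → F) g = 0) →
    ∃ g : Γ, (∀ f ∈ C₁, (f : Γ → F) g = 0) ∧ (∀ f ∈ C₂, (f : Γ → F) g = 0)

variable {A : Subalgebra F (Γ → F)}

theorem AG.left_mem (H : AG A) (g : Γ) (f : A) : (fun h => (f : Γ → F) (g * h)) ∈ A := by
  obtain ⟨s, a, b, hab⟩ := H.comul f
  have : (fun h => (f : Γ → F) (g * h)) =
      ∑ i, ((a i : Γ → F) g) • (b i : Γ → F) := by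
    funext h; simp [hab, Finset.sum_apply]
  rw [this]
  exact sum_mem fun i _ => A.smul_mem (b i).2 _

theorem AG.right_mem (H : AG A) (g : Γ) (f : A) : (fun h => (f : Γ → F) (h * g)) ∈ A := by
  obtain ⟨s, a, b, hab⟩ := H.comul f
  have : (fun h => (f : Γ → F) (h * g)) =
      ∑ i, ((b i : Γ → F) g) • (a i : Γ → F) := by
    funext h; simp [hab, Finset.sum_apply, mul_comm]
  rw [this]
  exact sum_mem fun i _ => A.smul_mem (a i).2 _

/-- evaluation -/
def evA (A : Subalgebra F (Γ → F)) (g : Γ) : A →ₐ[F] F :=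
  (Pi.evalAlgHom F (fun _ : Γ => F) g).comp A.val

@[simp] theorem evA_apply (g : Γ) (f : A) : evA A g f = (f : Γ → F) g := rfl

/-- left translation -/
def lam (H : AG A) (g : Γ) : A →ₐ[F] A where
  toFun f := ⟨fun h => (f : Γ → F) (g * h), H.left_mem g f⟩
  map_one' := rfl
  map_mul' _ _ := rfl
  map_zero' := rfl
  map_add' _ _ := rfl
  commutes' _ := rfl

@[simp] theorem lam_apply (H : AG A) (g h : Γ) (f : A) :
    (lam H g f : Γ → F) h = (f : Γ → F) (g * h) := rfl

/-- right translation -/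
def rho (H : AG A) (g : Γ) : A →ₐ[F] A where
  toFun f := ⟨fun h => (f : Γ → F) (h * g), H.right_mem g f⟩
  map_one' := rfl
  map_mul' _ _ := rfl
  map_zero' := rfl
  map_add' _ _ := rfl
  commutes' _ := rfl

@[simp] theorem rho_apply (H : AG A) (g h : Γ) (f : A) :
    (rho H g f : Γ → F) h = (f : Γ → F) (h * g) := rfl

/-- point derivation at the identity -/
def IsPD (δ : A →ₗ[F] F) : Prop :=
  ∀ f g : A, δ (f * g) = (f : Γ → F) 1 * δ g + δ f * (g : Γ → F) 1

/-- left invariant derivation -/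
structure LID (H : AG A) (D : A →ₗ[F] A) : Prop where
  leib : ∀ f g : A, D (f * g) = D f * g + f * D g
  inv : ∀ g f, D (lam H g f) = lam H g (D f)

theorem LID.app (H : AG A) {D : A →ₗ[F] A} (hD : LID H D) (f : A) (g : Γ) :
    (D f : Γ → F) g = (D (lam H g f) : Γ → F) 1 := by
  rw [hD.inv]; simp

/-- derivation of a point derivation -/
def Dd (H : AG A) (δ : A →ₗ[F] F) : A →ₗ[F] A where
  toFun f := ⟨fun g => δ (lam H g f), by
    obtain ⟨s, a, b, hab⟩ := H.comul f
    have : (fun g => δ (lam H g f)) = ∑ i, (δ (b i)) • (a i : Γ → F) := by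
      funext g
      have : lam H g f = ∑ i, (a i : Γ → F) g • b i := by
        ext h; simp [hab, Finset.sum_apply]
      rw [this]; simp [mul_comm]
    rw [this]
    exact sum_mem fun i _ => A.smul_mem (a i).2 _⟩
  map_add' f g := by ext h; simp
  map_smul' c f := by ext h; simp

@[simp] theorem Dd_apply (H : AG A) (δ : A →ₗ[F] F) (f : A) (g : Γ) :
    (Dd H δ f : Γ → F) g = δ (lam H g f) := rfl

theorem lam_one (H : AG A) (f : A) : lam H 1 f = f := by ext; simp
theorem lam_mul (H : AG A) (g h : Γ) (f : A) : lam H g (lam H h f) = lam H (h * g) f := by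
  ext; simp [mul_assoc]

theorem Dd_LID (H : AG A) {δ : A →ₗ[F] F} (hδ : IsPD δ) : LID H (Dd H δ) where
  leib f g := by
    ext h
    simp [hδ _ _]
    ring
  inv g f := by
    ext h
    simp [lam_mul]

theorem LID.pd (H : AG A) {D : A →ₗ[F] A} (hD : LID H D) :
    IsPD ((evA A 1).toLinearMap ∘ₗ D) := by
  intro f g
  simp [hD.leib]
  ring

/-! density -/

/-- the maximal ideal of the identity -/
def mI (A : Subalgebra F (Γ → F)) : Ideal A := RingHom.ker (evA A 1).toRingHom

theorem mem_mI {f : A} : f ∈ mI A ↔ (f : Γ → F) 1 = 0 := Iff.rfl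

theorem sub_const_mem (f : A) : f - algebraMap F A ((f : Γ → F) 1) ∈ mI A := by
  rw [mem_mI]
  simp [Algebra.algebraMap_eq_smul_one]

theorem exists_euler (H : AG A) : ∃ (r : ℕ) (x : Fin r → A) (δ : Fin r → A →ₗ[F] F),
    (∀ i, x i ∈ mI A) ∧ (∀ i, IsPD (δ i)) ∧
    ∀ f ∈ mI A, f - ∑ i, δ i f • x i ∈ (mI A)^2 := by
  haveI := H.noeth
  obtain ⟨t, ht⟩ := (isNoetherianRing_iff_ideal_fg A).1 H.noeth (mI A)
  let W : Submodule F A := ((mI A)^2).restrictScalars F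
  let Q : Submodule F (A ⧸ W) := Submodule.map W.mkQ ((mI A).restrictScalars F)
  have hmul : ∀ f g, f ∈ mI A → g ∈ mI A → W.mkQ (f * g) = 0 := by
    intro f g hf hg
    rw [Submodule.mkQ_apply, Submodule.Quotient.mk_eq_zero]
    show f * g ∈ (mI A)^2
    rw [pow_two]; exact Ideal.mul_mem_mul hf hg
  have hQ : Q ≤ Submodule.span F (W.mkQ '' (t : Set A)) := by
    rintro _ ⟨f, hf, rfl⟩
    have hf : f ∈ mI A := hf
    rw [← ht] at hf
    refine Submodule.span_induction (p := fun f _ => W.mkQ f ∈ Submodule.span F (W.mkQ '' (t : Set A)))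
      ?_ ?_ ?_ ?_ hf
    · intro x hx; exact Submodule.subset_span ⟨x, hx, rfl⟩
    · simp
    · intro x y _ _ hx hy; rw [map_add]; exact add_mem hx hy
    · intro a x hx' hx
      have h1 : a • x = (a - algebraMap F A ((a : Γ → F) 1)) * x + ((a : Γ → F) 1) • x := by
        rw [sub_mul, smul_eq_mul, Algebra.smul_def ((a : Γ → F) 1) x]; ring
      rw [h1, map_add, hmul _ _ (sub_const_mem a) (by rw [← ht]; exact hx'), zero_add, map_smul]
      exact Submodule.smul_mem _ _ hx
  haveI : FiniteDimensional F (Submodule.span F (W.mkQ '' (t : Set A))) :=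
    FiniteDimensional.span_of_finite F ((t.finite_toSet).image _)
  haveI : FiniteDimensional F Q := Submodule.finiteDimensional_of_le hQ
  haveI : Module.Free F Q := Module.Free.of_divisionRing F Q
  let b := Module.finBasis F Q
  have hl : ∀ i, ∃ x ∈ mI A, W.mkQ x = (b i : A ⧸ W) := fun i => (b i).2
  choose x hx hxb using hl
  -- the functional
  let pr : A →ₗ[F] A := LinearMap.id - (Algebra.linearMap F A) ∘ₗ (evA A 1).toLinearMap
  have hpr : ∀ f, pr f = f - algebraMap F A ((f : Γ → F) 1) := fun f => rfl
  let qq : A →ₗ[F] Q := LinearMap.codRestrict Q (W.mkQ ∘ₗ pr) (fun f =>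
    ⟨pr f, by rw [hpr]; exact sub_const_mem f, rfl⟩)
  have hqq : ∀ f, (qq f : A ⧸ W) = W.mkQ (pr f) := fun f => rfl
  refine ⟨_, x, fun i => b.coord i ∘ₗ qq, hx, ?_, ?_⟩
  · intro i f g
    have h1 : qq (f * g) = (f : Γ → F) 1 • qq g + (g : Γ → F) 1 • qq f := by
      apply Subtype.ext
      rw [Submodule.coe_add, Submodule.coe_smul, Submodule.coe_smul, hqq, hqq, hqq, ← map_smul W.mkQ,
        ← map_smul W.mkQ, ← map_add W.mkQ, ← sub_eq_zero, ← map_sub W.mkQ]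
      have h2 : pr (f * g) - ((f : Γ → F) 1 • pr g + (g : Γ → F) 1 • pr f) = pr f * pr g := by
        simp only [hpr, Algebra.smul_def, map_mul, Subalgebra.coe_mul, Pi.mul_apply]; ring
      rw [h2]
      exact hmul _ _ (by rw [hpr]; exact sub_const_mem f) (by rw [hpr]; exact sub_const_mem g)
    simp only [LinearMap.comp_apply, h1, map_add, map_smul, smul_eq_mul]
    ring
  · intro f hf
    have h1 : W.mkQ f = (qq f : A ⧸ W) := by
      rw [hqq, hpr, mem_mI.1 hf]; simp
    have h2 := b.sum_repr (qq f)
    have h3 := congrArg (Subtype.val) h2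
    rw [← h1] at h3
    have h4 : W.mkQ (f - ∑ i, (b.coord i ∘ₗ qq) f • x i) = 0 := by
      rw [map_sub, map_sum, ← h3, sub_eq_zero, Submodule.coe_sum]
      simp [hxb]
    rw [Submodule.mkQ_apply, Submodule.Quotient.mk_eq_zero] at h4
    exact h4

theorem mem_pow_all [CharZero F] (H : AG A) (S : Submodule F A)
    (hS : ∀ D, LID H D → ∀ f ∈ S, D f ∈ S) (h1 : ∀ f ∈ S, (f : Γ → F) 1 = 0) (k : ℕ) :
    ∀ f ∈ S, f ∈ (mI A)^k := by
  obtain ⟨r, x, δ, hx, hδ, hd⟩ := exists_euler H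
  let E : A → A := fun f => ∑ i, x i * Dd H (δ i) f
  have hE : ∀ f g, E (f * g) = E f * g + f * E g := by
    intro f g
    simp only [E, (Dd_LID H (hδ _)).leib, Finset.sum_mul, Finset.mul_sum, ← Finset.sum_add_distrib]
    refine Finset.sum_congr rfl fun i _ => ?_
    ring
  have hEa : ∀ f g, E (f + g) = E f + E g := by
    intro f g
    simp only [E, map_add, mul_add, Finset.sum_add_distrib]
  have hE1 : ∀ f ∈ mI A, E f - f ∈ (mI A)^2 := by
    intro f hf
    have h2 : E f - ∑ i, δ i f • x i ∈ (mI A)^2 := by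
      rw [← Finset.sum_sub_distrib]
      refine sum_mem fun i _ => ?_
      have : x i * Dd H (δ i) f - δ i f • x i = x i * (Dd H (δ i) f -
          algebraMap F A ((Dd H (δ i) f : Γ → F) 1)) := by
        rw [Dd_apply, lam_one, Algebra.smul_def]; ring
      rw [this, pow_two]
      exact Ideal.mul_mem_mul (hx i) (sub_const_mem _)
    have := sub_mem h2 (hd f hf)
    convert this using 1
    ring
  have hEk : ∀ k, ∀ f ∈ (mI A)^(k+1), E f - ((k+1 : ℕ) : A) * f ∈ (mI A)^(k+2) := by
    intro k
    induction k with
    | zero => intro f hf; simpa using hE1 f (by simpa using hf)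
    | succ k ih =>
      intro f hf
      rw [pow_succ] at hf
      refine Submodule.mul_induction_on hf ?_ ?_
      · intro a ha b hb
        have e : E (a * b) - ((k+1+1 : ℕ) : A) * (a * b) =
          (E a - ((k+1 : ℕ) : A) * a) * b + a * (E b - b) := by
          rw [hE]; push_cast; ring
        rw [e]
        refine add_mem ?_ ?_
        · rw [show k + 1 + 2 = (k+2)+1 by ring, pow_succ]
          exact Ideal.mul_mem_mul (ih a ha) hb
        · rw [show k + 1 + 2 = (k+1)+2 by ring, pow_add]
          exact Ideal.mul_mem_mul ha (hE1 b hb)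
      · intro a b ha hb
        have := add_mem ha hb
        convert this using 1
        rw [hEa]; ring
  have key : ∀ k, ∀ f ∈ S, f ∈ (mI A)^(k+1) := by
    intro k
    induction k with
    | zero => intro f hf; rw [zero_add, pow_one]; exact h1 f hf
    | succ k ih =>
      intro f hf
      have a1 : E f ∈ (mI A)^(k+2) := by
        refine sum_mem fun i _ => ?_
        rw [show k+2 = (k+1)+1 by ring, pow_succ']
        exact Ideal.mul_mem_mul (hx i) (ih _ (hS _ (Dd_LID H (hδ i)) f hf))
      have a2 := sub_mem a1 (hEk k f (ih f hf))
      rw [sub_sub_cancel] at a2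
      have a3 := Ideal.mul_mem_left _ (algebraMap F A (((k+1 : ℕ) : F)⁻¹)) a2
      rw [← mul_assoc, ← map_natCast (algebraMap F A), ← map_mul, inv_mul_cancel₀, map_one, one_mul] at a3
      · exact a3
      · exact_mod_cast Nat.succ_ne_zero k
  intro f hf
  cases k with
  | zero => simp
  | succ k => exact key k f hf

theorem exists_annih (H : AG A) : ∃ u : A, (u : Γ → F) 1 = 1 ∧
    ∀ f, (∀ k, f ∈ (mI A)^k) → u * f = 0 := by
  haveI := H.noeth
  let K : Ideal A := ⨅ k : ℕ, (mI A)^k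
  have hK : K ≤ mI A • K := by
    intro f hf
    have : f ∈ (⨅ i : ℕ, (mI A)^i • (⊤ : Submodule A A)) := by
      simpa [K] using hf
    rw [Ideal.mem_iInf_smul_pow_eq_bot_iff] at this
    obtain ⟨r, hr⟩ := this
    rw [← hr]
    exact Submodule.smul_mem_smul r.2 hf
  obtain ⟨r, hr1, hr2⟩ := Submodule.exists_sub_one_mem_and_smul_eq_zero_of_fg_of_le_smul (mI A) K
    ((isNoetherianRing_iff_ideal_fg A).1 H.noeth K) hK
  refine ⟨r, ?_, fun f hf => hr2 f (by simpa [K, Submodule.mem_iInf] using hf)⟩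
  have := mem_mI.1 hr1
  simpa [sub_eq_zero] using this

theorem vanish [CharZero F] (H : AG A) (S : Submodule F A)
    (hS : ∀ D, LID H D → ∀ f ∈ S, D f ∈ S) (h1 : ∀ f ∈ S, (f : Γ → F) 1 = 0) :
    ∀ f ∈ S, ∀ g, (f : Γ → F) g = 0 := by
  by_contra hcon
  push Not at hcon
  obtain ⟨f₀, hf₀, g₀, hg₀⟩ := hcon
  obtain ⟨u, hu1, hu⟩ := exists_annih H
  have hun : ∀ g : Γ, (∀ f ∈ (S : Set A), (f : Γ → F) g = 0) ∨
      (∀ w ∈ {w : A | ∀ f ∈ S, w * f = 0}, (w : Γ → F) g = 0) := by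
    intro g
    by_cases hg : ∀ f ∈ (S : Set A), (f : Γ → F) g = 0
    · exact Or.inl hg
    · right
      push Not at hg
      obtain ⟨f, hf, hfg⟩ := hg
      intro w hw
      have := congrArg (fun f : A => (f : Γ → F) g) (hw f hf)
      simpa [hfg] using this
  obtain ⟨g, hg1, hg2⟩ := H.conn (S : Set A) {w | ∀ f ∈ S, w * f = 0} hun ⟨1, h1⟩ ⟨g₀, fun w hw => by
    have := congrArg (fun f : A => (f : Γ → F) g₀) (hw f₀ hf₀)
    simpa [hg₀] using this⟩
  · -- contradiction
    let S' : Submodule F A := S.map (lam H g).toLinearMap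
    have hS' := mem_pow_all H S' (by
      rintro D hD _ ⟨f, hf, rfl⟩
      exact ⟨D f, hS D hD f hf, (hD.inv g f).symm⟩) (by
      rintro _ ⟨f, hf, rfl⟩
      simpa using hg1 f hf)
    have h3 : ∀ f ∈ S, lam H g⁻¹ u * f = 0 := by
      intro f hf
      have h4 := hu (lam H g f) (fun k => hS' k _ ⟨f, hf, rfl⟩)
      have h5 := congrArg (lam H g⁻¹) h4
      rw [map_mul, lam_mul, mul_inv_cancel, lam_one, map_zero] at h5
      exact h5
    have h6 := hg2 _ h3
    simp [hu1] at h6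

end ag
end Minu

set_option linter.all false
namespace Minu
open Module

section rep
variable {F : Type} [Field F] {Γ : Type} [Group Γ] {A : Subalgebra F (Γ → F)}
  {R : Type} [AddCommGroup R] [Module F R]

/-- algebraic representation -/
def IsAlgR (A : Subalgebra F (Γ → F)) (σ : Γ →* Module.End F R) : Prop :=
  ∀ (ℓ : Module.Dual F R) (v : R), (fun g => ℓ (σ g v)) ∈ A

variable {σ : Γ →* Module.End F R}

/-- matrix coefficients -/
def cf (hσ : IsAlgR A σ) (ℓ : Module.Dual F R) : R →ₗ[F] A where
  toFun v := ⟨fun g => ℓ (σ g v), hσ ℓ v⟩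
  map_add' v w := by ext g; simp
  map_smul' c v := by ext g; simp

@[simp] theorem cf_apply (hσ : IsAlgR A σ) (ℓ : Module.Dual F R) (v : R) (g : Γ) :
    (cf hσ ℓ v : Γ → F) g = ℓ (σ g v) := rfl

theorem lam_cf (H : AG A) (hσ : IsAlgR A σ) (ℓ : Module.Dual F R) (v : R) (g : Γ) :
    lam H g (cf hσ ℓ v) = cf hσ (ℓ ∘ₗ σ g) v := by
  ext h; simp

theorem rho_cf (H : AG A) (hσ : IsAlgR A σ) (ℓ : Module.Dual F R) (v : R) (g : Γ) :
    rho H g (cf hσ ℓ v) = cf hσ ℓ (σ g v) := by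
  ext h; simp

/-- `x` is the operator of the left invariant derivation `D` -/
def Op (hσ : IsAlgR A σ) (D : A →ₗ[F] A) (x : Module.End F R) : Prop :=
  ∀ ℓ v, D (cf hσ ℓ v) = cf hσ ℓ (x v)

/-- The Lie algebra -/
def LieA (H : AG A) (hσ : IsAlgR A σ) : Submodule F (Module.End F R) where
  carrier := {x | ∃ D, LID H D ∧ Op hσ D x}
  zero_mem' := ⟨0, ⟨by simp, by simp⟩, fun ℓ v => by simp⟩
  add_mem' := by
    rintro x y ⟨D, hD, hx⟩ ⟨D', hD', hy⟩
    refine ⟨D + D', ⟨fun f g => ?_, fun g f => ?_⟩, fun ℓ v => ?_⟩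
    · simp [hD.leib, hD'.leib]; ring
    · simp [hD.inv, hD'.inv]
    · simp [hx ℓ v, hy ℓ v]
  smul_mem' := by
    rintro c x ⟨D, hD, hx⟩
    refine ⟨c • D, ⟨fun f g => ?_, fun g f => ?_⟩, fun ℓ v => ?_⟩
    · simp [hD.leib]
    · simp [hD.inv]
    · simp [hx ℓ v]

theorem mem_LieA {H : AG A} {hσ : IsAlgR A σ} {x : Module.End F R} :
    x ∈ LieA H hσ ↔ ∃ D, LID H D ∧ Op hσ D x := Iff.rfl

theorem LieA_bracket {H : AG A} {hσ : IsAlgR A σ} {x y : Module.End F R}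
    (hx : x ∈ LieA H hσ) (hy : y ∈ LieA H hσ) : x * y - y * x ∈ LieA H hσ := by
  obtain ⟨D, hD, hx⟩ := hx
  obtain ⟨D', hD', hy⟩ := hy
  refine ⟨D ∘ₗ D' - D' ∘ₗ D, ⟨fun f g => ?_, fun g f => ?_⟩, fun ℓ v => ?_⟩
  · simp [hD.leib, hD'.leib]; ring
  · simp [hD.inv, hD'.inv]
  · simp [hx ℓ _, hy ℓ _]

theorem exists_op [FiniteDimensional F R] (H : AG A) (hσ : IsAlgR A σ) {D : A →ₗ[F] A}
    (hD : LID H D) : ∃ x, Op hσ D x := by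
  let b := Module.finBasis F R
  let x : Module.End F R := ∑ i, ((evA A 1).toLinearMap ∘ₗ D ∘ₗ cf hσ (b.coord i)).smulRight (b i)
  have hx : ∀ ℓ v, ℓ (x v) = (D (cf hσ ℓ v) : Γ → F) 1 := by
    intro ℓ v
    have h1 : cf hσ ℓ v = ∑ i, ℓ (b i) • cf hσ (b.coord i) v := by
      ext g
      have := congrArg ℓ (b.sum_repr (σ g v))
      rw [map_sum] at this
      simp only [map_smul, smul_eq_mul] at this
      simp [← this, Finset.sum_apply, mul_comm]
    rw [h1, map_sum]
    simp [x, LinearMap.sum_apply, Finset.sum_apply, mul_comm]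
  refine ⟨x, fun ℓ v => ?_⟩
  ext g
  rw [hD.app H, lam_cf, ← hx]
  simp

section dens
variable [CharZero F] [FiniteDimensional F R]

theorem stable_of_lie (H : AG A) (hσ : IsAlgR A σ) (U : Submodule F R)
    (hU : ∀ x ∈ LieA H hσ, ∀ u ∈ U, x u ∈ U) : ∀ g, ∀ u ∈ U, σ g u ∈ U := by
  have := vanish H (Submodule.span F {f | ∃ ℓ ∈ U.dualAnnihilator, ∃ u ∈ U, f = cf hσ ℓ u}) ?_ ?_
  · intro g u hu
    have hh : ∀ ℓ ∈ U.dualAnnihilator, ℓ (σ g u) = 0 := fun ℓ hℓ => by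
      simpa using this (cf hσ ℓ u) (Submodule.subset_span ⟨ℓ, hℓ, u, hu, rfl⟩) g
    have := (Submodule.mem_dualCoannihilator (σ g u)).2 hh
    rwa [Subspace.dualAnnihilator_dualCoannihilator_eq] at this
  · intro D hD f hf
    obtain ⟨x, hx⟩ := exists_op H hσ hD
    refine Submodule.span_induction (p := fun f _ => D f ∈ _) ?_ ?_ ?_ ?_ hf
    · rintro _ ⟨ℓ, hℓ, u, hu, rfl⟩
      exact Submodule.subset_span ⟨ℓ, hℓ, x u, hU x ⟨D, hD, hx⟩ u hu, hx ℓ u⟩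
    · simp
    · intro f g _ _ hf hg; rw [map_add]; exact add_mem hf hg
    · intro c f _ hf; rw [map_smul]; exact Submodule.smul_mem _ _ hf
  · intro f hf
    refine Submodule.span_induction (p := fun (f : A) _ => (f : Γ → F) 1 = 0) ?_ ?_ ?_ ?_ hf
    · rintro _ ⟨ℓ, hℓ, u, hu, rfl⟩
      simpa using (Submodule.mem_dualAnnihilator ℓ).1 hℓ u hu
    · simp
    · intro f g _ _ hf hg; simp [hf, hg]
    · intro c f _ hf; simp [hf]

theorem commute_of_lie (H : AG A) (hσ : IsAlgR A σ) (z : Module.End F R)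
    (hz : ∀ x ∈ LieA H hσ, Commute x z) : ∀ g, Commute (σ g) z := by
  have := vanish H (Submodule.span F {f | ∃ ℓ u, f = cf hσ ℓ (z u) - cf hσ (ℓ ∘ₗ z) u}) ?_ ?_
  · intro g
    refine LinearMap.ext fun u => ?_
    have hh : ∀ ℓ : Module.Dual F R, ℓ (σ g (z u) - z (σ g u)) = 0 := fun ℓ => by
      simpa using this _ (Submodule.subset_span ⟨ℓ, u, rfl⟩) g
    exact sub_eq_zero.1 ((Module.forall_dual_apply_eq_zero_iff F _).1 hh)
  · intro D hD f hf
    obtain ⟨x, hx⟩ := exists_op H hσ hD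
    refine Submodule.span_induction (p := fun f _ => D f ∈ _) ?_ ?_ ?_ ?_ hf
    · rintro _ ⟨ℓ, u, rfl⟩
      refine Submodule.subset_span ⟨ℓ, x u, ?_⟩
      rw [map_sub, hx, hx]
      have := LinearMap.congr_fun (hz x ⟨D, hD, hx⟩).eq u
      simp only [Module.End.mul_apply] at this
      rw [this]
    · simp
    · intro f g _ _ hf hg; rw [map_add]; exact add_mem hf hg
    · intro c f _ hf; rw [map_smul]; exact Submodule.smul_mem _ _ hf
  · intro f hf
    refine Submodule.span_induction (p := fun (f : A) _ => (f : Γ → F) 1 = 0) ?_ ?_ ?_ ?_ hf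
    · rintro _ ⟨ℓ, u, rfl⟩
      simp
    · simp
    · intro f g _ _ hf hg; simp [hf, hg]
    · intro c f _ hf; simp [hf]

end dens

/-- coefficients generate -/
def Gen (hσ : IsAlgR A σ) : Prop := Algebra.adjoin F {f : A | ∃ ℓ v, f = cf hσ ℓ v} = ⊤

theorem split_A {H : AG A} {hσ : IsAlgR A σ} (hG : Gen hσ) {D : A →ₗ[F] A} (hD : LID H D)
    {x : Module.End F R} (hx : Op hσ D x) (Λ : AddSubgroup F)
    (hs : ⨆ μ : Λ, x.maxGenEigenspace (μ : F) = ⊤) :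
    ⨆ μ : Λ, Module.End.maxGenEigenspace (D : Module.End F A) (μ : F) = ⊤ := by
  have hD1 : D 1 = 0 := by
    have := hD.leib 1 1
    simpa using this
  let B : Subalgebra F A :=
    { carrier := (⨆ μ : Λ, Module.End.maxGenEigenspace (D : Module.End F A) (μ : F) : Submodule F A)
      add_mem' := fun {a b} ha hb => add_mem ha hb
      mul_mem' := by
        intro f g hf hg
        refine Submodule.iSup_induction (fun μ : Λ => Module.End.maxGenEigenspace (D : Module.End F A) (μ : F))
          (motive := fun f => f * g ∈ _) hf ?_ (by simp) ?_
        · intro μ f hf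
          refine Submodule.iSup_induction (fun μ : Λ => Module.End.maxGenEigenspace (D : Module.End F A) (μ : F))
            (motive := fun g => f * g ∈ _) hg ?_ (by simp) ?_
          · intro ν g hg
            have := bilin_maxGen (LinearMap.mul F A) (x := (D : Module.End F A))
              (y := (D : Module.End F A)) (z := (D : Module.End F A))
              (fun m n => by simp [hD.leib]) hf hg
            exact Submodule.mem_iSup_of_mem (μ + ν) this
          · intro a b ha hb; rw [mul_add]; exact add_mem ha hb
        · intro a b ha hb; rw [add_mul]; exact add_mem ha hb
      algebraMap_mem' := by
        intro r
        refine Submodule.mem_iSup_of_mem 0 ?_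
        rw [Module.End.mem_maxGenEigenspace]
        refine ⟨1, ?_⟩
        rw [Algebra.algebraMap_eq_smul_one]
        simp [hD1] }
  have hB : B = ⊤ := by
    rw [eq_top_iff, ← show _ = _ from hG]
    refine Algebra.adjoin_le ?_
    rintro _ ⟨ℓ, v, rfl⟩
    have hv : v ∈ (⨆ μ : Λ, x.maxGenEigenspace (μ : F)) := by rw [hs]; trivial
    show _ ∈ (⨆ μ : Λ, Module.End.maxGenEigenspace (D : Module.End F A) (μ : F) : Submodule F A)
    refine Submodule.iSup_induction (fun μ : Λ => x.maxGenEigenspace (μ : F))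
      (motive := fun v => cf hσ ℓ v ∈ _) hv ?_ (by simp) ?_
    · intro μ v hv
      exact Submodule.mem_iSup_of_mem μ (map_maxGen (cf hσ ℓ) (fun v => (hx ℓ v).symm) hv)
    · intro a b ha hb; rw [map_add]; exact add_mem ha hb
  rw [eq_top_iff]
  intro f _
  have : f ∈ B := by rw [hB]; trivial
  exact this

theorem lie_replica [IsAlgClosed F] [FiniteDimensional F R] {H : AG A} {hσ : IsAlgR A σ} (hG : Gen hσ)
    {x : Module.End F R} (hx : x ∈ LieA H hσ) (φ : F → F) (hφ : ∀ a b, φ (a + b) = φ a + φ b)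
    {x' : Module.End F R} (hx' : IsRep φ x x') : x' ∈ LieA H hσ := by
  obtain ⟨D, hD, hop⟩ := hx
  have hs : Spl (D : Module.End F A) := by
    have := split_A hG hD hop ⊤ (by
      rw [eq_top_iff, ← show _ = _ from spl_of_fd x]
      exact iSup_le fun μ => le_iSup (fun μ : (⊤ : AddSubgroup F) => x.maxGenEigenspace (μ : F)) ⟨μ, trivial⟩)
    rw [Spl, eq_top_iff, ← this]
    exact iSup_le fun μ => le_iSup (fun μ : F => Module.End.maxGenEigenspace (D : Module.End F A) μ) (μ : F)
  obtain ⟨D', hD'⟩ := exists_isRep hs φ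
  refine ⟨D', ⟨fun f g => ?_, fun g f => ?_⟩, fun ℓ v => ?_⟩
  · refine hs.induction (P := fun f => D' (f * g) = D' f * g + f * D' g) f ?_ (by simp) ?_
    · intro μ f hf
      refine hs.induction (P := fun g => D' (f * g) = D' f * g + f * D' g) g ?_ (by simp) ?_
      · intro ν g hg
        have := bilin_maxGen (LinearMap.mul F A) (x := (D : Module.End F A))
              (y := (D : Module.End F A)) (z := (D : Module.End F A))
              (fun m n => by simp [hD.leib]) hf hg
        have e := hD' _ _ this
        simp only [LinearMap.mul_apply'] at e
        rw [e, hD' _ _ hf, hD' _ _ hg, hφ, add_smul]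
        simp
      · intro a b ha hb
        simp only [mul_add, map_add, ha, hb]; ring
    · intro a b ha hb
      simp only [add_mul, map_add, ha, hb]; ring
  · exact (hD'.intertwine hs hD' (lam H g).toLinearMap (fun f => (hD.inv g f).symm) f).symm
  · exact (hx'.intertwine (spl_of_fd x) hD' (cf hσ ℓ) (fun v => (hop ℓ v).symm) v).symm

/-- multiplicative replicas are group elements -/
theorem group_replica [IsAlgClosed F] [FiniteDimensional F R] {H : AG A} {hσ : IsAlgR A σ} (hG : Gen hσ)
    {x : Module.End F R} (hx : x ∈ LieA H hσ) (Λ : AddSubgroup F)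
    (hsx : ⨆ μ : Λ, x.maxGenEigenspace (μ : F) = ⊤) (φ : F → F) (hφ0 : φ 0 = 1)
    (hφ : ∀ a ∈ Λ, ∀ b ∈ Λ, φ (a + b) = φ a * φ b)
    {x' : Module.End F R} (hx' : IsRep φ x x') : ∃ g : Γ, σ g = x' := by
  obtain ⟨D, hD, hop⟩ := hx
  have hs' := split_A hG hD hop Λ hsx
  have hs : Spl (D : Module.End F A) := by
    rw [Spl, eq_top_iff, ← hs']
    exact iSup_le fun μ => le_iSup (fun μ : F => Module.End.maxGenEigenspace (D : Module.End F A) μ) (μ : F)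
  obtain ⟨P, hP⟩ := exists_isRep hs φ
  have hind : ∀ {p : A → Prop} (v : A) (h1 : ∀ μ ∈ Λ, ∀ v, v ∈ Module.End.maxGenEigenspace (D : Module.End F A) μ → p v)
      (h0 : p 0) (hadd : ∀ v w, p v → p w → p (v + w)), p v := by
    intro p v h1 h0 hadd
    exact Submodule.iSup_induction (fun μ : Λ => Module.End.maxGenEigenspace (D : Module.End F A) (μ : F))
      (motive := p) (x := v) (by rw [hs']; trivial) (fun μ v hv => h1 μ μ.2 v hv) h0 hadd
  have hD1 : D 1 = 0 := by
    have := hD.leib 1 1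
    simpa using this
  have hP1 : P 1 = 1 := by
    have : (1 : A) ∈ Module.End.maxGenEigenspace (D : Module.End F A) 0 := by
      rw [Module.End.mem_maxGenEigenspace]
      exact ⟨1, by simp [hD1]⟩
    rw [hP _ _ this, hφ0, one_smul]
  have hPm : ∀ f g, P (f * g) = P f * P g := by
    intro f g
    refine hind (p := fun f => P (f * g) = P f * P g) f ?_ (by simp) ?_
    · intro μ hμ f hf
      refine hind (p := fun g => P (f * g) = P f * P g) g ?_ (by simp) ?_
      · intro ν hν g hg
        have := bilin_maxGen (LinearMap.mul F A) (x := (D : Module.End F A))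
              (y := (D : Module.End F A)) (z := (D : Module.End F A))
              (fun m n => by simp [hD.leib]) hf hg
        have e := hP _ _ this
        simp only [LinearMap.mul_apply'] at e
        rw [e, hP _ _ hf, hP _ _ hg, hφ μ hμ ν hν, smul_mul_smul_comm]
      · intro a b ha hb
        simp only [mul_add, map_add, ha, hb]
    · intro a b ha hb
      simp only [add_mul, map_add, ha, hb]
  obtain ⟨g, hg⟩ := H.pts ((evA A 1).comp (AlgHom.ofLinearMap P hP1 hPm))
  refine ⟨g, LinearMap.ext fun v => ?_⟩
  rw [← sub_eq_zero, ← Module.forall_dual_apply_eq_zero_iff F]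
  intro ℓ
  have h1 := hg (cf hσ ℓ v)
  have h2 := hx'.intertwine (spl_of_fd x) hP (cf hσ ℓ) (fun v => (hop ℓ v).symm) v
  rw [cf_apply, AlgHom.comp_apply, AlgHom.ofLinearMap_apply, ← h2] at h1
  simp at h1
  rw [map_sub, h1, sub_self]

end rep
end Minu

set_option linter.all false
namespace Minu
open Module

section expo
variable {F : Type} [Field F] [CharZero F] {Γ : Type} [Group Γ] {A : Subalgebra F (Γ → F)}
  {R : Type} [AddCommGroup R] [Module F R] {σ : Γ →* Module.End F R}

theorem leib_pow {B : Type} [CommRing B] [Algebra F B] (D : Module.End F B)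
    (hD : ∀ f g, D (f * g) = D f * g + f * D g) (n : ℕ) (f g : B) :
    (n.factorial : F)⁻¹ • (D ^ n) (f * g) = ∑ p ∈ Finset.HasAntidiagonal.antidiagonal n,
      ((p.1.factorial : F)⁻¹ • (D ^ p.1) f) * ((p.2.factorial : F)⁻¹ • (D ^ p.2) g) := by
  let D1 : Module.End F (TensorProduct F B B) := LinearMap.rTensor B D
  let D2 : Module.End F (TensorProduct F B B) := LinearMap.lTensor B D
  have hc : Commute D1 D2 := by
    refine TensorProduct.ext' fun a b => ?_
    simp [D1, D2]
  have h1 : ∀ t, D (LinearMap.mul' F B t) = LinearMap.mul' F B ((D1 + D2) t) := by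
    intro t
    induction t with
    | zero => simp
    | tmul a b => simp [D1, D2, hD]
    | add a b ha hb => simp only [map_add, ha, hb]
  have h2 : ∀ n t, (D ^ n) (LinearMap.mul' F B t) = LinearMap.mul' F B (((D1 + D2)^n) t) := by
    intro n
    induction n with
    | zero => simp
    | succ n ih => intro t; rw [pow_succ, Module.End.mul_apply, h1, ih, pow_succ, Module.End.mul_apply]
  have h3 : ∀ i j, ((D1 ^ i * D2 ^ j) (f ⊗ₜ[F] g)) = ((D ^ i) f) ⊗ₜ[F] ((D ^ j) g) := by
    intro i j
    simp only [D1, D2, LinearMap.rTensor_pow, LinearMap.lTensor_pow, Module.End.mul_apply, LinearMap.lTensor_tmul,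
      LinearMap.rTensor_tmul]
  have h4 := h2 n (f ⊗ₜ[F] g)
  rw [hc.add_pow', LinearMap.mul'_apply, LinearMap.sum_apply, map_sum] at h4
  rw [h4, Finset.smul_sum]
  refine Finset.sum_congr rfl fun p hp => ?_
  rw [LinearMap.smul_apply, h3, map_nsmul, LinearMap.mul'_apply, smul_mul_smul_comm, ← Nat.cast_smul_eq_nsmul F,
    smul_smul]
  congr 1
  have hp' := Finset.HasAntidiagonal.mem_antidiagonal.1 hp
  have := Nat.add_choose_mul_factorial_mul_factorial p.1 p.2
  rw [hp'] at this
  rw [show n.choose p.2 = n.choose p.1 from (Nat.choose_symm_of_eq_add (by omega))] at this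
  have h5 : (n.factorial : F) = (n.choose p.1 : F) * p.1.factorial * p.2.factorial := by
    exact_mod_cast this.symm
  have a1 : (p.1.factorial : F) ≠ 0 := by exact_mod_cast Nat.factorial_ne_zero _
  have a2 : (p.2.factorial : F) ≠ 0 := by exact_mod_cast Nat.factorial_ne_zero _
  have a3 : (n.factorial : F) ≠ 0 := by exact_mod_cast Nat.factorial_ne_zero _
  field_simp
  rw [h5]

theorem group_exp [FiniteDimensional F R] {H : AG A} {hσ : IsAlgR A σ} (hG : Gen hσ)
    {x : Module.End F R} (hx : x ∈ LieA H hσ) {N : ℕ} (hN0 : 0 < N) (hN : x ^ N = 0) :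
    ∃ g : Γ, σ g = ∑ k ∈ Finset.range N, ((k.factorial : F)⁻¹) • x ^ k := by
  obtain ⟨D, hD, hop⟩ := hx
  have hx0 : x.maxGenEigenspace 0 = ⊤ := by
    rw [eq_top_iff]; intro v _
    rw [Module.End.mem_maxGenEigenspace]
    exact ⟨N, by simp [hN]⟩
  have hs' := split_A hG hD hop ⊥ (by
    rw [eq_top_iff, ← hx0]
    exact le_iSup (fun μ : (⊥ : AddSubgroup F) => x.maxGenEigenspace (μ : F)) 0)
  let D' : Module.End F A := D
  have hnil : ∀ f, ∃ k, ∀ m, k ≤ m → (D' ^ m) f = 0 := by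
    intro f
    have hf : f ∈ D'.maxGenEigenspace 0 := by
      have : (⨆ μ : (⊥ : AddSubgroup F), D'.maxGenEigenspace (μ : F)) ≤ D'.maxGenEigenspace 0 := by
        refine iSup_le fun μ => ?_
        rw [show (μ : F) = 0 from (AddSubgroup.mem_bot.1 μ.2)]
      exact this (by rw [hs']; trivial)
    rw [Module.End.mem_maxGenEigenspace] at hf
    obtain ⟨k, hk⟩ := hf
    refine ⟨k, fun m hm => ?_⟩
    have hz : D' - (0 : F) • (1 : Module.End F A) = D' := LinearMap.ext fun v => by simp
    rw [hz] at hk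
    rw [← Nat.sub_add_cancel hm, pow_add, Module.End.mul_apply, hk, map_zero]
  let a : ℕ → A →ₗ[F] F := fun k => ((k.factorial : F)⁻¹) • ((evA A 1).toLinearMap ∘ₗ (D' ^ k))
  let PS : A → PowerSeries F := fun f => PowerSeries.mk fun k => a k f
  have ha0 : ∀ f, ∃ k, ∀ m, k ≤ m → a m f = 0 := by
    intro f
    obtain ⟨k, hk⟩ := hnil f
    exact ⟨k, fun m hm => by simp [a, hk m hm]⟩
  have hPSm : ∀ f g, PS (f * g) = PS f * PS g := by
    intro f g
    ext k
    simp only [PS, PowerSeries.coeff_mul, PowerSeries.coeff_mk]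
    have := congrArg (evA A 1) (leib_pow D' hD.leib k f g)
    rw [map_sum] at this
    simp only [map_mul, map_smul] at this
    exact this
  have hpol : ∀ f, ∃ p : Polynomial F, (p : PowerSeries F) = PS f := by
    intro f
    obtain ⟨k, hk⟩ := ha0 f
    refine ⟨PowerSeries.trunc k (PS f), ?_⟩
    ext m
    rw [Polynomial.coeff_coe, PowerSeries.coeff_trunc]
    split_ifs with h
    · rfl
    · simp [PS, hk m (not_lt.1 h)]
  choose e he using hpol
  have hinj := Polynomial.coe_injective F
  have hem : ∀ f g, e (f * g) = e f * e g := by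
    intro f g
    apply hinj
    show ((e (f * g) : Polynomial F) : PowerSeries F) = ((e f * e g : Polynomial F) : PowerSeries F)
    rw [Polynomial.coe_mul, he, he, he, hPSm]
  have hea : ∀ f g, e (f + g) = e f + e g := by
    intro f g
    apply hinj
    show ((e (f + g) : Polynomial F) : PowerSeries F) = ((e f + e g : Polynomial F) : PowerSeries F)
    rw [Polynomial.coe_add, he, he, he]
    ext k; simp [PS]
  have hes : ∀ (c : F) f, e (c • f) = c • e f := by
    intro c f
    apply hinj
    show ((e (c • f) : Polynomial F) : PowerSeries F) = ((c • e f : Polynomial F) : PowerSeries F)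
    rw [he]
    ext k
    rw [Polynomial.coeff_coe, Polynomial.coeff_smul, ← Polynomial.coeff_coe, he]
    simp [PS]
  have hD1 : D 1 = 0 := by
    have := hD.leib 1 1
    simpa using this
  have he1 : e 1 = 1 := by
    apply hinj
    show ((e 1 : Polynomial F) : PowerSeries F) = ((1 : Polynomial F) : PowerSeries F)
    rw [he, Polynomial.coe_one]
    ext k
    rw [PowerSeries.coeff_one]
    cases k with
    | zero => simp [PS, a]
    | succ k =>
      have : (D' ^ (k+1)) 1 = 0 := by
        rw [pow_succ, Module.End.mul_apply, show D' 1 = 0 from hD1, map_zero]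
      simp [PS, a, this]
  let el : A →ₗ[F] Polynomial F := { toFun := e, map_add' := hea, map_smul' := hes }
  obtain ⟨g, hg⟩ := H.pts ((Polynomial.aeval (1 : F)).comp (AlgHom.ofLinearMap el he1 hem))
  refine ⟨g, LinearMap.ext fun v => ?_⟩
  rw [← sub_eq_zero, ← Module.forall_dual_apply_eq_zero_iff F]
  intro ℓ
  have h1 := hg (cf hσ ℓ v)
  have hk : ∀ k, (D' ^ k) (cf hσ ℓ v) = cf hσ ℓ ((x ^ k) v) := by
    intro k
    induction k with
    | zero => simp
    | succ k ih =>
      rw [pow_succ', Module.End.mul_apply, ih, pow_succ', Module.End.mul_apply]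
      exact hop ℓ _
  have hco : ∀ k, (e (cf hσ ℓ v)).coeff k = (k.factorial : F)⁻¹ * ℓ ((x^k) v) := by
    intro k
    rw [← Polynomial.coeff_coe, he]
    simp [PS, a, hk]
  have hdeg : (e (cf hσ ℓ v)).natDegree < N ∨ e (cf hσ ℓ v) = 0 := by
    by_cases h0 : e (cf hσ ℓ v) = 0
    · exact Or.inr h0
    · left
      by_contra hcon
      have : (x ^ (e (cf hσ ℓ v)).natDegree) = 0 := pow_eq_zero_of_le (not_lt.1 hcon) hN
      have h3 := hco (e (cf hσ ℓ v)).natDegree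
      rw [this] at h3
      simp at h3
      exact h0 h3
  have hev : Polynomial.aeval (1 : F) (e (cf hσ ℓ v)) =
      ∑ k ∈ Finset.range N, (k.factorial : F)⁻¹ * ℓ ((x^k) v) := by
    rw [Polynomial.aeval_def, Algebra.algebraMap_self, Polynomial.eval₂_eq_sum_range' _ (n := N)]
    · simp [hco]
    · rcases hdeg with h | h
      · exact h
      · rw [h]
        simpa using hN0
  rw [map_sub, sub_eq_zero]
  rw [cf_apply] at h1
  rw [← h1]
  show Polynomial.aeval (1 : F) (e (cf hσ ℓ v)) = _
  rw [hev, LinearMap.sum_apply, map_sum]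
  simp

end expo
end Minu

set_option linter.all false
namespace Minu
open Module

section conc
variable {F : Type} [Field F] {n : ℕ}

/-- coordinate functions on `GL n` -/
def gco (g : GL (Fin n) F) : (Fin n × Fin n) ⊕ (Fin n × Fin n) → F :=
  Sum.elim (fun q => (g : Matrix (Fin n) (Fin n) F) q.1 q.2)
    (fun q => ((g⁻¹ : GL (Fin n) F) : Matrix (Fin n) (Fin n) F) q.1 q.2)

/-- the coordinate ring -/
noncomputable def regm (H : Subgroup (GL (Fin n) F)) :
    MvPolynomial ((Fin n × Fin n) ⊕ (Fin n × Fin n)) F →ₐ[F] (H → F) :=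
  MvPolynomial.aeval (fun i (g : H) => gco (g : GL (Fin n) F) i)

/-- the coordinate ring -/
noncomputable def reg (H : Subgroup (GL (Fin n) F)) : Subalgebra F (H → F) := (regm H).range

theorem regm_apply (H : Subgroup (GL (Fin n) F)) (p) (g : H) :
    regm H p g = MvPolynomial.eval (gco (g : GL (Fin n) F)) p := by
  induction p using MvPolynomial.induction_on with
  | C a => simp [regm]
  | add p q hp hq => simp [hp, hq]
  | mul_X p i hp => rw [map_mul, map_mul, Pi.mul_apply, hp]; simp [regm]

/-- generator -/
noncomputable def gen (H : Subgroup (GL (Fin n) F)) (i : (Fin n × Fin n) ⊕ (Fin n × Fin n)) : reg H := ⟨_, ⟨MvPolynomial.X i, rfl⟩⟩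

@[simp] theorem gen_apply (H : Subgroup (GL (Fin n) F)) (i) (g : H) :
    (gen H i : H → F) g = gco (g : GL (Fin n) F) i := by
  show regm H (MvPolynomial.X i) g = _
  simp [regm_apply]

/-- surjection -/
noncomputable def regs (H : Subgroup (GL (Fin n) F)) :
    MvPolynomial ((Fin n × Fin n) ⊕ (Fin n × Fin n)) F →ₐ[F] reg H := (regm H).rangeRestrict

theorem regs_apply (H : Subgroup (GL (Fin n) F)) (p) (g : H) :
    (regs H p : H → F) g = MvPolynomial.eval (gco (g : GL (Fin n) F)) p := regm_apply H p g

theorem regs_surj (H : Subgroup (GL (Fin n) F)) : Function.Surjective (regs H) :=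
  (regm H).rangeRestrict_surjective

theorem regs_X (H : Subgroup (GL (Fin n) F)) (i) : regs H (MvPolynomial.X i) = gen H i := rfl

/-- has comultiplication -/
def IsCo {Γ : Type} [Group Γ] (A : Subalgebra F (Γ → F)) (f : Γ → F) : Prop :=
  ∃ (ι : Type) (_ : Fintype ι) (a b : ι → A), ∀ g h : Γ,
    f (g * h) = ∑ i, (a i : Γ → F) g * (b i : Γ → F) h

theorem reg_isCo (H : Subgroup (GL (Fin n) F)) (f : reg H) : IsCo (reg H) (f : H → F) := by
  obtain ⟨p, rfl⟩ := regs_surj H f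
  induction p using MvPolynomial.induction_on with
  | C a =>
    refine ⟨Unit, inferInstance, fun _ => algebraMap F _ a, fun _ => 1, fun g h => ?_⟩
    simp [regs_apply]
  | add p q hp hq =>
    obtain ⟨ι, _, a, b, hab⟩ := hp
    obtain ⟨ι', _, a', b', hab'⟩ := hq
    refine ⟨ι ⊕ ι', inferInstance, Sum.elim a a', Sum.elim b b', fun g h => ?_⟩
    rw [map_add, Fintype.sum_sum_type]
    simp [hab, hab']
  | mul_X p i hp =>
    obtain ⟨ι, _, a, b, hab⟩ := hp
    obtain ⟨ι', _, a', b', hab'⟩ : IsCo (reg H) (gen H i : H → F) := by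
      rcases i with ⟨i, j⟩ | ⟨i, j⟩
      · refine ⟨Fin n, inferInstance, fun k => gen H (Sum.inl (i, k)), fun k => gen H (Sum.inl (k, j)), fun g h => ?_⟩
        simp [gco, Matrix.mul_apply]
      · refine ⟨Fin n, inferInstance, fun k => gen H (Sum.inr (k, j)), fun k => gen H (Sum.inr (i, k)), fun g h => ?_⟩
        simp only [gen_apply, gco, Sum.elim_inr, Subgroup.coe_mul, mul_inv_rev, Units.val_mul, Matrix.mul_apply]
        exact Finset.sum_congr rfl fun k _ => mul_comm _ _
    refine ⟨ι × ι', inferInstance, fun k => a k.1 * a' k.2, fun k => b k.1 * b' k.2, fun g h => ?_⟩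
    rw [map_mul, regs_X, Fintype.sum_prod_type]
    simp only [Subalgebra.coe_mul, Pi.mul_apply, hab, hab', Finset.sum_mul_sum]
    refine Finset.sum_congr rfl fun k _ => Finset.sum_congr rfl fun l _ => ?_
    ring

/-! clearing denominators -/

theorem clear_den (p : MvPolynomial ((Fin n × Fin n) ⊕ (Fin n × Fin n)) F) :
    ∃ (N : ℕ) (q : MvPolynomial (Fin n × Fin n) F), ∀ g : GL (Fin n) F,
      (g : Matrix (Fin n) (Fin n) F).det ^ N * MvPolynomial.eval (gco g) p =
        MvPolynomial.eval (fun q => (g : Matrix (Fin n) (Fin n) F) q.1 q.2) q := by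
  let MX : Matrix (Fin n) (Fin n) (MvPolynomial (Fin n × Fin n) F) :=
    Matrix.of fun i j => MvPolynomial.X (i, j)
  have hMX : ∀ g : GL (Fin n) F, (MvPolynomial.eval
      (fun q => (g : Matrix (Fin n) (Fin n) F) q.1 q.2)).mapMatrix MX = (g : Matrix (Fin n) (Fin n) F) := by
    intro g; ext i j; simp [MX]
  have hdet : ∀ g : GL (Fin n) F, MvPolynomial.eval
      (fun q => (g : Matrix (Fin n) (Fin n) F) q.1 q.2) MX.det = (g : Matrix (Fin n) (Fin n) F).det := by
    intro g; rw [RingHom.map_det, hMX]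
  have hadj : ∀ (g : GL (Fin n) F) i j, MvPolynomial.eval
      (fun q => (g : Matrix (Fin n) (Fin n) F) q.1 q.2) (MX.adjugate i j) =
      (g : Matrix (Fin n) (Fin n) F).det * ((g⁻¹ : GL (Fin n) F) : Matrix (Fin n) (Fin n) F) i j := by
    intro g i j
    have h1 := RingHom.map_adjugate (MvPolynomial.eval
      (fun q => (g : Matrix (Fin n) (Fin n) F) q.1 q.2)) MX
    rw [hMX] at h1
    have h2 := congrFun (congrFun h1 i) j
    rw [RingHom.mapMatrix_apply, Matrix.map_apply] at h2
    rw [h2, Matrix.coe_units_inv, Matrix.inv_def, Matrix.smul_apply, smul_eq_mul, ← mul_assoc,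
      Ring.mul_inverse_cancel _ ((Matrix.isUnit_iff_isUnit_det _).1 g.isUnit), one_mul]
  induction p using MvPolynomial.induction_on with
  | C a => exact ⟨0, MvPolynomial.C a, fun g => by simp⟩
  | add p q hp hq =>
    obtain ⟨N, p', hp⟩ := hp
    obtain ⟨M, q', hq⟩ := hq
    refine ⟨N + M, MX.det ^ M * p' + MX.det ^ N * q', fun g => ?_⟩
    rw [map_add, map_add, map_mul, map_mul, map_pow, map_pow, hdet, ← hp, ← hq]
    ring
  | mul_X p i hp =>
    obtain ⟨N, p', hp⟩ := hp
    rcases i with ⟨i, j⟩ | ⟨i, j⟩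
    · refine ⟨N, p' * MvPolynomial.X (i, j), fun g => ?_⟩
      rw [map_mul, map_mul, ← hp]
      simp [gco]
      ring
    · refine ⟨N + 1, p' * MX.adjugate i j, fun g => ?_⟩
      rw [map_mul, map_mul, ← hp, hadj]
      simp [gco]
      ring

theorem zeq (H : Subgroup (GL (Fin n) F)) (f : reg H) : ∃ q : MvPolynomial (Fin n × Fin n) F,
    ∀ g : H, (f : H → F) g = 0 ↔ MvPolynomial.eval
      (fun q => ((g : GL (Fin n) F) : Matrix (Fin n) (Fin n) F) q.1 q.2) q = 0 := by
  obtain ⟨p, rfl⟩ := regs_surj H f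
  obtain ⟨N, q, h⟩ := clear_den p
  refine ⟨q, fun g => ?_⟩
  rw [regs_apply, ← h, mul_eq_zero]
  have : ((g : GL (Fin n) F) : Matrix (Fin n) (Fin n) F).det ^ N ≠ 0 :=
    pow_ne_zero _ ((Matrix.isUnit_iff_isUnit_det _).1 (g : GL (Fin n) F).isUnit).ne_zero
  simp [this]

/-- zero set -/
def zset (H : Subgroup (GL (Fin n) F)) (C : Set (reg H)) : Set (GL (Fin n) F) :=
  {g | ∃ h : g ∈ H, ∀ f ∈ C, (f : H → F) ⟨g, h⟩ = 0}

theorem zset_closed (H : Subgroup (GL (Fin n) F)) (hH : IsZClosed (H : Set (GL (Fin n) F)))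
    (C : Set (reg H)) : IsZClosed (zset H C) := by
  obtain ⟨I, hI⟩ := hH
  choose q hq using zeq H
  refine ⟨I ∪ q '' C, ?_⟩
  ext g
  have hmem : g ∈ H ↔ g ∈ {g : GL (Fin n) F | ∀ p ∈ I, MvPolynomial.eval
      (fun q => ((g : GL (Fin n) F) : Matrix (Fin n) (Fin n) F) q.1 q.2) p = 0} := by
    rw [← hI]; rfl
  constructor
  · rintro ⟨h, hg⟩ p (hp | ⟨f, hf, rfl⟩)
    · exact hmem.1 h p hp
    · exact (hq f ⟨g, h⟩).1 (hg f hf)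
  · intro hg
    have h : g ∈ H := hmem.2 fun p hp => hg p (Or.inl hp)
    exact ⟨h, fun f hf => (hq f ⟨g, h⟩).2 (hg _ (Or.inr ⟨f, hf, rfl⟩))⟩

theorem ag_reg (H : Subgroup (GL (Fin n) F)) (hH : IsZClosed (H : Set (GL (Fin n) F)))
    (hc : IsZConnected (H : Set (GL (Fin n) F))) : AG (reg H) where
  comul f := by
    obtain ⟨ι, _, a, b, hab⟩ := reg_isCo H f
    let e := Fintype.equivFin ι
    refine ⟨_, a ∘ e.symm, b ∘ e.symm, fun g h => ?_⟩
    rw [hab, ← Equiv.sum_comp e.symm]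
    rfl
  noeth := isNoetherianRing_of_surjective _ _ (regs H).toRingHom (regs_surj H)
  pts χ := by
    let M : Matrix (Fin n) (Fin n) F := fun i j => χ (gen H (Sum.inl (i, j)))
    let N : Matrix (Fin n) (Fin n) F := fun i j => χ (gen H (Sum.inr (i, j)))
    have key : ∀ p, χ (regs H p) = MvPolynomial.eval (fun i => χ (gen H i)) p := by
      intro p
      induction p using MvPolynomial.induction_on with
      | C a =>
        have : regs H (MvPolynomial.C a) = algebraMap F _ a := (regs H).commutes a
        rw [this, AlgHom.commutes]; simp
      | add p q hp hq => rw [map_add, map_add, map_add, hp, hq]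
      | mul_X p i hp => rw [map_mul, map_mul, map_mul, hp, regs_X]; simp
    have h1 : ∀ i j, ∑ k, gen H (Sum.inl (i, k)) * gen H (Sum.inr (k, j)) = if i = j then 1 else 0 := by
      intro i j
      ext g
      have := congrFun (congrFun (congrArg (fun u : GL (Fin n) F => (u : Matrix (Fin n) (Fin n) F)) (mul_inv_cancel (g : GL (Fin n) F))) i) j
      rw [Units.val_mul, Matrix.mul_apply] at this
      have e : ((∑ k, gen H (Sum.inl (i, k)) * gen H (Sum.inr (k, j)) : reg H) : H → F) g =
        ∑ k, ((g : GL (Fin n) F) : Matrix (Fin n) (Fin n) F) i k * (((g : GL (Fin n) F)⁻¹ : GL (Fin n) F) : Matrix (Fin n) (Fin n) F) k j := by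
        simp [Finset.sum_apply, gco]
      rw [e, this, Units.val_one, Matrix.one_apply]
      split_ifs <;> rfl
    have h2 : M * N = 1 := by
      ext i j
      rw [Matrix.mul_apply, Matrix.one_apply]
      have := congrArg χ (h1 i j)
      rw [map_sum] at this
      simp only [map_mul] at this
      rw [this]; split_ifs <;> simp
    have h3 : N * M = 1 := mul_eq_one_comm.1 h2
    let g : GL (Fin n) F := ⟨M, N, h2, h3⟩
    have hg : gco g = fun i => χ (gen H i) := by
      funext i; rcases i with ⟨i, j⟩ | ⟨i, j⟩ <;> rfl
    obtain ⟨I, hI⟩ := hH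
    have hgH : g ∈ H := by
      show g ∈ (H : Set (GL (Fin n) F))
      rw [hI]
      intro p hp
      have e1 : regs H (MvPolynomial.rename Sum.inl p) = 0 := by
        ext k
        rw [regs_apply, MvPolynomial.eval_rename]
        have : (k : GL (Fin n) F) ∈ (H : Set (GL (Fin n) F)) := k.2
        rw [hI] at this
        exact this p hp
      have e2 := key (MvPolynomial.rename Sum.inl p)
      rw [e1, map_zero, MvPolynomial.eval_rename] at e2
      exact e2.symm
    refine ⟨⟨g, hgH⟩, fun f => ?_⟩
    obtain ⟨p, rfl⟩ := regs_surj H f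
    rw [key, regs_apply]
    show _ = MvPolynomial.eval (gco g) p
    rw [hg]
  conn C₁ C₂ hu h1 h2 := by
    obtain ⟨g₁, h1⟩ := h1
    obtain ⟨g₂, h2⟩ := h2
    obtain ⟨g, hg, ⟨hgH, ha⟩, ⟨_, hb⟩⟩ := hc (zset H C₁) (zset H C₂) (zset_closed H hH C₁)
      (zset_closed H hH C₂) (by
        intro g hg
        rcases hu ⟨g, hg⟩ with h | h
        · exact Or.inl ⟨hg, h⟩
        · exact Or.inr ⟨hg, h⟩) ⟨g₁, g₁.2, g₁.2, h1⟩ ⟨g₂, g₂.2, g₂.2, h2⟩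
    exact ⟨⟨g, hgH⟩, ha, hb⟩

end conc
end Minu

set_option linter.all false
namespace Minu
open Module

section diag
variable {F : Type} [Field F] {M : Type} [AddCommGroup M] [Module F M]

/-- diagonalizable -/
def Diag (x : Module.End F M) : Prop := ⨆ μ, x.eigenspace μ = ⊤

theorem eig_le_maxGen (x : Module.End F M) (μ : F) : x.eigenspace μ ≤ x.maxGenEigenspace μ := by
  intro v hv
  rw [Module.End.mem_maxGenEigenspace]
  rw [Module.End.mem_eigenspace_iff] at hv
  exact ⟨1, by simp [hv]⟩

theorem Diag.spl {x : Module.End F M} (h : Diag x) : Spl x := by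
  rw [Spl, eq_top_iff, ← show _ = _ from h]
  exact iSup_mono (eig_le_maxGen x)

theorem Diag.induction {x : Module.End F M} (h : Diag x) {P : M → Prop} (v : M)
    (h1 : ∀ (μ : F) v, x v = μ • v → P v) (h0 : P 0)
    (hadd : ∀ v w, P v → P w → P (v + w)) : P v :=
  Submodule.iSup_induction (fun μ => x.eigenspace μ) (motive := P)
    (x := v) (by rw [show (⨆ μ, x.eigenspace μ) = ⊤ from h]; trivial)
    (fun μ v hv => h1 μ v (Module.End.mem_eigenspace_iff.1 hv)) h0 hadd

theorem Diag.isRep {x : Module.End F M} (h : Diag x) : IsRep id x x := by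
  obtain ⟨x', hx'⟩ := exists_isRep h.spl id
  have : x' = x := by
    refine LinearMap.ext fun v => h.induction (P := fun v => x' v = x v) v ?_ (by simp) ?_
    · intro μ v hv
      rw [hx' μ v (eig_le_maxGen x μ (Module.End.mem_eigenspace_iff.2 hv)), hv]; rfl
    · intro v w h1 h2; simp [h1, h2]
  rw [this] at hx'; exact hx'

theorem diag_of_isRep {x : Module.End F M} (hs : Spl x) (φ : F → F) {x' : Module.End F M}
    (h : IsRep φ x x') : Diag x' := by
  rw [Diag, eq_top_iff, ← show _ = _ from hs]
  refine iSup_le fun μ v hv => ?_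
  exact Submodule.mem_iSup_of_mem (φ μ) (Module.End.mem_eigenspace_iff.2 (h μ v hv))

variable [FiniteDimensional F M]

theorem Diag.ss [IsAlgClosed F] [CharZero F] {x : Module.End F M} (h : Diag x) : x.IsSemisimple := by
  classical
  let s := (finite_maxGen x).toFinset
  apply Module.End.isSemisimple_of_squarefree_aeval_eq_zero
    (p := ∏ μ ∈ s, (Polynomial.X - Polynomial.C μ))
  · apply Polynomial.Separable.squarefree
    exact Polynomial.separable_prod_X_sub_C_iff'.2 (fun x _ y _ h => h)
  · refine LinearMap.ext fun v => h.induction (P := fun v => (Polynomial.aeval x (∏ μ ∈ s, (Polynomial.X - Polynomial.C μ))) v = (0 : Module.End F M) v) v ?_ (by simp) ?_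
    · intro μ v hv
      by_cases hv0 : v = 0
      · simp [hv0]
      have hμ : μ ∈ s := by
        simp only [s, Set.Finite.mem_toFinset, Set.mem_setOf_eq]
        intro hb
        have := eig_le_maxGen x μ (Module.End.mem_eigenspace_iff.2 hv)
        rw [hb] at this
        exact hv0 (by simpa using this)
      rw [← Finset.prod_erase_mul _ _ hμ, map_mul, Module.End.mul_apply]
      simp [hv]
    · intro v w h1 h2; simp [h1, h2]

theorem diag_iff_ss [IsAlgClosed F] [CharZero F] {x : Module.End F M} : Diag x ↔ x.IsSemisimple :=
  ⟨Diag.ss, fun h => h.iSup_eigenspace_eq_top⟩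

theorem Diag.span [IsAlgClosed F] [CharZero F] {S : Set (Module.End F M)} (hS : ∀ x ∈ S, Diag x)
    (hc : ∀ x ∈ S, ∀ y ∈ S, Commute x y) :
    ∀ x ∈ Submodule.span F S, Diag x ∧ ∀ y ∈ Submodule.span F S, Commute x y := by
  have hcc : ∀ x ∈ Submodule.span F S, ∀ y ∈ Submodule.span F S, Commute x y := by
    intro x hx y hy
    refine Submodule.span_induction (p := fun x _ => Commute x y) ?_ (Commute.zero_left _)
      (fun a b _ _ ha hb => ha.add_left hb) (fun c a _ ha => ha.smul_left c) hx
    intro x hx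
    exact Submodule.span_induction (p := fun y _ => Commute x y) (fun y hy => hc x hx y hy) (Commute.zero_right _)
      (fun a b _ _ ha hb => ha.add_right hb) (fun c a _ ha => ha.smul_right c) hy
  intro x hx
  refine ⟨?_, hcc x hx⟩
  refine Submodule.span_induction (p := fun x _ => Diag x) hS ?_ ?_ ?_ hx
  · rw [Diag, eq_top_iff]; intro v _
    exact Submodule.mem_iSup_of_mem 0 (Module.End.mem_eigenspace_iff.2 (by simp))
  · intro a b ha' hb' ha hb
    exact diag_iff_ss.2 (Module.End.IsSemisimple.add_of_commute (hcc a ha' b hb') ha.ss hb.ss)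
  · intro c a _ ha
    rw [Diag, eq_top_iff, ← show _ = _ from ha]
    refine iSup_le fun μ v hv => Submodule.mem_iSup_of_mem (c * μ) ?_
    rw [Module.End.mem_eigenspace_iff] at hv ⊢
    simp [hv, mul_smul]

theorem Diag.basis {x : Module.End F M} (h : Diag x) {n : ℕ} (hn : finrank F M = n) :
    ∃ (b : Basis (Fin n) F M) (d : Fin n → F), ∀ i, x (b i) = d i • b i := by
  classical
  have hI : DirectSum.IsInternal (fun μ => x.eigenspace μ) :=
    DirectSum.isInternal_submodule_of_iSupIndep_of_iSup_eq_top
      (Module.End.eigenspaces_iSupIndep x) h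
  let b := hI.collectedBasis (fun μ => Module.finBasis F (x.eigenspace μ))
  have hb : ∀ a, x (b a) = a.1 • b a := fun a =>
    Module.End.mem_eigenspace_iff.1 (hI.collectedBasis_mem _ a)
  haveI : Fintype ((μ : F) × Fin (finrank F (x.eigenspace μ))) :=
    FiniteDimensional.fintypeBasisIndex b
  have hcard : Fintype.card ((μ : F) × Fin (finrank F (x.eigenspace μ))) = n := by
    rw [← Module.finrank_eq_card_basis b, hn]
  let e := Fintype.equivFinOfCardEq hcard
  refine ⟨b.reindex e, fun i => (e.symm i).1, fun i => ?_⟩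
  simp only [Basis.reindex_apply, hb]

theorem ssElem_iff {n : ℕ} [IsAlgClosed F] (g : GL (Fin n) F) :
    IsSemisimpleElem g ↔ Diag (Matrix.toLin' (g : Matrix (Fin n) (Fin n) F)) := by
  classical
  constructor
  · rintro ⟨P, hP⟩
    let d : Fin n → F := fun i => ((P⁻¹ * g * P : GL (Fin n) F) : Matrix (Fin n) (Fin n) F) i i
    have h1 : ((P⁻¹ * g * P : GL (Fin n) F) : Matrix (Fin n) (Fin n) F) = Matrix.diagonal d := by
      rw [← hP.diagonal_diag]; rfl
    have h2 : (g : Matrix (Fin n) (Fin n) F) * (P : Matrix (Fin n) (Fin n) F) =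
        (P : Matrix (Fin n) (Fin n) F) * Matrix.diagonal d := by
      rw [← h1, ← Units.val_mul, ← Units.val_mul]
      congr 1
      group
    rw [Diag, eq_top_iff]
    intro v _
    have hv : v = ∑ i, (((P⁻¹ : GL (Fin n) F) : Matrix (Fin n) (Fin n) F).mulVec v i) •
        (P : Matrix (Fin n) (Fin n) F).mulVec (Pi.single i 1) := by
      have : (P : Matrix (Fin n) (Fin n) F).mulVec (((P⁻¹ : GL (Fin n) F) : Matrix (Fin n) (Fin n) F).mulVec v) = v := by
        rw [Matrix.mulVec_mulVec, ← Units.val_mul, mul_inv_cancel]; simp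
      conv_lhs => rw [← this]
      generalize ((P⁻¹ : GL (Fin n) F) : Matrix (Fin n) (Fin n) F).mulVec v = w
      conv_lhs => rw [pi_eq_sum_univ' w]
      rw [Matrix.mulVec_sum]
      refine Finset.sum_congr rfl fun i _ => ?_
      rw [Matrix.mulVec_smul]
    rw [hv]
    refine sum_mem fun i _ => Submodule.smul_mem _ _ (Submodule.mem_iSup_of_mem (d i) ?_)
    rw [Module.End.mem_eigenspace_iff, Matrix.toLin'_apply, Matrix.mulVec_mulVec, h2,
      ← Matrix.mulVec_mulVec, ← Matrix.mulVec_smul]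
    congr 1
    rw [Matrix.diagonal_mulVec_single]
    ext j
    simp [Pi.single_apply]
  · intro h
    let x : Module.End F (Fin n → F) := Matrix.toLin' (g : Matrix (Fin n) (Fin n) F)
    obtain ⟨b', d, hb'⟩ := Diag.basis (x := x) h (n := n) (by simp)
    let s := Pi.basisFun F (Fin n)
    let P : GL (Fin n) F := ⟨s.toMatrix b', b'.toMatrix s, s.toMatrix_mul_toMatrix_flip b',
      b'.toMatrix_mul_toMatrix_flip s⟩
    refine ⟨P, ?_⟩
    have h3 : ((P⁻¹ * g * P : GL (Fin n) F) : Matrix (Fin n) (Fin n) F) = LinearMap.toMatrix b' b' x := by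
      have h4 : LinearMap.toMatrix s s x = (g : Matrix (Fin n) (Fin n) F) := by
        rw [LinearMap.toMatrix_eq_toMatrix', LinearMap.toMatrix'_toLin']
      have h5 := basis_toMatrix_mul_linearMap_toMatrix_mul_basis_toMatrix b' s b' s x
      rw [h4] at h5
      exact h5
    rw [h3]
    intro i j hij
    rw [LinearMap.toMatrix_apply, hb']
    simp [Finsupp.single_apply, hij.symm]

end diag

section diagrep
variable {F : Type} [Field F] {Γ : Type} [Group Γ] {A : Subalgebra F (Γ → F)}
  {R : Type} [AddCommGroup R] [Module F R] [FiniteDimensional F R] {V : Type} [AddCommGroup V] [Module F V]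

theorem diag_rep [IsAlgClosed F] (H : AG A) {τ : Γ →* Module.End F V} (hτ : IsAlgR A τ) (hG : Gen hτ)
    {σ : Γ →* Module.End F R} (hσ : IsAlgR A σ) (t : Γ) (ht : Diag (τ t)) : Diag (σ t) := by
  let r : Module.End F A := (rho H t).toLinearMap
  have hr : Diag r := by
    let B : Subalgebra F A :=
      { carrier := (⨆ μ, r.eigenspace μ : Submodule F A)
        add_mem' := fun {a b} ha hb => add_mem ha hb
        mul_mem' := by
          intro f g hf hg
          refine Submodule.iSup_induction (fun μ : F => r.eigenspace μ)
            (motive := fun f => f * g ∈ _) hf ?_ (by simp) ?_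
          · intro μ f hf
            refine Submodule.iSup_induction (fun μ : F => r.eigenspace μ)
              (motive := fun g => f * g ∈ _) hg ?_ (by simp) ?_
            · intro ν g hg
              refine Submodule.mem_iSup_of_mem (μ * ν) ?_
              rw [Module.End.mem_eigenspace_iff] at hf hg ⊢
              have : r (f * g) = r f * r g := map_mul (rho H t) f g
              rw [this, hf, hg, smul_mul_smul_comm]
            · intro a b ha hb; rw [mul_add]; exact add_mem ha hb
          · intro a b ha hb; rw [add_mul]; exact add_mem ha hb
        algebraMap_mem' := by
          intro c
          refine Submodule.mem_iSup_of_mem 1 ?_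
          rw [Module.End.mem_eigenspace_iff, one_smul]
          exact (rho H t).commutes c }
    have hB : B = ⊤ := by
      rw [eq_top_iff, ← show _ = _ from hG]
      refine Algebra.adjoin_le ?_
      rintro _ ⟨ℓ, v, rfl⟩
      show _ ∈ (⨆ μ, r.eigenspace μ : Submodule F A)
      refine ht.induction (P := fun v => cf hτ ℓ v ∈ (⨆ μ, r.eigenspace μ : Submodule F A)) v ?_ (by simp) ?_
      · intro μ v hv
        refine Submodule.mem_iSup_of_mem μ ?_
        rw [Module.End.mem_eigenspace_iff]
        show rho H t _ = _
        rw [rho_cf, hv, map_smul]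
      · intro a b ha hb; rw [map_add]; exact add_mem ha hb
    rw [Diag, eq_top_iff]
    intro f _
    have : f ∈ B := by rw [hB]; trivial
    exact this
  have h1 : IsRep id (σ t) (σ t) := by
    intro μ v hv
    rw [← sub_eq_zero, ← Module.forall_dual_apply_eq_zero_iff F]
    intro ℓ
    have h2 := hr.isRep μ _ (map_maxGen (y := r) (cf hσ ℓ) (fun v => (rho_cf H hσ ℓ v t).symm) hv)
    have h3 : r (cf hσ ℓ v) = cf hσ ℓ (σ t v) := rho_cf H hσ ℓ v t
    rw [h3] at h2
    have := congrArg (fun f : A => (f : Γ → F) 1) h2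
    simp at this
    rw [map_sub, this]; simp
  exact diag_of_isRep (spl_of_fd _) id h1

end diagrep
end Minu

set_option linter.all false
namespace Minu
open Module

section curves
variable {F : Type} [Field F] {n : ℕ}

/-- functions on ℕ determined by their values on infinite sets -/
def Rigid (E : Subalgebra F (ℕ → F)) : Prop :=
  ∀ e ∈ E, {k | e k = 0}.Infinite → ∀ k, e k = 0

theorem curve {E : Subalgebra F (ℕ → F)} (hE : Rigid E) (c : ℕ → GL (Fin n) F)
    (hc : ∀ i j, (fun k => (c k : Matrix (Fin n) (Fin n) F) i j) ∈ E)
    {C : Set (GL (Fin n) F)} (hC : IsZClosed C) (hi : {k | c k ∈ C}.Infinite) : ∀ k, c k ∈ C := by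
  obtain ⟨I, rfl⟩ := hC
  intro k p hp
  have he : ∀ p : MvPolynomial (Fin n × Fin n) F, (fun k => MvPolynomial.eval
      (fun q => ((c k : GL (Fin n) F) : Matrix (Fin n) (Fin n) F) q.1 q.2) p) ∈ E := by
    intro p
    induction p using MvPolynomial.induction_on with
    | C a => simp only [MvPolynomial.eval_C]; exact E.algebraMap_mem a
    | add p q hp hq =>
      simp only [map_add]
      exact E.add_mem hp hq
    | mul_X p i hp =>
      simp only [map_mul, MvPolynomial.eval_X]
      exact E.mul_mem hp (hc i.1 i.2)
  exact hE _ (he p) (hi.mono fun k hk => by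
    have hk' : ∀ p ∈ I, MvPolynomial.eval (fun q => ((c k : GL (Fin n) F) : Matrix (Fin n) (Fin n) F) q.1 q.2) p = 0 := hk
    exact hk' p hp) k

variable (F) in
/-- polynomial functions -/
noncomputable def E1 : Subalgebra F (ℕ → F) :=
  (Polynomial.aeval (fun k : ℕ => (k : F)) : Polynomial F →ₐ[F] (ℕ → F)).range

theorem E1_apply (P : Polynomial F) (k : ℕ) :
    (Polynomial.aeval (fun k : ℕ => (k : F)) P) k = P.eval (k : F) := by
  induction P using Polynomial.induction_on' with
  | add p q hp hq => simp [hp, hq]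
  | monomial m a => simp [Polynomial.aeval_monomial]

theorem E1_rigid [CharZero F] : Rigid (E1 F) := by
  rintro _ ⟨P, rfl⟩ hi
  have : P = 0 := by
    refine Polynomial.eq_zero_of_infinite_isRoot P ?_
    refine (hi.image (f := fun k : ℕ => (k : F)) (Nat.cast_injective.injOn)).mono ?_
    rintro _ ⟨k, hk, rfl⟩
    have : (Polynomial.aeval (fun k : ℕ => (k : F)) P) k = 0 := hk
    rwa [E1_apply] at this
  subst this
  intro k; simp

theorem E1_choose [CharZero F] (r : ℕ) : (fun k : ℕ => (k.choose r : F)) ∈ E1 F := by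
  refine ⟨(r.factorial : F)⁻¹ • descPochhammer F r, ?_⟩
  funext k
  show (Polynomial.aeval (fun k : ℕ => (k : F)) _) k = _
  rw [E1_apply, Polynomial.eval_smul, descPochhammer_eval_eq_descFactorial, Nat.descFactorial_eq_factorial_mul_choose]
  have : (r.factorial : F) ≠ 0 := Nat.cast_ne_zero.2 r.factorial_ne_zero
  push_cast
  rw [smul_eq_mul, inv_mul_cancel_left₀ this]

theorem unip_pow (u : Matrix (Fin n) (Fin n) F) (hu : (u - 1) ^ n = 0) (k : ℕ) :
    u ^ k = ∑ r ∈ Finset.range n, (k.choose r : F) • (u - 1) ^ r := by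
  have h1 : u ^ k = ∑ r ∈ Finset.range (k + 1), (k.choose r : F) • (u - 1) ^ r := by
    conv_lhs => rw [← sub_add_cancel u 1, (Commute.one_right (u - 1)).add_pow]
    refine Finset.sum_congr rfl fun r _ => ?_
    rw [one_pow, mul_one, Nat.cast_smul_eq_nsmul, nsmul_eq_mul, (Nat.cast_commute _ _).eq]
  rw [h1]
  have hN : ∀ N, k + 1 ≤ N → ∑ r ∈ Finset.range (k + 1), (k.choose r : F) • (u - 1) ^ r =
      ∑ r ∈ Finset.range N, (k.choose r : F) • (u - 1) ^ r := by
    intro N hN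
    refine Finset.sum_subset (Finset.range_mono hN) fun r _ hr => ?_
    rw [Nat.choose_eq_zero_of_lt (by simpa using hr)]; simp
  have hM : ∀ N, n ≤ N → ∑ r ∈ Finset.range n, (k.choose r : F) • (u - 1) ^ r =
      ∑ r ∈ Finset.range N, (k.choose r : F) • (u - 1) ^ r := by
    intro N hN
    refine Finset.sum_subset (Finset.range_mono hN) fun r _ hr => ?_
    rw [pow_eq_zero_of_le (by simpa using hr) hu]; simp
  rw [hN _ (le_max_left (k + 1) n), hM _ (le_max_right (k + 1) n)]

theorem unip_conn [CharZero F] (H : Subgroup (GL (Fin n) F)) (hu : ∀ h ∈ H, IsUnipotentElem h) :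
    IsZConnected (H : Set (GL (Fin n) F)) := by
  rintro C₁ C₂ h₁ h₂ hsub ⟨g₁, hg₁, hg₁'⟩ ⟨g₂, hg₂, hg₂'⟩
  let u := g₁⁻¹ * g₂
  have huH : u ∈ H := H.mul_mem (H.inv_mem hg₁) hg₂
  let c : ℕ → GL (Fin n) F := fun k => g₁ * u ^ k
  have hc : ∀ i j, (fun k => (c k : Matrix (Fin n) (Fin n) F) i j) ∈ E1 F := by
    intro i j
    have : (fun k => (c k : Matrix (Fin n) (Fin n) F) i j) = ∑ r ∈ Finset.range n,
        ((g₁ : Matrix (Fin n) (Fin n) F) * ((u : Matrix (Fin n) (Fin n) F) - 1) ^ r) i j • (fun k : ℕ => (k.choose r : F)) := by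
      funext k
      simp only [c, Units.val_mul, Units.val_pow_eq_pow_val]
      rw [unip_pow _ (hu u huH) k, Finset.mul_sum, Matrix.sum_apply, Finset.sum_apply]
      refine Finset.sum_congr rfl fun r _ => ?_
      simp [mul_comm]
    rw [this]
    exact sum_mem fun r _ => Subalgebra.smul_mem _ (E1_choose r) _
  have hcH : ∀ k, c k ∈ H := fun k => H.mul_mem hg₁ (H.pow_mem huH k)
  have hun : {k | c k ∈ C₁} ∪ {k | c k ∈ C₂} = Set.univ := by
    ext k; simpa using hsub (hcH k)
  have hinf : ({k | c k ∈ C₁} ∪ {k | c k ∈ C₂}).Infinite := by rw [hun]; exact Set.infinite_univ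
  rcases Set.infinite_union.1 hinf with h | h
  · have := curve E1_rigid c hc h₁ h 1
    have e : c 1 = g₂ := by simp [c, u]
    rw [e] at this
    exact ⟨g₂, hg₂, this, hg₂'⟩
  · have := curve E1_rigid c hc h₂ h 0
    have e : c 0 = g₁ := by simp [c]
    rw [e] at this
    exact ⟨g₁, hg₁, hg₁', this⟩

variable (F) in
/-- Laurent polynomials in `2^k` -/
noncomputable def E2 [CharZero F] : Subalgebra F (ℕ → F) where
  carrier := {e | ∃ (N : ℕ) (P : Polynomial F), ∀ k : ℕ, ((2 : F) ^ k) ^ N * e k = P.eval ((2 : F) ^ k)}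
  mul_mem' := by
    rintro a b ⟨N, P, h⟩ ⟨M, Q, h'⟩
    refine ⟨N + M, P * Q, fun k => ?_⟩
    rw [Polynomial.eval_mul, ← h, ← h', Pi.mul_apply]; ring
  add_mem' := by
    rintro a b ⟨N, P, h⟩ ⟨M, Q, h'⟩
    refine ⟨N + M, Polynomial.X ^ M * P + Polynomial.X ^ N * Q, fun k => ?_⟩
    rw [Polynomial.eval_add, Polynomial.eval_mul, Polynomial.eval_mul, ← h, ← h', Pi.add_apply]
    simp; ring
  algebraMap_mem' := fun a => ⟨0, Polynomial.C a, fun k => by simp⟩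

theorem two_pow_inj [CharZero F] : Function.Injective (fun k : ℕ => (2 : F) ^ k) := by
  intro a b h
  have : ((2 ^ a : ℕ) : F) = ((2 ^ b : ℕ) : F) := by push_cast; exact h
  exact Nat.pow_right_injective (le_refl 2) (Nat.cast_injective this)

theorem E2_rigid [CharZero F] : Rigid (E2 F) := by
  rintro e ⟨N, P, h⟩ hi
  have : P = 0 := by
    refine Polynomial.eq_zero_of_infinite_isRoot P ?_
    refine (hi.image (f := fun k : ℕ => (2 : F) ^ k) two_pow_inj.injOn).mono ?_
    rintro _ ⟨k, hk, rfl⟩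
    have hk : e k = 0 := hk
    show P.eval _ = 0
    rw [← h, hk, mul_zero]
  subst this
  intro k
  have := h k
  simpa using this

theorem E2_zpow [CharZero F] (m : ℤ) : (fun k : ℕ => ((2 : F) ^ m) ^ k) ∈ E2 F := by
  rcases m with m | m
  · refine ⟨0, Polynomial.X ^ m, fun k => ?_⟩
    simp [← pow_mul, mul_comm]
  · refine ⟨m + 1, 1, fun k => ?_⟩
    simp only [zpow_negSucc]
    rw [inv_pow, ← pow_mul, ← pow_mul, mul_comm k]
    simp
end curves
end Minu

set_option linter.all false
namespace Minu
open Module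

section engel
variable {F : Type} [Field F] {R : Type} [AddCommGroup R] [Module F R]

/-- the filtration -/
def Fil (a : Submodule F (Module.End F R)) : ℕ → Submodule F R
  | 0 => ⊤
  | k + 1 => Submodule.span F {w | ∃ y ∈ a, ∃ v ∈ Fil a k, w = y v}

theorem Fil_apply {a : Submodule F (Module.End F R)} {k : ℕ} {y : Module.End F R} (hy : y ∈ a) {v : R}
    (hv : v ∈ Fil a k) : y v ∈ Fil a (k + 1) := Submodule.subset_span ⟨y, hy, v, hv, rfl⟩

theorem Fil_anti (a : Submodule F (Module.End F R)) (k : ℕ) : Fil a (k + 1) ≤ Fil a k := by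
  induction k with
  | zero => exact le_top
  | succ k ih =>
    refine Submodule.span_le.2 ?_
    rintro _ ⟨y, hy, v, hv, rfl⟩
    exact Fil_apply hy (ih hv)

section
attribute [local instance] LieRing.ofAssociativeRing

theorem engel [FiniteDimensional F R] (a : Submodule F (Module.End F R))
    (hb : ∀ x ∈ a, ∀ y ∈ a, x * y - y * x ∈ a) (hn : ∀ x ∈ a, IsNilpotent x) :
    ∃ k, Fil a k = ⊥ := by
  let L : LieSubalgebra F (Module.End F R) := { a with lie_mem' := fun {x y} hx hy => hb x hx y hy }
  have h1 : LieModule.IsNilpotent L R := by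
    rw [LieModule.isNilpotent_iff_forall' (R := F)]
    intro x
    have : LieModule.toEnd F L R x = (x : Module.End F R) := by ext v; rfl
    rw [this]
    exact hn x.1 x.2
  obtain ⟨k, hk⟩ := (LieModule.isNilpotent_iff F L R).1 h1
  have h2 : ∀ k, ∀ v ∈ Fil a k, v ∈ LieModule.lowerCentralSeries F L R k := by
    intro k
    induction k with
    | zero => intro v _; simp
    | succ k ih =>
      intro v hv
      rw [LieModule.lowerCentralSeries_succ]
      refine Submodule.span_induction (p := fun v _ => v ∈ ⁅(⊤ : LieIdeal F L), LieModule.lowerCentralSeries F L R k⁆) ?_ (zero_mem _)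
        (fun a b _ _ ha hb => add_mem ha hb) (fun c a _ ha => SMulMemClass.smul_mem c ha) hv
      rintro _ ⟨y, hy, v, hv, rfl⟩
      exact LieSubmodule.lie_mem_lie (x := (⟨y, hy⟩ : L)) (LieSubmodule.mem_top _) (ih v hv)
  refine ⟨k, ?_⟩
  rw [eq_bot_iff]
  intro v hv
  have := h2 k v hv
  rw [hk] at this
  simpa using this
end

theorem exp_inj [CharZero F] {x : Module.End F R} {N : ℕ} (hN : x ^ N = 0)
    (h : ∑ k ∈ Finset.range (N + 2), ((k.factorial : F)⁻¹) • x ^ k = 1) : x = 0 := by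
  let Q : Module.End F R := ∑ k ∈ Finset.range N, (((k + 2).factorial : F)⁻¹) • x ^ k
  have hc : Commute x Q := Commute.sum_right _ _ _ fun k _ => (Commute.pow_right (Commute.refl x) k).smul_right _
  have h1 : x * (1 + x * Q) = 0 := by
    rw [Finset.sum_range_succ', Finset.sum_range_succ'] at h
    simp only [Nat.factorial_zero, Nat.cast_one, inv_one, pow_zero, one_smul, zero_add, Nat.factorial_one, pow_one, add_eq_right] at h
    rw [← h, add_comm, mul_add, mul_one]
    congr 1
    simp only [Q, Finset.mul_sum]
    refine Finset.sum_congr rfl fun k _ => ?_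
    rw [mul_smul_comm, mul_smul_comm, ← pow_succ', ← pow_succ']
  have h2 : IsUnit (1 + x * Q) := IsNilpotent.isUnit_one_add (hc.isNilpotent_mul_right ⟨N, hN⟩)
  exact (h2.mul_left_eq_zero).1 h1

end engel

section nil
variable {F : Type} [Field F] [IsAlgClosed F] [CharZero F] {n : ℕ} {G : Subgroup (GL (Fin n) F)}
  {R : Type} [AddCommGroup R] [Module F R] [FiniteDimensional F R]
  {σ : G →* Module.End F R}

theorem unip_of_rep (j : (Fin n → F) →ₗ[F] R) (hj : Function.Injective j)
    (hjσ : ∀ (g : G) v, σ g (j v) = j (((g : GL (Fin n) F) : Matrix (Fin n) (Fin n) F).mulVec v))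
    (g : G) {K : ℕ} (h : (σ g - 1) ^ K = 0) : IsUnipotentElem (g : GL (Fin n) F) := by
  let x : Module.End F (Fin n → F) := Matrix.toLin' (((g : GL (Fin n) F) : Matrix (Fin n) (Fin n) F) - 1)
  have h1 : ∀ k v, j ((x ^ k) v) = ((σ g - 1) ^ k) (j v) := by
    intro k
    induction k with
    | zero => intro v; simp
    | succ k ih =>
      intro v
      rw [pow_succ, pow_succ, Module.End.mul_apply, Module.End.mul_apply, ih]
      congr 1
      simp [x, Matrix.sub_mulVec, hjσ]
  have h2 : IsNilpotent x := ⟨K, LinearMap.ext fun v => hj (by rw [h1, h]; simp)⟩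
  have h3 : x ^ n = 0 := by
    have := LinearMap.aeval_self_charpoly x
    rw [(LinearMap.isNilpotent_iff_charpoly x).1 h2] at this
    simpa using this
  show (((g : GL (Fin n) F) : Matrix (Fin n) (Fin n) F) - 1) ^ n = 0
  apply Matrix.toLin'.injective
  rw [Matrix.toLin'_pow, map_zero]
  exact h3

theorem inj_of_rep (j : (Fin n → F) →ₗ[F] R) (hj : Function.Injective j)
    (hjσ : ∀ (g : G) v, σ g (j v) = j (((g : GL (Fin n) F) : Matrix (Fin n) (Fin n) F).mulVec v)) :
    Function.Injective σ := by
  intro g h hgh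
  apply Subtype.ext
  apply Units.ext
  apply Matrix.toLin'.injective
  refine LinearMap.ext fun v => hj ?_
  rw [Matrix.toLin'_apply, Matrix.toLin'_apply, ← hjσ, ← hjσ, hgh]

theorem nil_ideal (hGcl : IsZClosed (G : Set (GL (Fin n) F))) (hGred : IsReductive G)
    (H : AG (reg G)) (hσ : IsAlgR (reg G) σ) (hGen : Gen hσ)
    (j : (Fin n → F) →ₗ[F] R) (hj : Function.Injective j)
    (hjσ : ∀ (g : G) v, σ g (j v) = j (((g : GL (Fin n) F) : Matrix (Fin n) (Fin n) F).mulVec v))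
    (a : Submodule F (Module.End F R)) (hag : a ≤ LieA H hσ)
    (hid : ∀ z ∈ LieA H hσ, ∀ x ∈ a, z * x - x * z ∈ a) (hn : ∀ x ∈ a, IsNilpotent x) : a = ⊥ := by
  obtain ⟨K, hK⟩ := engel a (fun x hx y hy => hid x (hag hx) y hy) hn
  have hst : ∀ k, ∀ g, ∀ u ∈ Fil a k, σ g u ∈ Fil a k := by
    intro k
    refine stable_of_lie H hσ _ ?_
    intro z hz
    induction k with
    | zero => intro u _; trivial
    | succ k ih =>
      intro u hu
      refine Submodule.span_induction (p := fun u _ => z u ∈ Fil a (k + 1)) ?_ (by simp) ?_ ?_ hu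
      · rintro _ ⟨y, hy, v, hv, rfl⟩
        have : z (y v) = (z * y - y * z) v + y (z v) := by simp
        rw [this]
        exact add_mem (Fil_apply (hid z hz y hy) hv) (Fil_apply hy (ih v hv))
      · intro a b _ _ ha hb; rw [map_add]; exact add_mem ha hb
      · intro c a _ ha; rw [map_smul]; exact Submodule.smul_mem _ _ ha
  let C : Set (reg G) := {f | ∃ k, ∃ ℓ ∈ (Fil a (k + 1)).dualAnnihilator, ∃ v ∈ Fil a k, f = cf hσ ℓ v - algebraMap F _ (ℓ v)}
  have hmem : ∀ g : GL (Fin n) F, g ∈ zset G C ↔ ∃ h : g ∈ G, ∀ k, ∀ v ∈ Fil a k, σ ⟨g, h⟩ v - v ∈ Fil a (k + 1) := by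
    intro g
    constructor
    · rintro ⟨h, hg⟩
      refine ⟨h, fun k v hv => ?_⟩
      rw [← Subspace.forall_mem_dualAnnihilator_apply_eq_zero_iff]
      intro ℓ hℓ
      have := hg _ ⟨k, ℓ, hℓ, v, hv, rfl⟩
      rw [map_sub]
      exact this
    · rintro ⟨h, hg⟩
      refine ⟨h, ?_⟩
      rintro _ ⟨k, ℓ, hℓ, v, hv, rfl⟩
      have := (Submodule.mem_dualAnnihilator ℓ).1 hℓ _ (hg k v hv)
      rw [map_sub] at this
      exact this
  let N : Subgroup (GL (Fin n) F) :=
    { carrier := zset G C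
      one_mem' := by
        rw [hmem]
        refine ⟨G.one_mem, fun k v hv => ?_⟩
        have : σ ⟨1, G.one_mem⟩ = 1 := map_one σ
        rw [this]; simp
      mul_mem' := by
        intro g h hg hh
        rw [hmem] at hg hh ⊢
        obtain ⟨hg', hg⟩ := hg
        obtain ⟨hh', hh⟩ := hh
        refine ⟨G.mul_mem hg' hh', fun k v hv => ?_⟩
        have e : σ ⟨g * h, G.mul_mem hg' hh'⟩ = σ ⟨g, hg'⟩ * σ ⟨h, hh'⟩ := by rw [← map_mul]; rfl
        have : σ ⟨g * h, G.mul_mem hg' hh'⟩ v - v = σ ⟨g, hg'⟩ (σ ⟨h, hh'⟩ v - v) + (σ ⟨g, hg'⟩ v - v) := by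
          rw [e]; simp
        rw [this]
        exact add_mem (hst _ _ _ (hh k v hv)) (hg k v hv)
      inv_mem' := by
        intro g hg
        rw [hmem] at hg ⊢
        obtain ⟨hg', hg⟩ := hg
        refine ⟨G.inv_mem hg', fun k v hv => ?_⟩
        have e : σ ⟨g⁻¹, G.inv_mem hg'⟩ * σ ⟨g, hg'⟩ = 1 := by
          rw [← map_mul, ← map_one σ]; congr 1; ext1; simp
        have : σ ⟨g⁻¹, G.inv_mem hg'⟩ v - v = - σ ⟨g⁻¹, G.inv_mem hg'⟩ (σ ⟨g, hg'⟩ v - v) := by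
          have e' := LinearMap.congr_fun e v
          rw [Module.End.mul_apply, Module.End.one_apply] at e'
          rw [map_sub, e', neg_sub]
        rw [this]
        exact neg_mem (hst _ _ _ (hg k v hv)) }
  have hNmem : ∀ g : GL (Fin n) F, g ∈ N ↔ ∃ h : g ∈ G, ∀ k, ∀ v ∈ Fil a k, σ ⟨g, h⟩ v - v ∈ Fil a (k + 1) := hmem
  have hun : ∀ h ∈ N, IsUnipotentElem h := by
    intro g hg
    obtain ⟨hg', hg⟩ := (hNmem g).1 hg
    refine unip_of_rep j hj hjσ ⟨g, hg'⟩ (K := K) (LinearMap.ext fun v => ?_)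
    have : ∀ k, ((σ ⟨g, hg'⟩ - 1) ^ k) v ∈ Fil a k := by
      intro k
      induction k with
      | zero => trivial
      | succ k ih =>
        rw [pow_succ', Module.End.mul_apply]
        exact hg k _ ih
    have := this K
    rw [hK] at this
    simpa using this
  have hbot : N = ⊥ := by
    refine hGred N ?_ (zset_closed G hGcl C) (unip_conn N hun) hun ?_
    · intro g hg; exact ((hNmem g).1 hg).1
    · intro g hg h hh
      rw [hNmem] at hh ⊢
      obtain ⟨hh', hh⟩ := hh
      refine ⟨G.mul_mem (G.mul_mem hg hh') (G.inv_mem hg), fun k v hv => ?_⟩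
      have e : σ ⟨g * h * g⁻¹, G.mul_mem (G.mul_mem hg hh') (G.inv_mem hg)⟩ = σ ⟨g, hg⟩ * σ ⟨h, hh'⟩ * σ ⟨g⁻¹, G.inv_mem hg⟩ := by
        rw [← map_mul, ← map_mul]; rfl
      have e2 : σ ⟨g, hg⟩ * σ ⟨g⁻¹, G.inv_mem hg⟩ = 1 := by
        rw [← map_mul, ← map_one σ]; congr 1; ext1; simp
      have e' := LinearMap.congr_fun e2 v
      rw [Module.End.mul_apply, Module.End.one_apply] at e'
      have : σ ⟨g * h * g⁻¹, G.mul_mem (G.mul_mem hg hh') (G.inv_mem hg)⟩ v - v =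
          σ ⟨g, hg⟩ (σ ⟨h, hh'⟩ (σ ⟨g⁻¹, G.inv_mem hg⟩ v) - σ ⟨g⁻¹, G.inv_mem hg⟩ v) := by
        rw [e, map_sub, e']; rfl
      rw [this]
      exact hst _ _ _ (hh k _ (hst _ _ _ hv))
  rw [eq_bot_iff]
  intro x hx
  obtain ⟨M, hM⟩ := hn x hx
  obtain ⟨g, hg⟩ := group_exp hGen (hag hx) (N := M + 2) (by omega) (by rw [pow_add, hM, zero_mul])
  have hgN : (g : GL (Fin n) F) ∈ N := by
    rw [hNmem]
    refine ⟨g.2, fun k v hv => ?_⟩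
    have e : σ ⟨(g : GL (Fin n) F), g.2⟩ = σ g := rfl
    rw [e, hg, Finset.sum_range_succ', LinearMap.add_apply]
    simp only [pow_zero, Nat.factorial_zero, Nat.cast_one, inv_one, one_smul, Module.End.one_apply, add_sub_cancel_right]
    rw [LinearMap.sum_apply]
    refine sum_mem fun i _ => ?_
    rw [LinearMap.smul_apply]
    refine Submodule.smul_mem _ _ ?_
    rw [pow_succ', Module.End.mul_apply]
    refine Fil_apply hx ?_
    clear e
    induction i with
    | zero => exact hv
    | succ i ih =>
      rw [pow_succ', Module.End.mul_apply]
      exact Fil_anti a k (Fil_apply hx (ih (by simp_all; omega)))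
  rw [hbot, Subgroup.mem_bot] at hgN
  have : g = 1 := Subtype.ext hgN
  rw [this, map_one] at hg
  exact exp_inj hM hg.symm

/-- The key structure -/
theorem exists_LL (hGcl : IsZClosed (G : Set (GL (Fin n) F))) (hGred : IsReductive G)
    (H : AG (reg G)) (hσ : IsAlgR (reg G) σ) (hGen : Gen hσ)
    (j : (Fin n → F) →ₗ[F] R) (hj : Function.Injective j)
    (hjσ : ∀ (g : G) v, σ g (j v) = j (((g : GL (Fin n) F) : Matrix (Fin n) (Fin n) F).mulVec v)) :
    Nonempty (LL (LieA H hσ).subtype) := by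
  let b : LieA H hσ → LieA H hσ →ₗ[F] LieA H hσ := fun z =>
    { toFun := fun x => ⟨z.1 * x.1 - x.1 * z.1, LieA_bracket z.2 x.2⟩
      map_add' := fun x y => by ext1; simp [mul_add, add_mul]; abel
      map_smul' := fun c x => by ext1; simp [smul_sub] }
  refine ⟨{ inj := Subtype.val_injective, b := b, b_val := fun z x => rfl, rep := ?_, nil := ?_ }⟩
  · intro φ x x' hx'
    exact ⟨⟨x', lie_replica hGen x.2 φ (fun a b => map_add φ a b) hx'⟩, rfl⟩
  · intro a hid hn
    have := nil_ideal hGcl hGred H hσ hGen j hj hjσ (a.map (LieA H hσ).subtype) ?_ ?_ ?_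
    · rw [eq_bot_iff]
      intro x hx
      have h1 : (x : Module.End F R) ∈ a.map (LieA H hσ).subtype := ⟨x, hx, rfl⟩
      rw [this] at h1
      exact Subtype.ext h1
    · rintro _ ⟨x, _, rfl⟩; exact x.2
    · rintro z hz _ ⟨x, hx, rfl⟩
      exact ⟨b ⟨z, hz⟩ x, hid _ _ hx, rfl⟩
    · rintro _ ⟨x, hx, rfl⟩; exact hn x hx
end nil
end Minu

set_option linter.all false
namespace Minu
open Module

section clos
variable {F : Type} [Field F] {n : ℕ}

/-- regular map -/
def RegM (φ : GL (Fin n) F → GL (Fin n) F) : Prop :=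
  ∀ f : reg (⊤ : Subgroup (GL (Fin n) F)), ∃ f' : reg (⊤ : Subgroup (GL (Fin n) F)),
    ∀ g : GL (Fin n) F, (f' : (⊤ : Subgroup (GL (Fin n) F)) → F) ⟨g, trivial⟩ =
      (f : (⊤ : Subgroup (GL (Fin n) F)) → F) ⟨φ g, trivial⟩

theorem pre_closed {φ : GL (Fin n) F → GL (Fin n) F} (hφ : RegM φ) {C : Set (GL (Fin n) F)}
    (hC : IsZClosed C) : IsZClosed (φ ⁻¹' C) := by
  obtain ⟨I, rfl⟩ := hC
  choose φ' hφ' using hφ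
  let Φ : MvPolynomial (Fin n × Fin n) F → reg (⊤ : Subgroup (GL (Fin n) F)) := fun p =>
    regs ⊤ (MvPolynomial.rename Sum.inl p)
  have hΦ : ∀ p (g : GL (Fin n) F), (Φ p : (⊤ : Subgroup (GL (Fin n) F)) → F) ⟨g, trivial⟩ =
      MvPolynomial.eval (fun q => ((g : GL (Fin n) F) : Matrix (Fin n) (Fin n) F) q.1 q.2) p := by
    intro p g
    simp only [Φ]
    rw [regs_apply, MvPolynomial.eval_rename]
    rfl
  convert zset_closed (⊤ : Subgroup (GL (Fin n) F)) ⟨∅, by ext; simp⟩ ((fun p => φ' (Φ p)) '' I) using 1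
  ext g
  simp only [zset, Set.mem_preimage, Set.mem_setOf_eq, Set.forall_mem_image]
  constructor
  · intro h
    refine ⟨trivial, fun p hp => ?_⟩
    rw [hφ', hΦ]; exact h p hp
  · rintro ⟨_, h⟩ p hp
    have := h hp
    rw [hφ', hΦ] at this; exact this

theorem regM_left (a : GL (Fin n) F) : RegM (fun g => a * g) := by
  intro f
  obtain ⟨ι, _, u, v, h⟩ := reg_isCo ⊤ f
  refine ⟨∑ i, (u i : (⊤ : Subgroup (GL (Fin n) F)) → F) ⟨a, trivial⟩ • v i, fun g => ?_⟩
  have := h ⟨a, trivial⟩ ⟨g, trivial⟩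
  refine Eq.trans ?_ this.symm
  simp

theorem regM_right (a : GL (Fin n) F) : RegM (fun g => g * a) := by
  intro f
  obtain ⟨ι, _, u, v, h⟩ := reg_isCo ⊤ f
  refine ⟨∑ i, (v i : (⊤ : Subgroup (GL (Fin n) F)) → F) ⟨a, trivial⟩ • u i, fun g => ?_⟩
  have := h ⟨g, trivial⟩ ⟨a, trivial⟩
  refine Eq.trans ?_ this.symm
  simp [mul_comm]

theorem regM_inv : RegM (fun g : GL (Fin n) F => g⁻¹) := by
  intro f
  obtain ⟨p, rfl⟩ := regs_surj _ f
  refine ⟨regs _ (MvPolynomial.rename Sum.swap p), fun g => ?_⟩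
  rw [regs_apply, regs_apply, MvPolynomial.eval_rename]
  congr 2
  funext i
  rcases i with i | i <;> simp [gco]

theorem sub_closed (W : Submodule F (Matrix (Fin n) (Fin n) F)) :
    IsZClosed {g : GL (Fin n) F | (g : Matrix (Fin n) (Fin n) F) ∈ W} := by
  let Φ : Module.Dual F (Matrix (Fin n) (Fin n) F) → MvPolynomial (Fin n × Fin n) F := fun ℓ =>
    ∑ i, ∑ j, MvPolynomial.C (ℓ (Matrix.single i j 1)) * MvPolynomial.X (i, j)
  refine ⟨Φ '' (W.dualAnnihilator : Set _), ?_⟩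
  ext g
  have h : ∀ ℓ, MvPolynomial.eval (fun q => ((g : GL (Fin n) F) : Matrix (Fin n) (Fin n) F) q.1 q.2) (Φ ℓ) =
      ℓ (g : Matrix (Fin n) (Fin n) F) := by
    intro ℓ
    conv_rhs => rw [Matrix.matrix_eq_sum_single (g : Matrix (Fin n) (Fin n) F)]
    simp only [Φ, map_sum, map_mul, MvPolynomial.eval_C, MvPolynomial.eval_X]
    refine Finset.sum_congr rfl fun i _ => Finset.sum_congr rfl fun j _ => ?_
    have : Matrix.single i j ((g : Matrix (Fin n) (Fin n) F) i j) = (g : Matrix (Fin n) (Fin n) F) i j • Matrix.single i j (1 : F) := by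
      simp
    rw [this, map_smul, smul_eq_mul, mul_comm]
  simp only [Set.mem_setOf_eq, Set.forall_mem_image, h]
  rw [← Subspace.forall_mem_dualAnnihilator_apply_eq_zero_iff]
  rfl

/-- closure -/
def zcl (S : Set (GL (Fin n) F)) : Set (GL (Fin n) F) := {g | ∀ C, IsZClosed C → S ⊆ C → g ∈ C}

theorem zcl_closed (S : Set (GL (Fin n) F)) : IsZClosed (zcl S) := by
  refine ⟨{p | ∀ g ∈ S, MvPolynomial.eval (fun q => ((g : GL (Fin n) F) : Matrix (Fin n) (Fin n) F) q.1 q.2) p = 0}, ?_⟩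
  ext g
  constructor
  · intro h p hp
    have := h {g | ∀ p' ∈ ({p} : Set _), MvPolynomial.eval (fun q => ((g : GL (Fin n) F) : Matrix (Fin n) (Fin n) F) q.1 q.2) p' = 0} ⟨_, rfl⟩
      (by intro s hs p' hp'; rw [Set.mem_singleton_iff.1 hp']; exact hp s hs)
    exact this p rfl
  · rintro h C ⟨I, rfl⟩ hS p hp
    exact h p fun s hs => hS hs p hp

theorem sub_zcl (S : Set (GL (Fin n) F)) : S ⊆ zcl S := fun s hs C _ h => h hs

/-- closure of a subgroup -/
def zclS (S : Subgroup (GL (Fin n) F)) : Subgroup (GL (Fin n) F) where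
  carrier := zcl (S : Set (GL (Fin n) F))
  one_mem' := sub_zcl _ S.one_mem
  mul_mem' := by
    intro a b ha hb
    have h1 : ∀ s ∈ S, ∀ b ∈ zcl (S : Set (GL (Fin n) F)), s * b ∈ zcl (S : Set (GL (Fin n) F)) := by
      intro s hs b hb
      exact hb _ (pre_closed (regM_left s) (zcl_closed (S : Set (GL (Fin n) F)))) fun c hc =>
        sub_zcl _ (S.mul_mem hs hc)
    exact ha _ (pre_closed (regM_right b) (zcl_closed (S : Set (GL (Fin n) F)))) fun c hc => h1 c hc b hb
  inv_mem' := by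
    intro a ha
    exact ha _ (pre_closed regM_inv (zcl_closed (S : Set (GL (Fin n) F)))) fun c hc => sub_zcl _ (S.inv_mem hc)

theorem zcl_conn {S : Set (GL (Fin n) F)} (hS : IsZConnected S) : IsZConnected (zcl S) := by
  rintro C₁ C₂ h₁ h₂ hsub ⟨g₁, hg₁, hg₁'⟩ ⟨g₂, hg₂, hg₂'⟩
  by_cases e₁ : (S ∩ C₁).Nonempty
  · by_cases e₂ : (S ∩ C₂).Nonempty
    · obtain ⟨g, hg, h⟩ := hS C₁ C₂ h₁ h₂ ((sub_zcl S).trans hsub) e₁ e₂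
      exact ⟨g, sub_zcl S hg, h⟩
    · refine ⟨g₂, hg₂, ?_, hg₂'⟩
      refine hg₂ C₁ h₁ fun s hs => ?_
      rcases hsub (sub_zcl S hs) with h | h
      · exact h
      · exact absurd ⟨s, hs, h⟩ e₂
  · refine ⟨g₁, hg₁, hg₁', ?_⟩
    refine hg₁ C₂ h₂ fun s hs => ?_
    rcases hsub (sub_zcl S hs) with h | h
    · exact absurd ⟨s, hs, h⟩ e₁
    · exact h

/-- `T⟨γ⟩` -/
def adj (T : Subgroup (GL (Fin n) F)) (γ : GL (Fin n) F) (hc : ∀ t ∈ T, Commute γ t) : Subgroup (GL (Fin n) F) where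
  carrier := {g | ∃ t ∈ T, ∃ k : ℤ, g = t * γ ^ k}
  one_mem' := ⟨1, T.one_mem, 0, by simp⟩
  mul_mem' := by
    rintro _ _ ⟨t, ht, k, rfl⟩ ⟨t', ht', k', rfl⟩
    refine ⟨t * t', T.mul_mem ht ht', k + k', ?_⟩
    have := ((hc t' ht').zpow_left k).eq
    rw [zpow_add, mul_assoc, ← mul_assoc (γ ^ k), this]; group
  inv_mem' := by
    rintro _ ⟨t, ht, k, rfl⟩
    refine ⟨t⁻¹, T.inv_mem ht, -k, ?_⟩
    have := ((hc t⁻¹ (T.inv_mem ht)).zpow_left (-k)).eq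
    rw [mul_inv_rev, ← zpow_neg, this]

theorem adj_conn [CharZero F] (T : Subgroup (GL (Fin n) F)) (hT : IsZConnected (T : Set (GL (Fin n) F)))
    (γ : GL (Fin n) F) (hc : ∀ t ∈ T, Commute γ t)
    (hγ : ∀ i j, (fun k : ℕ => ((γ ^ k : GL (Fin n) F) : Matrix (Fin n) (Fin n) F) i j) ∈ E2 F) :
    IsZConnected (adj T γ hc : Set (GL (Fin n) F)) := by
  rintro C₁ C₂ h₁ h₂ hsub ⟨_, ⟨t₁, ht₁, a, rfl⟩, hg₁⟩ ⟨_, ⟨t₂, ht₂, b, rfl⟩, hg₂⟩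
  let M := min a b
  let c : ℕ → GL (Fin n) F := fun k => γ ^ M * γ ^ k
  have hcE : ∀ i j, (fun k => (c k : Matrix (Fin n) (Fin n) F) i j) ∈ E2 F := by
    intro i j
    have : (fun k => (c k : Matrix (Fin n) (Fin n) F) i j) = ∑ l, ((γ ^ M : GL (Fin n) F) : Matrix (Fin n) (Fin n) F) i l •
        (fun k : ℕ => ((γ ^ k : GL (Fin n) F) : Matrix (Fin n) (Fin n) F) l j) := by
      funext k
      rw [Finset.sum_apply]
      simp only [c, Units.val_mul, Matrix.mul_apply]
      rfl
    rw [this]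
    exact sum_mem fun r _ => Subalgebra.smul_mem _ (hγ r j) _
  have hcz : ∀ k, c k = γ ^ (M + k) := fun k => by simp [c, zpow_add]
  have hcH : ∀ k, c k ∈ adj T γ hc := fun k => ⟨1, T.one_mem, M + k, by rw [one_mul, hcz]⟩
  have hun : {k | c k ∈ C₁} ∪ {k | c k ∈ C₂} = Set.univ := by
    ext k; simpa using hsub (hcH k)
  have hinf : ({k | c k ∈ C₁} ∪ {k | c k ∈ C₂}).Infinite := by rw [hun]; exact Set.infinite_univ
  have key : ∀ b : ℤ, (∃ t ∈ T, t * γ ^ b ∈ C₁) → (∃ t ∈ T, t * γ ^ b ∈ C₂) →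
      ((adj T γ hc : Set (GL (Fin n) F)) ∩ (C₁ ∩ C₂)).Nonempty := by
    rintro b ⟨t₁, ht₁, e₁⟩ ⟨t₂, ht₂, e₂⟩
    obtain ⟨t, ht, h⟩ := hT _ _ (pre_closed (regM_right (γ ^ b)) h₁) (pre_closed (regM_right (γ ^ b)) h₂)
      (fun t ht => hsub ⟨t, ht, b, rfl⟩) ⟨t₁, ht₁, e₁⟩ ⟨t₂, ht₂, e₂⟩
    exact ⟨t * γ ^ b, ⟨t, ht, b, rfl⟩, h⟩
  rcases Set.infinite_union.1 hinf with h | h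
  · have := curve E2_rigid c hcE h₁ h (b - M).toNat
    have e : M + (b - M).toNat = b := by omega
    rw [hcz, e] at this
    exact key b ⟨1, T.one_mem, by rwa [one_mul]⟩ ⟨t₂, ht₂, hg₂⟩
  · have := curve E2_rigid c hcE h₂ h (a - M).toNat
    have e : M + (a - M).toNat = a := by omega
    rw [hcz, e] at this
    exact key a ⟨t₁, ht₁, hg₁⟩ ⟨1, T.one_mem, by rwa [one_mul]⟩

theorem diag_inv (g : GL (Fin n) F) (h : Diag (Matrix.toLin' (g : Matrix (Fin n) (Fin n) F))) :
    Diag (Matrix.toLin' ((g⁻¹ : GL (Fin n) F) : Matrix (Fin n) (Fin n) F)) := by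
  rw [Diag, eq_top_iff, ← show _ = _ from h]
  refine iSup_le fun μ v hv => ?_
  rw [Module.End.mem_eigenspace_iff, Matrix.toLin'_apply] at hv
  have h1 : v = μ • ((g⁻¹ : GL (Fin n) F) : Matrix (Fin n) (Fin n) F).mulVec v := by
    rw [← Matrix.mulVec_smul, ← hv, Matrix.mulVec_mulVec, ← Units.val_mul]; simp
  by_cases h0 : μ = 0
  · rw [h0, zero_smul] at h1
    rw [h1]; exact zero_mem _
  · refine Submodule.mem_iSup_of_mem μ⁻¹ ?_
    rw [Module.End.mem_eigenspace_iff, Matrix.toLin'_apply]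
    conv_rhs => rw [h1]
    rw [smul_smul, inv_mul_cancel₀ h0, one_smul]

theorem diag_mul [IsAlgClosed F] [CharZero F] (g h : GL (Fin n) F) (hc : Commute g h)
    (hg : Diag (Matrix.toLin' (g : Matrix (Fin n) (Fin n) F)))
    (hh : Diag (Matrix.toLin' (h : Matrix (Fin n) (Fin n) F))) :
    Diag (Matrix.toLin' ((g * h : GL (Fin n) F) : Matrix (Fin n) (Fin n) F)) := by
  rw [Units.val_mul, Matrix.toLin'_mul]
  refine diag_iff_ss.2 (Module.End.IsSemisimple.mul_of_commute ?_ hg.ss hh.ss)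
  show Matrix.toLin' _ ∘ₗ Matrix.toLin' _ = Matrix.toLin' _ ∘ₗ Matrix.toLin' _
  rw [← Matrix.toLin'_mul, ← Matrix.toLin'_mul, ← Units.val_mul, ← Units.val_mul, hc.eq]

theorem diag_zpow [IsAlgClosed F] [CharZero F] (g : GL (Fin n) F)
    (hg : Diag (Matrix.toLin' (g : Matrix (Fin n) (Fin n) F))) (k : ℤ) :
    Diag (Matrix.toLin' ((g ^ k : GL (Fin n) F) : Matrix (Fin n) (Fin n) F)) := by
  have h : ∀ k : ℕ, Diag (Matrix.toLin' ((g ^ k : GL (Fin n) F) : Matrix (Fin n) (Fin n) F)) := by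
    intro k
    induction k with
    | zero =>
      rw [Diag, eq_top_iff]; intro v _
      exact Submodule.mem_iSup_of_mem 1 (by simp [Module.End.mem_eigenspace_iff])
    | succ k ih => rw [pow_succ]; exact diag_mul _ _ ((Commute.refl g).pow_left k) ih hg
  rcases k with k | k
  · simpa using h k
  · rw [zpow_negSucc]; exact diag_inv _ (h _)

theorem torus_absorb [IsAlgClosed F] [CharZero F] {G T : Subgroup (GL (Fin n) F)}
    (hGcl : IsZClosed (G : Set (GL (Fin n) F))) (hT : IsMaximalTorus G T)
    {γ : GL (Fin n) F} (hγG : γ ∈ G) (hc : ∀ t ∈ T, Commute γ t)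
    (hγ : ∀ i j, (fun k : ℕ => ((γ ^ k : GL (Fin n) F) : Matrix (Fin n) (Fin n) F) i j) ∈ E2 F)
    (hd : Diag (Matrix.toLin' (γ : Matrix (Fin n) (Fin n) F))) : γ ∈ T := by
  obtain ⟨hTG, ⟨hTcl, hTco, hTss, hTcomm⟩, hmax⟩ := hT
  let S := adj T γ hc
  let W : Submodule F (Module.End F (Fin n → F)) := Submodule.span F
    ((fun g : GL (Fin n) F => (Matrix.toLin' (g : Matrix (Fin n) (Fin n) F) : Module.End F (Fin n → F))) '' S)
  have hW := Diag.span (S := (fun g : GL (Fin n) F => (Matrix.toLin' (g : Matrix (Fin n) (Fin n) F) : Module.End F (Fin n → F))) '' S)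
    (by
      rintro _ ⟨_, ⟨t, ht, k, rfl⟩, rfl⟩
      exact diag_mul _ _ ((hc t ht).zpow_left k).symm ((ssElem_iff t).1 (hTss t ht)) (diag_zpow γ hd k))
    (by
      rintro _ ⟨_, ⟨t, ht, k, rfl⟩, rfl⟩ _ ⟨_, ⟨t', ht', k', rfl⟩, rfl⟩
      show Matrix.toLin' _ ∘ₗ Matrix.toLin' _ = Matrix.toLin' _ ∘ₗ Matrix.toLin' _
      rw [← Matrix.toLin'_mul, ← Matrix.toLin'_mul, ← Units.val_mul, ← Units.val_mul]
      congr 2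
      have a1 : Commute t t' := hTcomm t ht t' ht'
      have a2 : Commute (γ ^ k) t' := (hc t' ht').zpow_left k
      have a3 : Commute t (γ ^ k') := ((hc t ht).zpow_left k').symm
      have a4 : Commute (γ ^ k) (γ ^ k') := (Commute.refl γ).zpow_zpow k k'
      exact ((a1.mul_left a2).mul_right (a3.mul_left a4)).eq)
  have hcl : ∀ g ∈ zclS S, (Matrix.toLin' (g : Matrix (Fin n) (Fin n) F) : Module.End F (Fin n → F)) ∈ W := by
    intro g hg
    have := hg _ (sub_closed (W.comap (Matrix.toLin' : Matrix (Fin n) (Fin n) F ≃ₗ[F] _).toLinearMap))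
      (fun s hs => Submodule.subset_span ⟨s, hs, rfl⟩)
    exact this
  have htor : IsTorus (zclS S) := by
    refine ⟨zcl_closed _, zcl_conn (adj_conn T hTco γ hc hγ), fun t ht => (ssElem_iff t).2 (hW _ (hcl t ht)).1, fun a ha b hb => ?_⟩
    have := (hW _ (hcl a ha)).2 _ (hcl b hb)
    apply Units.ext
    apply Matrix.toLin'.injective
    rw [Units.val_mul, Units.val_mul, Matrix.toLin'_mul, Matrix.toLin'_mul]
    exact this
  have hTS : T ≤ zclS S := fun t ht => sub_zcl _ ⟨t, ht, 0, by simp⟩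
  have hSG : zclS S ≤ G := by
    intro g hg
    refine hg _ hGcl ?_
    rintro _ ⟨t, ht, k, rfl⟩
    exact G.mul_mem (hTG ht) (G.zpow_mem hγG k)
  rw [← hmax (zclS S) hSG htor hTS]
  exact sub_zcl _ ⟨1, T.one_mem, 1, by simp⟩

end clos
end Minu

set_option linter.all false
namespace Minu
open Module

section tor
variable {F : Type} [Field F] {n : ℕ} {G T : Subgroup (GL (Fin n) F)}
  {R : Type} [AddCommGroup R] [Module F R]

/-- image of the torus -/
def TS (T : Subgroup (GL (Fin n) F)) (σ : G →* Module.End F R) : Set (Module.End F R) :=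
  {y | ∃ t : G, (t : GL (Fin n) F) ∈ T ∧ y = σ t}

/-- span of the torus -/
def SpT (T : Subgroup (GL (Fin n) F)) (σ : G →* Module.End F R) : Subalgebra F (Module.End F R) :=
  Algebra.adjoin F (TS T σ)

variable {σ : G →* Module.End F R}

theorem spT_span {y : Module.End F R} (hy : y ∈ SpT T σ) : y ∈ Submodule.span F (TS T σ) := by
  let N : Submonoid (Module.End F R) :=
    { carrier := TS T σ
      one_mem' := ⟨1, T.one_mem, by simp⟩
      mul_mem' := by
        rintro _ _ ⟨t, ht, rfl⟩ ⟨t', ht', rfl⟩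
        exact ⟨t * t', T.mul_mem ht ht', by simp⟩ }
  have h1 : y ∈ Subalgebra.toSubmodule (Algebra.adjoin F (N : Set (Module.End F R))) := hy
  rw [Algebra.adjoin_eq_span, Submonoid.closure_eq] at h1
  exact h1

theorem res_mem (hTG : T ≤ G) (f : reg G) : (fun t : T => (f : G → F) (Subgroup.inclusion hTG t)) ∈ reg T := by
  obtain ⟨p, rfl⟩ := regs_surj G f
  have : (fun t : T => (regs G p : G → F) (Subgroup.inclusion hTG t)) = (regs T p : T → F) := by
    funext t
    rw [regs_apply, regs_apply]; rfl
  rw [this]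
  exact (regs T p).2

/-- restriction -/
def res (hTG : T ≤ G) : reg G →ₗ[F] reg T where
  toFun f := ⟨_, res_mem hTG f⟩
  map_add' f g := rfl
  map_smul' c f := rfl

@[simp] theorem res_apply (hTG : T ≤ G) (f : reg G) (t : T) :
    (res hTG f : T → F) t = (f : G → F) (Subgroup.inclusion hTG t) := rfl

theorem resAlg (hTG : T ≤ G) (hσ : IsAlgR (reg G) σ) : IsAlgR (reg T) (σ.comp (Subgroup.inclusion hTG)) := by
  intro ℓ v
  exact res_mem hTG (cf hσ ℓ v)

theorem res_cf (hTG : T ≤ G) (hσ : IsAlgR (reg G) σ) (ℓ v) :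
    res hTG (cf hσ ℓ v) = cf (resAlg hTG hσ) ℓ v := rfl

theorem lieT_le (hTG : T ≤ G) (H : AG (reg G)) (HT : AG (reg T)) (hσ : IsAlgR (reg G) σ)
    {x : Module.End F R} (hx : x ∈ LieA HT (resAlg hTG hσ)) : x ∈ LieA H hσ := by
  obtain ⟨D, hD, hop⟩ := hx
  let δ : reg G →ₗ[F] F := (evA (reg T) 1).toLinearMap ∘ₗ D ∘ₗ res hTG
  have hδ : IsPD δ := by
    intro f g
    have h1 : res hTG (f * g) = res hTG f * res hTG g := rfl
    have := hD.pd HT (res hTG f) (res hTG g)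
    simp only [LinearMap.comp_apply, δ, h1] at this ⊢
    rw [this]
    simp only [res_apply, map_one]
  refine ⟨Dd H δ, Dd_LID H hδ, fun ℓ v => ?_⟩
  ext g
  rw [Dd_apply, lam_cf]
  show (D (res hTG (cf hσ (ℓ ∘ₗ σ g) v)) : T → F) 1 = _
  rw [res_cf, hop]
  simp

theorem lieT_span [FiniteDimensional F R] (hTG : T ≤ G) (HT : AG (reg T)) (hσ : IsAlgR (reg G) σ)
    {x : Module.End F R} (hx : x ∈ LieA HT (resAlg hTG hσ)) : x ∈ Submodule.span F (TS T σ) := by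
  obtain ⟨D, hD, hop⟩ := hx
  rw [← Subspace.forall_mem_dualAnnihilator_apply_eq_zero_iff]
  intro ξ hξ
  let b := Module.finBasis F R
  have hdec : ∀ y : Module.End F R, y = ∑ i, ∑ j, (b.coord i (y (b j))) • ((b.coord j).smulRight (b i) : Module.End F R) := by
    intro y
    refine b.ext fun k => ?_
    simp only [LinearMap.sum_apply, LinearMap.smul_apply, LinearMap.smulRight_apply, Basis.coord_apply, Basis.repr_self]
    conv_lhs => rw [← b.sum_repr (y (b k))]
    refine Finset.sum_congr rfl fun i _ => ?_
    rw [Finset.sum_eq_single k]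
    · simp
    · intro j _ hj; simp [Finsupp.single_apply, hj.symm]
    · simp
  let c : Fin (finrank F R) → Fin (finrank F R) → F := fun i j => ξ ((b.coord j).smulRight (b i) : Module.End F R)
  have hξd : ∀ y : Module.End F R, ξ y = ∑ i, ∑ j, b.coord i (y (b j)) * c i j := by
    intro y
    conv_lhs => rw [hdec y]
    simp [c]
  let f : reg T := ∑ i, ∑ j, c i j • cf (resAlg hTG hσ) (b.coord i) (b j)
  have hev : ∀ t : T, evA (reg T) t f = ξ (σ (Subgroup.inclusion hTG t)) := by
    intro t
    rw [hξd]
    simp only [f, map_sum, map_smul]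
    refine Finset.sum_congr rfl fun i _ => Finset.sum_congr rfl fun j _ => ?_
    rw [smul_eq_mul, mul_comm]; rfl
  have hf : f = 0 := by
    ext t
    have := hev t
    rw [(Submodule.mem_dualAnnihilator ξ).1 hξ _ (Submodule.subset_span ⟨_, t.2, rfl⟩)] at this
    exact this
  have h2 : evA (reg T) 1 (D f) = ξ x := by
    rw [hξd]
    simp only [f, map_sum, map_smul, hop _ _]
    refine Finset.sum_congr rfl fun i _ => Finset.sum_congr rfl fun j _ => ?_
    rw [smul_eq_mul, mul_comm]
    congr 1
    show b.coord i (σ (Subgroup.inclusion hTG 1) (x (b j))) = _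
    simp
  rw [← h2, hf]; simp

theorem comm_T [CharZero F] [FiniteDimensional F R] (hTG : T ≤ G) (H : AG (reg G)) (HT : AG (reg T)) (hσ : IsAlgR (reg G) σ)
    (z : Module.End F R) (hz : ∀ x ∈ LieA H hσ, x ∈ SpT T σ → Commute x z) :
    ∀ t : G, (t : GL (Fin n) F) ∈ T → Commute (σ t) z := by
  intro t ht
  refine commute_of_lie HT (resAlg hTG hσ) z ?_ ⟨t, ht⟩
  intro x hx
  refine hz x (lieT_le hTG H HT hσ hx) ?_
  exact Algebra.span_le_adjoin F _ (lieT_span hTG HT hσ hx)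

end tor

section poly
variable {F : Type} [Field F] [IsAlgClosed F] [CharZero F]
  {R : Type} [AddCommGroup R] [Module F R] [FiniteDimensional F R]

theorem rep_poly {x x' : Module.End F R} (hx : Diag x) (φ : F → F)
    (h : ∀ (μ : F) v, x v = μ • v → x' v = φ μ • v) : ∃ P : Polynomial F, x' = Polynomial.aeval x P := by
  classical
  let s := (finite_maxGen x).toFinset
  refine ⟨Lagrange.interpolate s id φ, ?_⟩
  refine LinearMap.ext fun v => hx.induction (P := fun v => x' v = (Polynomial.aeval x (Lagrange.interpolate s id φ)) v) v ?_ (by simp) ?_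
  · intro μ v hv
    rw [h μ v hv]
    by_cases hv0 : v = 0
    · simp [hv0]
    have hμ : μ ∈ s := by
      simp only [s, Set.Finite.mem_toFinset, Set.mem_setOf_eq]
      intro hb
      have := eig_le_maxGen x μ (Module.End.mem_eigenspace_iff.2 hv)
      rw [hb] at this
      exact hv0 (by simpa using this)
    rw [Module.End.aeval_apply_of_hasEigenvector ⟨Module.End.mem_eigenspace_iff.2 hv, hv0⟩]
    have := Lagrange.eval_interpolate_at_node φ (s := s) (v := id) (Set.injOn_id _) hμ
    rw [id] at this
    rw [this]
  · intro v w h1 h2; simp only [map_add, h1, h2]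
end poly

section absorb
variable {F : Type} [Field F] [IsAlgClosed F] [CharZero F] {n : ℕ} {G T : Subgroup (GL (Fin n) F)}
  {R : Type} [AddCommGroup R] [Module F R] [FiniteDimensional F R]
  {σ : G →* Module.End F R}

open Classical in
/-- `m ↦ 2^m` on integers -/
noncomputable def twop (a : F) : F := if h : ∃ m : ℤ, (m : F) = a then (2 : F) ^ h.choose else 0

theorem twop_int (m : ℤ) : twop (m : F) = (2 : F) ^ m := by
  have h : ∃ k : ℤ, (k : F) = (m : F) := ⟨m, rfl⟩
  rw [twop, dif_pos h]
  congr 1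
  exact_mod_cast h.choose_spec

theorem twoz_inj {a b : ℤ} (h : (2 : F) ^ a = (2 : F) ^ b) : a = b := by
  have h2 : (2 : F) ≠ 0 := two_ne_zero
  wlog hab : a ≤ b generalizing a b
  · exact (this h.symm (le_of_not_ge hab)).symm
  obtain ⟨k, rfl⟩ := Int.le.dest hab
  rw [zpow_add₀ h2] at h
  have h3 : (2 : F) ^ (k : ℤ) = 1 := by
    have := zpow_ne_zero a h2
    field_simp at h
    exact h.symm
  have h4 : (fun k : ℕ => (2 : F) ^ k) k = (fun k : ℕ => (2 : F) ^ k) 0 := by simpa using h3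
  have := two_pow_inj h4
  omega

theorem int_replica (hGcl : IsZClosed (G : Set (GL (Fin n) F))) (hT : IsMaximalTorus G T)
    {H : AG (reg G)} {hσ : IsAlgR (reg G) σ} (hGen : Gen hσ)
    (j : (Fin n → F) →ₗ[F] R) (hj : Function.Injective j)
    (hjσ : ∀ (g : G) v, σ g (j v) = j (((g : GL (Fin n) F) : Matrix (Fin n) (Fin n) F).mulVec v))
    {x : Module.End F R} (hx : x ∈ LieA H hσ) (hxT : ∀ t : G, (t : GL (Fin n) F) ∈ T → Commute (σ t) x)
    (φ : F → F) (hφ : ∀ a b, φ (a + b) = φ a + φ b) (hφZ : ∀ μ, x.maxGenEigenspace μ ≠ ⊥ → ∃ m : ℤ, φ μ = m)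
    {h : Module.End F R} (hh : IsRep φ x h) : h ∈ SpT T σ := by
  have hhg : h ∈ LieA H hσ := lie_replica hGen hx φ hφ hh
  have hhT : ∀ t : G, (t : GL (Fin n) F) ∈ T → Commute (σ t) h := fun t ht => hh.comm (spl_of_fd x) (hxT t ht)
  have hsx : ⨆ μ : (Int.castAddHom F).range, h.maxGenEigenspace (μ : F) = ⊤ := by
    rw [eq_top_iff, ← show _ = _ from spl_of_fd x]
    refine iSup_le fun μ => ?_
    by_cases hb : x.maxGenEigenspace μ = ⊥
    · rw [hb]; exact bot_le
    obtain ⟨m, hm⟩ := hφZ μ hb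
    intro v hv
    refine Submodule.mem_iSup_of_mem ⟨(m : F), ⟨m, rfl⟩⟩ ?_
    refine eig_le_maxGen _ _ (Module.End.mem_eigenspace_iff.2 ?_)
    rw [hh μ v hv, hm]
  have hIntInd : ∀ (P : R → Prop) (v : R), (∀ (m : ℤ) v, h v = (m : F) • v → P v) → P 0 → (∀ v w, P v → P w → P (v + w)) → P v := by
    intro P v h1 h0 ha
    refine (spl_of_fd x).induction (P := P) v ?_ h0 ha
    intro μ v hv
    by_cases hb : x.maxGenEigenspace μ = ⊥
    · rw [hb] at hv
      rw [(Submodule.mem_bot F).1 hv]; exact h0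
    obtain ⟨m, hm⟩ := hφZ μ hb
    exact h1 m v (by rw [hh μ v hv, hm])
  obtain ⟨x', hx'⟩ := exists_isRep (spl_of_fd h) twop
  obtain ⟨γ, hγ⟩ := group_replica hGen hhg (Int.castAddHom F).range hsx twop
    (by have := twop_int (F := F) 0; simpa using this)
    (by
      rintro _ ⟨a, rfl⟩ _ ⟨b, rfl⟩
      have := twop_int (F := F) (a + b)
      push_cast at this
      show twop ((a : F) + (b : F)) = twop (a : F) * twop (b : F)
      rw [this, twop_int, twop_int, zpow_add₀ two_ne_zero]) hx'
  have heig : ∀ (m : ℤ) v, h v = (m : F) • v → σ γ v = (2 : F) ^ m • v := by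
    intro m v hv
    rw [hγ, hx' m v (eig_le_maxGen _ _ (Module.End.mem_eigenspace_iff.2 hv)), twop_int]
  have hdR : Diag (σ γ) := by
    rw [hγ]; exact diag_of_isRep (spl_of_fd h) _ hx'
  have hγT : (γ : GL (Fin n) F) ∈ T := by
    refine torus_absorb hGcl hT γ.2 ?_ ?_ ?_
    · intro t ht
      have hc : Commute (σ ⟨t, hT.1 ht⟩) (σ γ) := by
        rw [hγ]; exact hx'.comm (spl_of_fd h) (hhT _ ht)
      have h2 : (⟨t, hT.1 ht⟩ : G) * γ = γ * ⟨t, hT.1 ht⟩ := by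
        apply inj_of_rep j hj hjσ
        rw [map_mul, map_mul]; exact hc.eq
      exact (congrArg Subtype.val h2).symm
    · intro i l
      obtain ⟨p, hp⟩ := LinearMap.exists_leftInverse_of_injective j (LinearMap.ker_eq_bot.2 hj)
      have h1 : ∀ (k : ℕ), (((γ : GL (Fin n) F) ^ k : GL (Fin n) F) : Matrix (Fin n) (Fin n) F) i l =
          p ((σ γ ^ k) (j (Pi.single l 1))) i := by
        intro k
        rw [← map_pow, hjσ, show p (j _) = _ from LinearMap.congr_fun hp _]
        simp
      simp only [h1]
      refine hIntInd (fun v => (fun k : ℕ => p ((σ γ ^ k) v) i) ∈ E2 F) _ ?_ ?_ ?_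
      · intro m v hv
        have h3 : ∀ k : ℕ, (σ γ ^ k) v = ((2 : F) ^ m) ^ k • v := by
          intro k
          induction k with
          | zero => simp
          | succ k ih => rw [pow_succ', Module.End.mul_apply, ih, map_smul, heig m v hv, smul_smul, pow_succ]
        simp only [h3, map_smul, Pi.smul_apply, smul_eq_mul]
        exact (E2 F).mul_mem (E2_zpow m) ((E2 F).algebraMap_mem (p v i))
      · simp only [map_zero, Pi.zero_apply]; exact (E2 F).zero_mem
      · intro v w h1 h2
        simp only [map_add, Pi.add_apply]; exact (E2 F).add_mem h1 h2
    · refine diag_of_isRep (x := (Matrix.toLin' ((γ : GL (Fin n) F) : Matrix (Fin n) (Fin n) F) : Module.End F (Fin n → F))) (spl_of_fd _) id (IsRep.of_injective hdR.isRep j hj ?_ ?_) <;>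
      · intro v; rw [Matrix.toLin'_apply, hjσ]
  have hpoly : ∃ P : Polynomial F, h = Polynomial.aeval (σ γ) P := by
    classical
    let lg : F → F := fun a => if e : ∃ m : ℤ, (2 : F) ^ m = a then (e.choose : F) else 0
    have hlg : ∀ m : ℤ, lg ((2 : F) ^ m) = m := by
      intro m
      have e : ∃ k : ℤ, (2 : F) ^ k = (2 : F) ^ m := ⟨m, rfl⟩
      simp only [lg]
      rw [dif_pos e, twoz_inj e.choose_spec]
    obtain ⟨y, hy⟩ := exists_isRep (spl_of_fd (σ γ)) lg
    have : h = y := by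
      refine LinearMap.ext fun v => hIntInd (fun v => h v = y v) v ?_ (by simp) (fun v w h1 h2 => by simp only [map_add, h1, h2])
      intro m v hv
      rw [hv, hy _ v (eig_le_maxGen _ _ (Module.End.mem_eigenspace_iff.2 (heig m v hv))), hlg]
    rw [this]
    exact rep_poly hdR lg fun μ v hv => hy μ v (eig_le_maxGen _ _ (Module.End.mem_eigenspace_iff.2 hv))
  obtain ⟨P, hP⟩ := hpoly
  rw [hP]
  have h1 : σ γ ∈ SpT T σ := Algebra.subset_adjoin ⟨γ, hγT, rfl⟩
  exact Algebra.adjoin_le (Set.singleton_subset_iff.2 h1) (Polynomial.aeval_mem_adjoin_singleton F (σ γ))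

theorem ss_mem (hGcl : IsZClosed (G : Set (GL (Fin n) F))) (hT : IsMaximalTorus G T)
    {H : AG (reg G)} {hσ : IsAlgR (reg G) σ} (hGen : Gen hσ)
    (j : (Fin n → F) →ₗ[F] R) (hj : Function.Injective j)
    (hjσ : ∀ (g : G) v, σ g (j v) = j (((g : GL (Fin n) F) : Matrix (Fin n) (Fin n) F).mulVec v))
    {x : Module.End F R} (hx : x ∈ LieA H hσ) (hxT : ∀ t : G, (t : GL (Fin n) F) ∈ T → Commute (σ t) x)
    {xs : Module.End F R} (hs : IsRep id x xs) : xs ∈ SpT T σ := by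
  classical
  have hq : ∀ q : F →ₗ[ℚ] ℚ, ∀ h, IsRep (fun μ => ((q μ : ℚ) : F)) x h → h ∈ SpT T σ := by
    intro q h hh
    let N : ℕ := ∏ μ ∈ (finite_maxGen x).toFinset, (q μ).den
    have hN : (N : F) ≠ 0 := by
      rw [Nat.cast_ne_zero, Finset.prod_ne_zero_iff]
      intro μ _; exact (q μ).den_nz
    have h1 : (N : F) • h ∈ SpT T σ := by
      refine int_replica hGcl hT hGen j hj hjσ hx hxT (fun μ => (N : F) * ((q μ : ℚ) : F)) ?_ ?_ ?_
      · intro a b; simp only [map_add]; push_cast; ring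
      · intro μ hμ
        have : (q μ).den ∣ N := Finset.dvd_prod_of_mem (fun μ => (q μ).den) (by simpa using hμ)
        obtain ⟨M, hM⟩ := this
        refine ⟨M * (q μ).num, ?_⟩
        rw [hM]
        have : ((q μ : ℚ) : F) * ((q μ).den : F) = ((q μ).num : F) := by
          have := Rat.mul_den_eq_num (q μ)
          exact_mod_cast congrArg (fun a : ℚ => (a : F)) this
        push_cast
        rw [← this]; ring
      · intro μ v hv
        rw [LinearMap.smul_apply, hh μ v hv, smul_smul]
    have := (SpT T σ).smul_mem h1 ((N : F)⁻¹)
    rwa [smul_smul, inv_mul_cancel₀ hN, one_smul] at this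
  let E : Submodule ℚ F := Submodule.span ℚ {μ | x.maxGenEigenspace μ ≠ ⊥}
  haveI : FiniteDimensional ℚ E := FiniteDimensional.span_of_finite ℚ (finite_maxGen x)
  let b := Module.finBasis ℚ E
  have hext : ∀ i, ∃ q : F →ₗ[ℚ] ℚ, q ∘ₗ E.subtype = b.coord i := fun i => LinearMap.exists_extend _
  choose q hq' using hext
  choose h hh using fun i => exists_isRep (spl_of_fd x) (fun μ => ((q i μ : ℚ) : F))
  have hfin : xs = ∑ i, (b i : F) • h i := by
    refine LinearMap.ext fun v => (spl_of_fd x).induction (P := fun v => xs v = (∑ i, (b i : F) • h i : Module.End F R) v) v ?_ (by simp) (fun v w h1 h2 => by rw [map_add, map_add, h1, h2])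
    intro μ v hv
    by_cases hb : x.maxGenEigenspace μ = ⊥
    · rw [hb] at hv
      rw [(Submodule.mem_bot F).1 hv, map_zero, map_zero]
    rw [hs μ v hv, LinearMap.sum_apply]
    simp only [LinearMap.smul_apply]
    have h1 : ∀ i, h i v = ((q i μ : ℚ) : F) • v := fun i => hh i μ v hv
    simp only [h1, smul_smul, ← Finset.sum_smul, id]
    congr 1
    let μ' : E := ⟨μ, Submodule.subset_span hb⟩
    have h2 := congrArg (fun a : E => (a : F)) (b.sum_repr μ')
    simp only [AddSubmonoidClass.coe_finset_sum, Submodule.coe_smul] at h2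
    rw [show μ = (μ' : F) from rfl, ← h2]
    refine Finset.sum_congr rfl fun i _ => ?_
    have h3 : q i μ' = b.repr μ' i := LinearMap.congr_fun (hq' i) μ'
    rw [h2, h3, Rat.smul_def, mul_comm]
  rw [hfin]
  exact sum_mem fun i _ => (SpT T σ).smul_mem (hq (q i) (h i) (hh i)) _
end absorb
end Minu

set_option linter.all false
namespace Minu
open Module

section wt
variable {F : Type} [Field F] [IsAlgClosed F] [CharZero F] {n : ℕ} {G : Subgroup (GL (Fin n) F)}
  {R : Type} [AddCommGroup R] [Module F R] [FiniteDimensional F R]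

/-- torus points inside `G` -/
def Tp (G T : Subgroup (GL (Fin n) F)) : Subgroup G := T.subgroupOf G

/-- weight space -/
def Wt (T : Subgroup G) (σ : G →* Module.End F R) (U : Submodule F R) (χ : T → F) : Submodule F R where
  carrier := {v | v ∈ U ∧ ∀ t : T, σ t v = χ t • v}
  zero_mem' := ⟨U.zero_mem, fun t => by simp⟩
  add_mem' := fun h1 h2 => ⟨U.add_mem h1.1 h2.1, fun t => by rw [map_add, h1.2, h2.2, smul_add]⟩
  smul_mem' := fun c v h => ⟨U.smul_mem c h.1, fun t => by rw [map_smul, h.2, smul_comm]⟩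

variable {T : Subgroup G} {σ : G →* Module.End F R}

theorem wt_basis (hd : ∀ t : T, Diag (σ t)) (hc : ∀ a b : T, a * b = b * a) (U : Submodule F R)
    (hU : ∀ t : T, ∀ u ∈ U, σ t u ∈ U) :
    ∃ (ι : Type) (_ : Fintype ι) (b : Basis ι F U) (χ : ι → T → F), ∀ i (t : T), σ t (b i) = χ i t • (b i : R) := by
  classical
  let f : T → Module.End F U := fun t => (σ t).restrict (hU t)
  have hcom : Pairwise fun a b => Commute (f a) (f b) := by
    intro a b _
    have : Commute (σ a) (σ b) := by
      show σ a * σ b = σ b * σ a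
      rw [← map_mul, ← map_mul, ← Subgroup.coe_mul, ← Subgroup.coe_mul, hc]
    refine LinearMap.ext fun u => Subtype.ext ?_
    exact LinearMap.congr_fun this.eq u.1
  have h1 := Module.End.iSup_iInf_maxGenEigenspace_eq_top_of_iSup_maxGenEigenspace_eq_top_of_commute f hcom
    (fun t => spl_of_fd (f t))
  let S : Set U := {u | ∃ χ : T → F, ∀ t : T, σ t (u : R) = χ t • (u : R)}
  have hS : ⊤ ≤ Submodule.span F S := by
    rw [← h1]
    refine iSup_le fun χ u hu => Submodule.subset_span ⟨χ, fun t => ?_⟩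
    have h2 : u ∈ (f t).maxGenEigenspace (χ t) := (Submodule.mem_iInf _).1 hu t
    have h3 := map_maxGen (x := f t) (y := σ t) U.subtype (fun v => rfl) h2
    exact (hd t).isRep _ _ h3
  let b := Basis.ofSpan hS
  haveI : Fintype _ := FiniteDimensional.fintypeBasisIndex b
  have hb : ∀ i, b i ∈ S := fun i => Basis.ofSpan_subset hS ⟨i, rfl⟩
  choose χ hχ using hb
  exact ⟨_, this, b, χ, hχ⟩

theorem wt_coord {U : Submodule F R} {ι : Type} [Fintype ι] (b : Basis ι F U) (χ : ι → T → F)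
    (hb : ∀ i (t : T), σ t (b i) = χ i t • (b i : R)) (ψ : T → F) (v : U) (hv : (v : R) ∈ Wt T σ U ψ)
    (i : ι) (hi : b.repr v i ≠ 0) : χ i = ψ := by
  funext t
  have h1 := hv.2 t
  have h2 : (v : R) = ∑ i, b.repr v i • (b i : R) := by
    have := congrArg (fun a : U => (a : R)) (b.sum_repr v)
    simp only [AddSubmonoidClass.coe_finset_sum, Submodule.coe_smul] at this
    exact this.symm
  have h3 : σ t v = ((∑ i, (b.repr v i * χ i t) • b i : U) : R) := by
    rw [h2, map_sum]
    simp [hb, smul_smul]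
  rw [h3] at h1
  have h4 : (∑ i, (b.repr v i * χ i t) • b i : U) = ψ t • v := Subtype.ext h1
  have h5 := congrArg (fun w => b.repr w i) h4
  simp only [Basis.repr_sum_self, map_smul, Finsupp.smul_apply, smul_eq_mul] at h5
  rw [mul_comm] at h5
  exact mul_right_cancel₀ hi h5

theorem wt_card {U : Submodule F R} {ι : Type} [Fintype ι] (b : Basis ι F U) (χ : ι → T → F)
    (hb : ∀ i (t : T), σ t (b i) = χ i t • (b i : R)) (ψ : T → F) [Fintype {i // χ i = ψ}] :
    finrank F (Wt T σ U ψ) = Fintype.card {i // χ i = ψ} := by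
  classical
  have h1 : Wt T σ U ψ = Submodule.span F (Set.range fun i : {i // χ i = ψ} => (b i.1 : R)) := by
    apply le_antisymm
    · intro v hv
      have h2 : v = ∑ i, b.repr ⟨v, hv.1⟩ i • (b i : R) := by
        have := congrArg (fun a : U => (a : R)) (b.sum_repr ⟨v, hv.1⟩)
        simp only [AddSubmonoidClass.coe_finset_sum, Submodule.coe_smul] at this
        exact this.symm
      rw [h2]
      refine sum_mem fun i _ => ?_
      by_cases hi : b.repr ⟨v, hv.1⟩ i = 0
      · rw [hi, zero_smul]; exact zero_mem _
      · refine Submodule.smul_mem _ _ (Submodule.subset_span ⟨⟨i, ?_⟩, rfl⟩)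
        exact wt_coord b χ hb ψ ⟨v, hv.1⟩ hv i hi
    · rw [Submodule.span_le]
      rintro _ ⟨i, rfl⟩
      refine ⟨(b i.1).2, fun t => ?_⟩
      rw [hb, i.2]
  rw [h1, finrank_span_eq_card]
  have h2 : LinearIndependent F (fun i => (b i : R)) := b.linearIndependent.map' U.subtype (Submodule.ker_subtype U)
  exact h2.comp _ Subtype.val_injective

theorem wt_trace {U : Submodule F R} {ι : Type} [Fintype ι] (b : Basis ι F U) (χ : ι → T → F)
    (hb : ∀ i (t : T), σ t (b i) = χ i t • (b i : R)) (hU : ∀ t : T, ∀ u ∈ U, σ t u ∈ U)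
    (π : Module.End F R) (hr : ∀ v, π v ∈ U) (hi : ∀ u ∈ U, π u = u) (t : T) :
    LinearMap.trace F R (σ t * π) = ∑ i, χ i t := by
  classical
  have h1 : σ t * π = (σ t ∘ₗ U.subtype) ∘ₗ (π.codRestrict U hr) := rfl
  rw [h1, LinearMap.trace_comp_comm', LinearMap.trace_eq_matrix_trace F b, Matrix.trace]
  refine Finset.sum_congr rfl fun i _ => ?_
  rw [Matrix.diag_apply, LinearMap.toMatrix_apply]
  have : ((π.codRestrict U hr) ∘ₗ σ t ∘ₗ U.subtype) (b i) = χ i t • b i := by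
    apply Subtype.ext
    show π (σ t (b i)) = _
    rw [hi _ (hU t _ (b i).2), hb]; rfl
  rw [this]; simp

theorem wt_conj {U : Submodule F R} (hU : ∀ g : G, ∀ u ∈ U, σ g u ∈ U) (w : G)
    (hw : ∀ t : T, w * t * w⁻¹ ∈ T) (ψ ψ' : T → F) (h : ∀ t : T, ψ' t = ψ ⟨w * t * w⁻¹, hw t⟩) :
    finrank F (Wt T σ U ψ) ≤ finrank F (Wt T σ U ψ') := by
  have hm : ∀ v ∈ Wt T σ U ψ, σ w⁻¹ v ∈ Wt T σ U ψ' := by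
    intro v hv
    refine ⟨hU _ _ hv.1, fun t => ?_⟩
    rw [← Module.End.mul_apply, ← map_mul, show (t : G) * w⁻¹ = w⁻¹ * (w * t * w⁻¹) by group,
      map_mul, Module.End.mul_apply, h t]
    have := hv.2 ⟨w * t * w⁻¹, hw t⟩
    rw [this, map_smul]
  refine LinearMap.finrank_le_finrank_of_injective (f := (σ w⁻¹).restrict hm) ?_
  intro a b hab
  have h1 : σ w⁻¹ a = σ w⁻¹ b := congrArg Subtype.val hab
  have h2 := congrArg (σ w) h1
  rw [← Module.End.mul_apply, ← Module.End.mul_apply, ← map_mul] at h2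
  simp at h2
  exact h2

/-- character sums of a minuscule module -/
theorem wt_main (hd : ∀ t : T, Diag (σ t)) (hc : ∀ a b : T, a * b = b * a)
    (ψ : T → F) (π₁ π₂ : Module.End F R) (U₁ U₂ : Submodule F R)
    (hU₁ : ∀ g : G, ∀ u ∈ U₁, σ g u ∈ U₁) (hU₂ : ∀ g : G, ∀ u ∈ U₂, σ g u ∈ U₂)
    (hr₁ : ∀ v, π₁ v ∈ U₁) (hi₁ : ∀ u ∈ U₁, π₁ u = u)
    (hr₂ : ∀ v, π₂ v ∈ U₂) (hi₂ : ∀ u ∈ U₂, π₂ u = u)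
    (hψ₁ : Wt T σ U₁ ψ ≠ ⊥) (hψ₂ : Wt T σ U₂ ψ ≠ ⊥)
    (hm₁ : ∀ ψ' : T → F, Wt T σ U₁ ψ' ≠ ⊥ → ∃ w : G, ∃ hw : ∀ t : G, t ∈ T ↔ w * t * w⁻¹ ∈ T,
      ∀ t : T, ψ' t = ψ ⟨w * t * w⁻¹, (hw t).1 t.2⟩)
    (hm₂ : ∀ ψ' : T → F, Wt T σ U₂ ψ' ≠ ⊥ → ∃ w : G, ∃ hw : ∀ t : G, t ∈ T ↔ w * t * w⁻¹ ∈ T,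
      ∀ t : T, ψ' t = ψ ⟨w * t * w⁻¹, (hw t).1 t.2⟩) :
    ∃ d₁ d₂ : F, d₂ ≠ 0 ∧ ∀ t : T, d₂ * LinearMap.trace F R (σ t * π₁) = d₁ * LinearMap.trace F R (σ t * π₂) := by
  classical
  have hdim : ∀ U : Submodule F R, (∀ g : G, ∀ u ∈ U, σ g u ∈ U) → ∀ ψ' : T → F,
      (∃ w : G, ∃ hw : ∀ t : G, t ∈ T ↔ w * t * w⁻¹ ∈ T,
      ∀ t : T, ψ' t = ψ ⟨w * t * w⁻¹, (hw t).1 t.2⟩) → finrank F (Wt T σ U ψ') = finrank F (Wt T σ U ψ) := by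
    rintro U hU ψ' ⟨w, hw, h⟩
    have hw' : ∀ t : T, w⁻¹ * t * w⁻¹⁻¹ ∈ T := by
      intro t
      rw [hw]
      have : w * (w⁻¹ * (t : G) * w⁻¹⁻¹) * w⁻¹ = t := by group
      rw [this]; exact t.2
    apply le_antisymm
    · refine wt_conj hU w⁻¹ hw' _ _ ?_
      intro t
      rw [h]
      congr 1
      apply Subtype.ext
      show (t : G) = w * (w⁻¹ * (t : G) * w⁻¹⁻¹) * w⁻¹
      group
    · exact wt_conj hU w (fun t => (hw t).1 t.2) _ _ h
  have key : ∀ (π : Module.End F R) (U : Submodule F R), (∀ g : G, ∀ u ∈ U, σ g u ∈ U) →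
      (∀ v, π v ∈ U) → (∀ u ∈ U, π u = u) → Wt T σ U ψ ≠ ⊥ →
      (∀ ψ' : T → F, Wt T σ U ψ' ≠ ⊥ → ∃ w : G, ∃ hw : ∀ t : G, t ∈ T ↔ w * t * w⁻¹ ∈ T,
      ∀ t : T, ψ' t = ψ ⟨w * t * w⁻¹, (hw t).1 t.2⟩) →
      ∃ O : Finset (T → F), (∀ ψ' : T → F, ψ' ∈ O ↔ ∃ w : G, ∃ hw : ∀ t : G, t ∈ T ↔ w * t * w⁻¹ ∈ T,
        ∀ t : T, ψ' t = ψ ⟨w * t * w⁻¹, (hw t).1 t.2⟩) ∧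
        ∀ t : T, LinearMap.trace F R (σ t * π) = (finrank F (Wt T σ U ψ) : F) * ∑ χ ∈ O, χ t := by
    intro π U hU hr hi h0 hm
    obtain ⟨ι, _, b, χ, hb⟩ := wt_basis hd hc U (fun t => hU t)
    have hmem : ∀ ψ' : T → F, ψ' ∈ Finset.univ.image χ ↔ ∃ w : G, ∃ hw : ∀ t : G, t ∈ T ↔ w * t * w⁻¹ ∈ T,
        ∀ t : T, ψ' t = ψ ⟨w * t * w⁻¹, (hw t).1 t.2⟩ := by
      intro ψ'
      constructor
      · intro h
        obtain ⟨i, -, rfl⟩ := Finset.mem_image.1 h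
        apply hm
        intro hbot
        have : (b i : R) ∈ Wt T σ U (χ i) := ⟨(b i).2, hb i⟩
        rw [hbot, Submodule.mem_bot] at this
        exact b.ne_zero i (Subtype.ext this)
      · intro h
        have h1 := hdim U hU ψ' h
        rw [wt_card b χ hb] at h1
        have h2 : finrank F (Wt T σ U ψ) ≠ 0 := fun h => h0 (Submodule.finrank_eq_zero.1 h)
        have h3 : 0 < Fintype.card {i // χ i = ψ'} := by omega
        obtain ⟨i⟩ := Fintype.card_pos_iff.1 h3
        exact Finset.mem_image.2 ⟨i.1, Finset.mem_univ _, i.2⟩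
    refine ⟨Finset.univ.image χ, hmem, fun t => ?_⟩
    rw [wt_trace b χ hb (fun t => hU t) π hr hi t, Finset.sum_comp (fun ψ : T → F => ψ t) χ, Finset.mul_sum]
    refine Finset.sum_congr rfl fun ψ' hψ' => ?_
    rw [← hdim U hU ψ' ((hmem ψ').1 hψ'), wt_card b χ hb, Fintype.card_subtype, nsmul_eq_mul]
  obtain ⟨O₁, hO₁, ht₁⟩ := key π₁ U₁ hU₁ hr₁ hi₁ hψ₁ hm₁
  obtain ⟨O₂, hO₂, ht₂⟩ := key π₂ U₂ hU₂ hr₂ hi₂ hψ₂ hm₂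
  have hO : O₁ = O₂ := by ext ψ'; rw [hO₁, hO₂]
  refine ⟨finrank F (Wt T σ U₁ ψ), finrank F (Wt T σ U₂ ψ), ?_, fun t => ?_⟩
  · rw [Nat.cast_ne_zero]
    exact fun h => hψ₂ (Submodule.finrank_eq_zero.1 h)
  · rw [ht₁, ht₂, hO]; ring
end wt
end Minu

set_option linter.all false
namespace Minu
open Module

section tm
variable {F : Type} [Field F] [IsAlgClosed F] [CharZero F] 
  {R : Type} [AddCommGroup R] [Module F R] [FiniteDimensional F R]

theorem nil_part {x xs : Module.End F R} (hs : IsRep id x xs) : IsNilpotent (x - xs) := by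
  have h1 : ∀ μ v, v ∈ x.maxGenEigenspace μ → ∀ k : ℕ, ((x - xs) ^ k) v = ((x - μ • (1 : Module.End F R)) ^ k) v ∧
      ((x - μ • (1 : Module.End F R)) ^ k) v ∈ x.maxGenEigenspace μ := by
    intro μ v hv k
    induction k with
    | zero => simpa using hv
    | succ k ih =>
      have h2 : (x - μ • (1 : Module.End F R)) (((x - μ • (1 : Module.End F R)) ^ k) v) =
          x (((x - μ • (1 : Module.End F R)) ^ k) v) - μ • (((x - μ • (1 : Module.End F R)) ^ k) v) := by
        simp
      constructor
      · rw [pow_succ', Module.End.mul_apply, ih.1, pow_succ', Module.End.mul_apply, h2, LinearMap.sub_apply,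
          hs μ _ ih.2]
        rfl
      · rw [pow_succ', Module.End.mul_apply, h2]
        exact sub_mem (Module.End.mapsTo_maxGenEigenspace_of_comm (Commute.refl x) μ ih.2) (Submodule.smul_mem _ _ ih.2)
  have h3 : (x - xs).maxGenEigenspace 0 = ⊤ := by
    rw [eq_top_iff]
    intro v _
    refine (spl_of_fd x).induction (P := fun v => v ∈ (x - xs).maxGenEigenspace 0) v ?_ (zero_mem _)
      (fun v w => add_mem)
    intro μ v hv
    obtain ⟨k, hk⟩ := (Module.End.mem_maxGenEigenspace _ _ _).1 hv
    refine (Module.End.mem_maxGenEigenspace _ _ _).2 ⟨k, ?_⟩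
    rw [zero_smul, sub_zero, (h1 μ v hv k).1]
    exact hk
  rw [Module.End.maxGenEigenspace_eq_genEigenspace_finrank] at h3
  refine ⟨finrank F R, LinearMap.ext fun v => ?_⟩
  have h4 : v ∈ (x - xs).genEigenspace 0 (finrank F R) := by rw [h3]; trivial
  rw [Module.End.mem_genEigenspace_nat] at h4
  simpa using h4

theorem trace_ss {x xs z : Module.End F R} (hs : IsRep id x xs) (hz : Commute z x) (k : ℕ) :
    LinearMap.trace F R (x ^ k * z) = LinearMap.trace F R (xs ^ k * z) := by
  have hzs : Commute z xs := hs.comm (spl_of_fd x) hz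
  have hxs : Commute x xs := hs.comm (spl_of_fd x) (Commute.refl x)
  obtain ⟨q, hq, hq'⟩ : ∃ q, x ^ k - xs ^ k = (x - xs) * q ∧ Commute (x - xs) q := by
    refine ⟨_, (hxs.mul_geom_sum₂ k).symm, ?_⟩
    refine Commute.sum_right _ _ _ fun i _ => ?_
    exact Commute.mul_right (((Commute.refl x).sub_left hxs.symm).pow_right _) ((hxs.sub_left (Commute.refl xs)).pow_right _)
  have h1 : IsNilpotent ((x ^ k - xs ^ k) * z) := by
    have h2 : IsNilpotent (x ^ k - xs ^ k) := by
      rw [hq]; exact hq'.isNilpotent_mul_right (nil_part hs)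
    refine Commute.isNilpotent_mul_right ?_ h2
    exact ((hz.symm.pow_left k).sub_left (hzs.symm.pow_left k))
  have h3 := (LinearMap.isNilpotent_trace_of_isNilpotent h1).eq_zero
  rw [sub_mul, map_sub, sub_eq_zero] at h3
  exact h3

variable {n : ℕ} {G T : Subgroup (GL (Fin n) F)} {σ : G →* Module.End F R}

theorem trace_main (hGcl : IsZClosed (G : Set (GL (Fin n) F))) (hT : IsMaximalTorus G T)
    {H : AG (reg G)} (HT : AG (reg T)) {hσ : IsAlgR (reg G) σ} (hGen : Gen hσ)
    (j : (Fin n → F) →ₗ[F] R) (hj : Function.Injective j)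
    (hjσ : ∀ (g : G) v, σ g (j v) = j (((g : GL (Fin n) F) : Matrix (Fin n) (Fin n) F).mulVec v))
    (hd : ∀ t : Tp G T, Diag (σ t)) (z : Module.End F R) (hz : ∀ x ∈ LieA H hσ, Commute x z)
    (htz : ∀ t : Tp G T, LinearMap.trace F R (σ t * z) = 0) :
    ∀ a ∈ Algebra.adjoin F (LieA H hσ : Set (Module.End F R)), LinearMap.trace F R (a * z) = 0 := by
  classical
  have hcT : ∀ a b : Tp G T, a * b = b * a := by
    intro a b
    apply Subtype.ext; apply Subtype.ext
    exact hT.2.1.2.2.2 _ a.2 _ b.2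
  obtain ⟨ι, _, b, χ, hb⟩ := wt_basis hd hcT ⊤ (fun t u _ => trivial)
  let 𝔱 : Submodule F (Module.End F R) := LieA H hσ ⊓ Subalgebra.toSubmodule (SpT T σ)
  let d : ι → Module.End F R →ₗ[F] F := fun i =>
    b.coord i ∘ₗ (LinearMap.id.codRestrict ⊤ (fun _ => trivial)) ∘ₗ LinearMap.applyₗ (b i : R)
  have hdy : ∀ y ∈ SpT T σ, ∀ i, y (b i) = d i y • (b i : R) := by
    intro y hy i
    replace hy := spT_span hy
    induction hy using Submodule.span_induction with
    | mem y hy =>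
      obtain ⟨t, ht, rfl⟩ := hy
      have h1 := hb i ⟨t, ht⟩
      have h2 : d i (σ t) = χ i ⟨t, ht⟩ := by
        show b.coord i ⟨σ t (b i), trivial⟩ = _
        have : (⟨σ t (b i), trivial⟩ : (⊤ : Submodule F R)) = χ i ⟨t, ht⟩ • b i := Subtype.ext h1
        rw [this]; simp
      rw [h2]; exact h1
    | zero => simp
    | add x y _ _ h1 h2 => rw [LinearMap.add_apply, h1, h2, map_add, add_smul]
    | smul c x _ h1 => rw [LinearMap.smul_apply, h1, map_smul, smul_assoc]
  have hgenr : ∃ h ∈ 𝔱, ∀ i k, d i h = d k h → ∀ y ∈ 𝔱, d i y = d k y := by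
    let I := {p : ι × ι // ∃ y ∈ 𝔱, d p.1 y ≠ d p.2 y}
    obtain ⟨h, hh, hne⟩ := Module.Dual.exists_forall_mem_ne_zero_of_forall_exists 𝔱
      (fun p : I => d p.1.1 - d p.1.2) (by
        rintro ⟨p, y, hy, hne⟩
        exact ⟨y, hy, by simpa [sub_eq_zero] using hne⟩)
    refine ⟨h, hh, fun i k hik => ?_⟩
    by_contra! hcon
    exact hne ⟨(i, k), hcon⟩ (by simp [hik])
  obtain ⟨h, hh, hsep⟩ := hgenr
  let c : Submodule F (Module.End F R) :=
    { carrier := {x | x ∈ LieA H hσ ∧ ∀ y ∈ 𝔱, Commute y x}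
      zero_mem' := ⟨zero_mem _, fun y _ => Commute.zero_right _⟩
      add_mem' := fun h1 h2 => ⟨add_mem h1.1 h2.1, fun y hy => (h1.2 y hy).add_right (h2.2 y hy)⟩
      smul_mem' := fun c x h1 => ⟨Submodule.smul_mem _ _ h1.1, fun y hy => (h1.2 y hy).smul_right c⟩ }
  have hS : ∀ x ∈ TS T σ, Diag x := by
    rintro _ ⟨t, ht, rfl⟩; exact hd ⟨t, ht⟩
  have hSc : ∀ x ∈ TS T σ, ∀ y ∈ TS T σ, Commute x y := by
    rintro _ ⟨t, ht, rfl⟩ _ ⟨s, hs, rfl⟩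
    show σ t * σ s = σ s * σ t
    rw [← map_mul, ← map_mul]
    congr 1
    exact congrArg Subtype.val (hcT ⟨t, ht⟩ ⟨s, hs⟩)
  have hspan := Diag.span hS hSc
  have hcz : ∀ x ∈ LieA H hσ, Commute h x → x ∈ c := by
    intro x hx hhx
    refine ⟨hx, fun y hy => ?_⟩
    have hbase : ∀ v : R, v ∈ Submodule.span F (Set.range fun i => (b i : R)) := by
      intro v
      have := congrArg (fun a : (⊤ : Submodule F R) => (a : R)) (b.sum_repr ⟨v, trivial⟩)
      simp only [AddSubmonoidClass.coe_finset_sum, Submodule.coe_smul] at this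
      rw [← this]
      exact sum_mem fun i _ => Submodule.smul_mem _ _ (Submodule.subset_span ⟨i, rfl⟩)
    refine LinearMap.ext fun v => ?_
    induction hbase v using Submodule.span_induction with
    | zero => simp
    | add v w _ _ h1 h2 => rw [map_add, map_add, h1, h2]
    | smul a v _ h1 => rw [map_smul, map_smul, h1]
    | mem v hv =>
      obtain ⟨i, rfl⟩ := hv
      show y (x (b i)) = x (y (b i))
      have h1 : h (x (b i)) = d i h • x (b i) := by
        have : h (x (b i)) = x (h (b i)) := LinearMap.congr_fun hhx.eq _
        rw [this, hdy h hh.2, map_smul]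
      have hxe : x (b i) = ∑ k, b.repr ⟨x (b i), trivial⟩ k • (b k : R) := by
        have := congrArg (fun a : (⊤ : Submodule F R) => (a : R)) (b.sum_repr ⟨x (b i), trivial⟩)
        simp only [AddSubmonoidClass.coe_finset_sum, Submodule.coe_smul] at this
        exact this.symm
      set r := b.repr ⟨x (b i), trivial⟩ with hr
      have h2 : ∀ k, r k ≠ 0 → d k h = d i h := by
        intro k hk
        rw [hxe, map_sum, Finset.smul_sum] at h1
        simp only [map_smul, hdy h hh.2, smul_smul] at h1
        have h3 : (∑ k, (r k * d k h) • b k : (⊤ : Submodule F R)) = ∑ k, (d i h * r k) • b k := by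
          apply Subtype.ext
          simp only [AddSubmonoidClass.coe_finset_sum, Submodule.coe_smul]
          exact h1
        have h4 := congrArg (fun w => b.repr w k) h3
        simp only [Basis.repr_sum_self] at h4
        rw [mul_comm] at h4
        exact mul_right_cancel₀ hk h4
      rw [hdy y hy.2, map_smul, hxe, map_sum, Finset.smul_sum]
      refine Finset.sum_congr rfl fun k _ => ?_
      rw [map_smul, hdy y hy.2, smul_smul, smul_smul]
      by_cases hk : r k = 0
      · simp [hk]
      · rw [hsep k i (h2 k hk) y hy, mul_comm]
  have hhc : h ∈ c := hcz h hh.1 (Commute.refl h)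
  let τ : Module.End F R →ₗ[F] F := LinearMap.trace F R ∘ₗ LinearMap.mulRight F z
  refine trace_argument τ (LieA H hσ) c (fun x hx => hx.1) (fun x hx y hy => LieA_bracket hx hy) ?_ ?_ h hhc ?_ ?_
  · intro x hx y hy
    refine ⟨LieA_bracket hx.1 hy.1, fun w hw => ?_⟩
    exact ((hx.2 w hw).mul_right (hy.2 w hw)).sub_right ((hy.2 w hw).mul_right (hx.2 w hw))
  · intro w hw a
    show LinearMap.trace F R (w * a * z) = LinearMap.trace F R (a * w * z)
    rw [mul_assoc, LinearMap.trace_mul_comm, mul_assoc, mul_assoc, (hz w hw).eq]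
  · have hdh : Diag h := (hspan h (spT_span hh.2)).1
    have hdad : Diag (adE h) := diag_of_isRep (spl_of_fd _) id (hdh.isRep.ad (fun _ _ => rfl) hdh.spl)
    have hst : ∀ x ∈ LieA H hσ, adE h x ∈ LieA H hσ := fun x hx => by
      rw [adE_apply]; exact LieA_bracket hh.1 hx
    have := Submodule.eq_iSup_inf_genEigenspace (f := adE h) (p := LieA H hσ) 1 hst hdad
    intro x hx
    rw [this] at hx
    refine Submodule.iSup_induction _ (motive := fun x => x ∈ c ⊔ brh h (LieA H hσ)) hx ?_ (zero_mem _) (fun _ _ => add_mem)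
    rintro μ x ⟨hx, hμ⟩
    have h1 : adE h x = μ • x := Module.End.mem_eigenspace_iff.1 hμ
    rw [adE_apply] at h1
    by_cases h0 : μ = 0
    · refine Submodule.mem_sup_left (hcz x hx ?_)
      rw [h0, zero_smul, sub_eq_zero] at h1
      exact h1
    · refine Submodule.mem_sup_right (mem_brh.2 ⟨-μ⁻¹ • x, Submodule.smul_mem _ _ hx, ?_⟩)
      have : (-μ⁻¹ • x) * h - h * (-μ⁻¹ • x) = μ⁻¹ • (h * x - x * h) := by
        rw [smul_mul_assoc, mul_smul_comm, smul_sub, neg_smul, neg_smul]; abel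
      rw [this, h1, smul_smul, inv_mul_cancel₀ h0, one_smul]
  · intro x hx k
    show LinearMap.trace F R (x ^ k * z) = 0
    obtain ⟨xs, hxs⟩ := exists_isRep (spl_of_fd x) id
    have hxT := comm_T hT.1 H HT hσ x (fun y hy hy' => hx.2 y ⟨hy, hy'⟩)
    have hmem : xs ∈ SpT T σ := ss_mem hGcl hT hGen j hj hjσ hx.1 hxT hxs
    rw [trace_ss hxs (hz x hx.1).symm]
    have h2 := spT_span (pow_mem hmem k)
    generalize xs ^ k = w at h2
    induction h2 using Submodule.span_induction with
    | mem y hy =>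
      obtain ⟨t, ht, rfl⟩ := hy
      exact htz ⟨t, ht⟩
    | zero => simp
    | add x y _ _ h1 h2 => rw [add_mul, map_add, h1, h2, add_zero]
    | smul c x _ h1 => rw [smul_mul_assoc, map_smul, h1, smul_zero]
end tm
end Minu

set_option linter.all false
namespace Minu
open Module

section core
variable {F : Type} [Field F] [IsAlgClosed F] [CharZero F] {n : ℕ} {G : Subgroup (GL (Fin n) F)}
  {R : Type} [AddCommGroup R] [Module F R] [FiniteDimensional F R] {σ : G →* Module.End F R}

/-- stable subspace -/
def Stab (σ : G →* Module.End F R) (U : Submodule F R) : Prop := ∀ g, ∀ u ∈ U, σ g u ∈ U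

/-- irreducible -/
def Irr (σ : G →* Module.End F R) (U : Submodule F R) : Prop :=
  U ≠ ⊥ ∧ Stab σ U ∧ ∀ U' ≤ U, Stab σ U' → U' = ⊥ ∨ U' = U

theorem exists_irr (hred : ∀ U, Stab σ U → ∃ π : Module.End F R, (∀ g, Commute (σ g) π) ∧ (∀ v, π v ∈ U) ∧ ∀ u ∈ U, π u = u)
    (Q : Module.End F R → Prop) (hQ : ∀ a b, Q (a + b) → Q a ∨ Q b) (hQ0 : ¬ Q 0) (N : ℕ) :
    ∀ V : Submodule F R, finrank F V ≤ N → Stab σ V → ∀ π : Module.End F R, (∀ g, Commute (σ g) π) → (∀ v, π v ∈ V) → Q π →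
    ∃ U ≤ V, Irr σ U ∧ ∃ π : Module.End F R, (∀ g, Commute (σ g) π) ∧ (∀ v, π v ∈ U) ∧ Q π := by
  induction N with
  | zero =>
    intro V hV _ π _ hπV hπ
    have h1 : V = ⊥ := Submodule.finrank_eq_zero.1 (by omega)
    exfalso; apply hQ0
    have : π = 0 := LinearMap.ext fun v => by simpa [h1] using hπV v
    rwa [← this]
  | succ N ih =>
    intro V hV hst π hc hπV hπ
    by_cases hirr : Irr σ V
    · exact ⟨V, le_rfl, hirr, π, hc, hπV, hπ⟩
    have hVne : V ≠ ⊥ := by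
      intro h1
      apply hQ0
      have : π = 0 := LinearMap.ext fun v => by simpa [h1] using hπV v
      rwa [← this]
    simp only [Irr, not_and] at hirr
    have h2 := hirr hVne hst
    push Not at h2
    obtain ⟨U', hU', hs', hne, hne'⟩ := h2
    obtain ⟨p, hpc, hpr, hpi⟩ := hred U' hs'
    have hlt : finrank F U' < finrank F V := Submodule.finrank_lt_finrank_of_lt (lt_of_le_of_ne hU' hne')
    let U'' := V ⊓ LinearMap.ker p
    have hs'' : Stab σ U'' := by
      rintro g u ⟨hu, hk⟩
      refine ⟨hst g u hu, ?_⟩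
      have h3 : p (σ g u) = σ g (p u) := (LinearMap.congr_fun (hpc g).eq u).symm
      show p (σ g u) = 0
      rw [h3, show p u = 0 from hk, map_zero]
    have hlt' : finrank F U'' < finrank F V := by
      refine Submodule.finrank_lt_finrank_of_lt (lt_of_le_of_ne inf_le_left ?_)
      intro h
      apply hne
      rw [eq_bot_iff]
      intro u hu
      have h3 : u ∈ U'' := by rw [h]; exact hU' hu
      rw [Submodule.mem_bot, ← hpi u hu]
      exact h3.2
    have hsum : p * π + (π - p * π) = π := by abel
    rcases hQ _ _ (hsum ▸ hπ) with h | h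
    · obtain ⟨U, hU, rest⟩ := ih U' (by omega) hs' (p * π) (fun g => (hpc g).mul_right (hc g)) (fun v => hpr _) h
      exact ⟨U, hU.trans hU', rest⟩
    · obtain ⟨U, hU, rest⟩ := ih U'' (by omega) hs'' (π - p * π)
        (fun g => (hc g).sub_right ((hpc g).mul_right (hc g))) (fun v => by
          refine ⟨V.sub_mem (hπV v) (hU' (hpr _)), ?_⟩
          show p (π v - p (π v)) = 0
          rw [map_sub, hpi _ (hpr _), sub_self]) h
      exact ⟨U, hU.trans inf_le_left, rest⟩

theorem lie_stable {H : AG (reg G)} {hσ : IsAlgR (reg G) σ} {U : Submodule F R} (hU : Stab σ U) :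
    ∀ x ∈ LieA H hσ, ∀ u ∈ U, x u ∈ U := by
  rintro x ⟨D, hD, hop⟩ u hu
  rw [← Subspace.forall_mem_dualAnnihilator_apply_eq_zero_iff]
  intro ℓ hℓ
  have h0 : cf hσ ℓ u = 0 := by
    ext g
    exact (Submodule.mem_dualAnnihilator _).1 hℓ _ (hU g u hu)
  have h1 := hop ℓ u
  rw [h0, map_zero] at h1
  have h2 := congrArg (fun f : reg G => (f : G → F) 1) h1
  simpa using h2.symm

theorem core {T : Subgroup (GL (Fin n) F)}
    (hGcl : IsZClosed (G : Set (GL (Fin n) F))) (hGred : IsReductive G) (hT : IsMaximalTorus G T)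
    {H : AG (reg G)} (HT : AG (reg T)) {hσ : IsAlgR (reg G) σ} (hGen : Gen hσ)
    (j : (Fin n → F) →ₗ[F] R) (hj : Function.Injective j)
    (hjσ : ∀ (g : G) v, σ g (j v) = j (((g : GL (Fin n) F) : Matrix (Fin n) (Fin n) F).mulVec v))
    (hd : ∀ t : Tp G T, Diag (σ t)) (V₁ V₂ : Submodule F R) (hV₁ : Stab σ V₁) (hV₂ : Stab σ V₂)
    (hm₁ : ∀ U ≤ V₁, Irr σ U → ∀ ψ ψ' : Tp G T → F, Wt (Tp G T) σ U ψ ≠ ⊥ → Wt (Tp G T) σ U ψ' ≠ ⊥ →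
      ∃ w : G, ∃ hw : ∀ t : G, t ∈ Tp G T ↔ w * t * w⁻¹ ∈ Tp G T,
      ∀ t : Tp G T, ψ' t = ψ ⟨w * t * w⁻¹, (hw t).1 t.2⟩)
    (hm₂ : ∀ U ≤ V₂, Irr σ U → ∀ ψ ψ' : Tp G T → F, Wt (Tp G T) σ U ψ ≠ ⊥ → Wt (Tp G T) σ U ψ' ≠ ⊥ →
      ∃ w : G, ∃ hw : ∀ t : G, t ∈ Tp G T ↔ w * t * w⁻¹ ∈ Tp G T,
      ∀ t : Tp G T, ψ' t = ψ ⟨w * t * w⁻¹, (hw t).1 t.2⟩)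
    (f : Module.End F R) (hfV : ∀ v, f v ∈ V₂) (hf0 : ∃ v ∈ V₁, f v ≠ 0)
    (hfT : ∀ t : Tp G T, ∀ v, f (σ t v) = σ t (f v)) :
    ∃ ψ : Module.End F R, (∀ g, Commute (σ g) ψ) ∧ (∀ v, ψ v ∈ V₂) ∧ ∃ v ∈ V₁, ψ v ≠ 0 := by
  classical
  obtain ⟨hLL⟩ := exists_LL hGcl hGred H hσ hGen j hj hjσ
  have hredL : ∀ U, Stab σ U → ∃ π : Module.End F R, (∀ x ∈ LieA H hσ, Commute x π) ∧ (∀ v, π v ∈ U) ∧ ∀ u ∈ U, π u = u := by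
    intro U hU
    obtain ⟨π, h1, h2, h3⟩ := exists_proj hLL U (fun x u hu => lie_stable hU x.1 x.2 u hu)
    exact ⟨π, fun x hx => h1 ⟨x, hx⟩, h2, h3⟩
  have hred : ∀ U, Stab σ U → ∃ π : Module.End F R, (∀ g, Commute (σ g) π) ∧ (∀ v, π v ∈ U) ∧ ∀ u ∈ U, π u = u := by
    intro U hU
    obtain ⟨π, h1, h2, h3⟩ := hredL U hU
    exact ⟨π, commute_of_lie H hσ π h1, h2, h3⟩
  have hcT : ∀ a b : Tp G T, a * b = b * a := by
    intro a b
    apply Subtype.ext; apply Subtype.ext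
    exact hT.2.1.2.2.2 _ a.2 _ b.2
  obtain ⟨v₁, hv₁, hfv₁⟩ := hf0
  obtain ⟨p₁, hp₁c, hp₁r, hp₁i⟩ := hred V₁ hV₁
  obtain ⟨p₂, hp₂c, hp₂r, hp₂i⟩ := hred V₂ hV₂
  obtain ⟨U₁, hU₁V, hU₁, q₁, hq₁c, hq₁r, hq₁⟩ := exists_irr hred (fun π => ∃ v, f (π v) ≠ 0)
    (by
      rintro a b ⟨v, hv⟩
      by_contra! hcon
      apply hv
      rw [LinearMap.add_apply, map_add, hcon.1 v, hcon.2 v, add_zero]) (by simp) _ V₁ le_rfl hV₁ p₁ hp₁c hp₁r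
      ⟨v₁, by rwa [hp₁i v₁ hv₁]⟩
  obtain ⟨v₂, hv₂⟩ := hq₁
  obtain ⟨ι, _, b, χ, hb⟩ := wt_basis hd hcT U₁ (fun t => hU₁.2.1 t)
  obtain ⟨i, hi⟩ : ∃ i, f (b i) ≠ 0 := by
    by_contra! hcon
    apply hv₂
    have := congrArg (fun a : U₁ => f (a : R)) (b.sum_repr ⟨q₁ v₂, hq₁r v₂⟩)
    simp only [AddSubmonoidClass.coe_finset_sum, Submodule.coe_smul, map_sum, map_smul, hcon, smul_zero,
      Finset.sum_const_zero] at this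
    exact this.symm
  obtain ⟨U₂, hU₂V, hU₂, q₂, hq₂c, hq₂r, hq₂⟩ := exists_irr hred (fun π => π (f (b i)) ≠ 0)
    (by
      intro a c h
      by_contra! hcon
      apply h
      rw [LinearMap.add_apply, hcon.1, hcon.2, add_zero]) (by simp) _ V₂ le_rfl hV₂ p₂ hp₂c hp₂r
      (by rwa [hp₂i _ (hfV _)])
  have hw₁ : Wt (Tp G T) σ U₁ (χ i) ≠ ⊥ := by
    intro h
    have : (b i : R) ∈ Wt (Tp G T) σ U₁ (χ i) := ⟨(b i).2, hb i⟩
    rw [h, Submodule.mem_bot] at this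
    exact hi (by rw [this, map_zero])
  have hw₂ : Wt (Tp G T) σ U₂ (χ i) ≠ ⊥ := by
    intro h
    have : q₂ (f (b i)) ∈ Wt (Tp G T) σ U₂ (χ i) := by
      refine ⟨hq₂r _, fun t => ?_⟩
      have h1 : σ t (q₂ (f (b i))) = q₂ (σ t (f (b i))) := LinearMap.congr_fun (hq₂c t).eq _
      rw [h1, ← hfT, hb, map_smul, map_smul]
    rw [h, Submodule.mem_bot] at this
    exact hq₂ this
  obtain ⟨π₁, hπ₁c, hπ₁r, hπ₁i⟩ := hredL U₁ hU₁.2.1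
  obtain ⟨π₂, hπ₂c, hπ₂r, hπ₂i⟩ := hredL U₂ hU₂.2.1
  obtain ⟨d₁, d₂, hd₂, htr⟩ := wt_main hd hcT (χ i) π₁ π₂ U₁ U₂ hU₁.2.1 hU₂.2.1 hπ₁r hπ₁i hπ₂r hπ₂i hw₁ hw₂
    (fun ψ' h => hm₁ U₁ hU₁V hU₁ _ _ hw₁ h) (fun ψ' h => hm₂ U₂ hU₂V hU₂ _ _ hw₂ h)
  have htm := trace_main hGcl hT HT hGen j hj hjσ hd (d₂ • π₁ - d₁ • π₂)
    (fun x hx => ((hπ₁c x hx).smul_right _).sub_right ((hπ₂c x hx).smul_right _)) (fun t => by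
      rw [mul_sub, mul_smul_comm, mul_smul_comm, map_sub, map_smul, map_smul, smul_eq_mul, smul_eq_mul, htr, sub_self])
  obtain ⟨ψ, hψ0, hψc, hψr, hψπ⟩ := end_hom (LieA H hσ) U₁ U₂ π₁ π₂ (lie_stable hU₁.2.1) (lie_stable hU₂.2.1)
    hU₁.1 hU₂.1 (fun U hU hs => hU₁.2.2 U hU (stable_of_lie H hσ U hs))
    (fun U hU hs => hU₂.2.2 U hU (stable_of_lie H hσ U hs)) hπ₁c hπ₁r hπ₂r hπ₁i hπ₂i d₁ d₂ hd₂ (fun a ha => by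
      have := htm a ha
      rw [mul_sub, mul_smul_comm, mul_smul_comm, map_sub, map_smul, map_smul, smul_eq_mul, smul_eq_mul, sub_eq_zero] at this
      exact this)
  refine ⟨ψ, commute_of_lie H hσ ψ hψc, fun v => hU₂V (hψr v), ?_⟩
  by_contra! hcon
  exact hψ0 (LinearMap.ext fun v => by rw [← hψπ, hcon _ (hU₁V (hπ₁r v))]; rfl)
end core
end Minu

set_option linter.all false
namespace Minu
open Module

section tr
variable {F : Type} [Field F] [IsAlgClosed F] [CharZero F] {n m : ℕ} {G : Subgroup (GL (Fin n) F)}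
  {R : Type} [AddCommGroup R] [Module F R] [FiniteDimensional F R] {σ : G →* Module.End F R}

theorem minu_tr {T : Subgroup (GL (Fin n) F)} (hTG : T ≤ G) (ρ : G →* GL (Fin m) F)
    (e : (Fin m → F) →ₗ[F] R) (he : Function.Injective e)
    (heσ : ∀ (g : G) v, σ g (e v) = e (((ρ g : GL (Fin m) F) : Matrix (Fin m) (Fin m) F).mulVec v))
    (hmin : IsMinuscule G T ρ) :
    ∀ U ≤ LinearMap.range e, Irr σ U → ∀ ψ ψ' : Tp G T → F, Wt (Tp G T) σ U ψ ≠ ⊥ → Wt (Tp G T) σ U ψ' ≠ ⊥ →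
      ∃ w : G, ∃ hw : ∀ t : G, t ∈ Tp G T ↔ w * t * w⁻¹ ∈ Tp G T,
      ∀ t : Tp G T, ψ' t = ψ ⟨w * t * w⁻¹, (hw t).1 t.2⟩ := by
  classical
  intro U hU hirr ψ ψ' hψ hψ'
  have hmap : (U.comap e).map e = U := by
    rw [Submodule.map_comap_eq]; exact inf_eq_right.2 hU
  have hirr' : IsIrreducibleOn ρ (U.comap e) := by
    refine ⟨?_, ?_, ?_⟩
    · intro h
      apply hirr.1
      rw [← hmap, h, Submodule.map_bot]
    · intro g v hv
      show e _ ∈ U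
      rw [← heσ]
      exact hirr.2.1 g _ hv
    · intro U' hU' hs
      rcases hirr.2.2 (U'.map e) (by rw [← hmap]; exact Submodule.map_mono hU') (by
        rintro g _ ⟨v, hv, rfl⟩
        rw [heσ]
        exact ⟨_, hs g v hv, rfl⟩) with h | h
      · left
        rw [eq_bot_iff]
        intro v hv
        have h1 : e v ∈ U'.map e := ⟨v, hv, rfl⟩
        rw [h, Submodule.mem_bot] at h1
        rw [Submodule.mem_bot]
        exact he (by rw [h1, map_zero])
      · right
        rw [← h, Submodule.comap_map_eq_of_injective he]
  have hM := hmin _ hirr'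
  let c : (Tp G T → F) → GL (Fin n) F → F := fun φ g => if h : g ∈ T then φ ⟨⟨g, hTG h⟩, h⟩ else 0
  have hc : ∀ φ, ∀ t : Tp G T, c φ (t : G) = φ t := by
    intro φ t
    have : ((t : G) : GL (Fin n) F) ∈ T := t.2
    simp only [c, dif_pos this]
  have hwv : ∀ φ, Wt (Tp G T) σ U φ ≠ ⊥ → ∃ v, IsWeightVector T ρ (U.comap e) (c φ) v := by
    intro φ hφ
    obtain ⟨x, hx, hx0⟩ := Submodule.exists_mem_ne_zero_of_ne_bot hφ
    obtain ⟨v, rfl⟩ := hU hx.1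
    refine ⟨v, hx.1, fun h => hx0 (by rw [h, map_zero]), fun t ht => he ?_⟩
    rw [← heσ, map_smul]
    have h1 := hx.2 ⟨t, ht⟩
    rw [h1, hc φ ⟨t, ht⟩]
  obtain ⟨v, hv⟩ := hwv ψ hψ
  obtain ⟨v', hv'⟩ := hwv ψ' hψ'
  obtain ⟨w, hwG, hwN, hw⟩ := hM _ _ _ _ hv hv'
  have hN : ∀ t : G, t ∈ Tp G T ↔ (⟨w, hwG⟩ : G) * t * (⟨w, hwG⟩ : G)⁻¹ ∈ Tp G T := by
    intro t
    exact (Subgroup.mem_normalizer_iff.1 hwN) (t : GL (Fin n) F)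
  refine ⟨⟨w, hwG⟩, hN, fun t => ?_⟩
  have h1 := hw ((t : G) : GL (Fin n) F) t.2
  rw [hc] at h1
  rw [h1, ← hc ψ]
  rfl
end tr

section reps
variable {F : Type} [Field F] {n m : ℕ} {G : Subgroup (GL (Fin n) F)}

/-- matrix representation -/
noncomputable def mrep (ρ : G →* GL (Fin m) F) : G →* Module.End F (Fin m → F) where
  toFun g := Matrix.toLin' ((ρ g : GL (Fin m) F) : Matrix (Fin m) (Fin m) F)
  map_one' := by simp [Module.End.one_eq_id]
  map_mul' g h := by simp [Matrix.toLin'_mul, Module.End.mul_eq_comp]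

/-- contragredient of the standard representation -/
noncomputable def drep (G : Subgroup (GL (Fin n) F)) : G →* Module.End F (Fin n → F) where
  toFun g := Matrix.toLin' (((g : GL (Fin n) F)⁻¹ : GL (Fin n) F) : Matrix (Fin n) (Fin n) F).transpose
  map_one' := by simp [Module.End.one_eq_id]
  map_mul' g h := by
    rw [Module.End.mul_eq_comp, ← Matrix.toLin'_mul, ← Matrix.transpose_mul]
    simp only [Subgroup.coe_mul, mul_inv_rev, Units.val_mul]

/-- direct sum -/
def prep {A B : Type} [AddCommGroup A] [Module F A] [AddCommGroup B] [Module F B]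
    (σ : G →* Module.End F A) (τ : G →* Module.End F B) : G →* Module.End F (A × B) where
  toFun g := LinearMap.prodMap (σ g) (τ g)
  map_one' := by ext <;> simp
  map_mul' g h := by ext <;> simp

theorem prep_alg {A B : Type} [AddCommGroup A] [Module F A] [AddCommGroup B] [Module F B]
    {σ : G →* Module.End F A} {τ : G →* Module.End F B} (hσ : IsAlgR (reg G) σ) (hτ : IsAlgR (reg G) τ) :
    IsAlgR (reg G) (prep σ τ) := by
  intro ℓ v
  have : (fun g => ℓ (prep σ τ g v)) = (fun g => (ℓ ∘ₗ LinearMap.inl F A B) (σ g v.1)) +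
      (fun g => (ℓ ∘ₗ LinearMap.inr F A B) (τ g v.2)) := by
    funext g
    show ℓ (σ g v.1, τ g v.2) = ℓ (σ g v.1, 0) + ℓ (0, τ g v.2)
    rw [← map_add]; simp
  rw [this]
  exact (reg G).add_mem (hσ _ _) (hτ _ _)

theorem mat_alg (σ : G →* Module.End F (Fin m → F)) (M : G → Matrix (Fin m) (Fin m) F)
    (hM : ∀ g, σ g = Matrix.toLin' (M g)) (h : ∀ i k, (fun g => M g i k) ∈ reg G) : IsAlgR (reg G) σ := by
  intro ℓ v
  have : (fun g => ℓ (σ g v)) = ∑ i, ∑ k, (ℓ (Pi.single i 1) * v k) • (fun g => M g i k) := by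
    funext g
    rw [hM, Matrix.toLin'_apply, LinearMap.pi_apply_eq_sum_univ ℓ]
    simp only [Finset.sum_apply, Pi.smul_apply, smul_eq_mul, Matrix.mulVec, dotProduct, Finset.sum_mul]
    refine Finset.sum_congr rfl fun i _ => Finset.sum_congr rfl fun k _ => ?_
    have : (fun k => if i = k then (1 : F) else 0) = Pi.single i 1 := by
      funext k; simp [Pi.single_apply, eq_comm]
    rw [this]; ring
  rw [this]
  exact sum_mem fun i _ => sum_mem fun k _ => (reg G).smul_mem (h i k) _

theorem mrep_alg (ρ : G →* GL (Fin m) F) (h : IsAlgebraicRep G ρ) : IsAlgR (reg G) (mrep ρ) := by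
  refine mat_alg _ (fun g => ((ρ g : GL (Fin m) F) : Matrix (Fin m) (Fin m) F)) (fun g => rfl) ?_
  intro i k
  obtain ⟨p, hp⟩ := h i k
  refine ⟨p, ?_⟩
  funext g
  show regm G p g = _
  rw [regm_apply, hp]
  simp only [gco, Matrix.coe_units_inv]

theorem std_alg : IsAlgR (reg G) (mrep G.subtype) := by
  refine mat_alg _ (fun g => ((g : GL (Fin n) F) : Matrix (Fin n) (Fin n) F)) (fun g => rfl) ?_
  intro i k
  have : (fun g : G => ((g : GL (Fin n) F) : Matrix (Fin n) (Fin n) F) i k) = (gen G (Sum.inl (i, k)) : G → F) := by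
    funext g; rw [gen_apply]; rfl
  rw [this]; exact (gen G _).2

theorem drep_alg : IsAlgR (reg G) (drep G) := by
  refine mat_alg _ (fun g => (((g : GL (Fin n) F)⁻¹ : GL (Fin n) F) : Matrix (Fin n) (Fin n) F).transpose) (fun g => rfl) ?_
  intro i k
  have : (fun g : G => (((g : GL (Fin n) F)⁻¹ : GL (Fin n) F) : Matrix (Fin n) (Fin n) F).transpose i k) = (gen G (Sum.inr (k, i)) : G → F) := by
    funext g; rw [gen_apply]; rfl
  rw [this]; exact (gen G _).2

theorem gen_of {R : Type} [AddCommGroup R] [Module F R] {σ : G →* Module.End F R} (hσ : IsAlgR (reg G) σ)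
    (h : ∀ i, ∃ ℓ v, gen G i = cf hσ ℓ v) : Gen hσ := by
  rw [Gen, eq_top_iff]
  intro f _
  obtain ⟨p, rfl⟩ := regs_surj G f
  induction p using MvPolynomial.induction_on with
  | C a => rw [← MvPolynomial.algebraMap_eq, AlgHom.commutes]; exact Subalgebra.algebraMap_mem _ a
  | add p q hp hq => rw [map_add]; exact add_mem (hp trivial) (hq trivial)
  | mul_X p i hp =>
    rw [map_mul, regs_X]
    exact mul_mem (hp trivial) (Algebra.subset_adjoin (h i))

theorem gen_inl (g : G) (i k : Fin n) : (gen G (Sum.inl (i, k)) : G → F) g = mrep G.subtype g (Pi.single k 1) i := by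
  rw [gen_apply]; simp [gco, mrep]

theorem gen_inr (g : G) (i k : Fin n) : (gen G (Sum.inr (i, k)) : G → F) g = drep G g (Pi.single i 1) k := by
  rw [gen_apply]; simp [gco, drep]

theorem gen_prep {B : Type} [AddCommGroup B] [Module F B] {σ : G →* Module.End F B}
    (hσ : IsAlgR (reg G) (prep (mrep G.subtype) (prep (drep G) σ))) : Gen hσ := by
  refine gen_of hσ ?_
  rintro (⟨i, k⟩ | ⟨i, k⟩)
  · refine ⟨LinearMap.proj i ∘ₗ LinearMap.fst F _ _, (Pi.single k 1, 0), ?_⟩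
    ext g
    rw [gen_inl]; rfl
  · refine ⟨LinearMap.proj k ∘ₗ LinearMap.fst F _ _ ∘ₗ LinearMap.snd F _ _, (0, Pi.single i 1, 0), ?_⟩
    ext g
    rw [gen_inr]; rfl

theorem gen_two (hσ : IsAlgR (reg G) (prep (mrep G.subtype) (drep G))) : Gen hσ := by
  refine gen_of hσ ?_
  rintro (⟨i, k⟩ | ⟨i, k⟩)
  · refine ⟨LinearMap.proj i ∘ₗ LinearMap.fst F _ _, (Pi.single k 1, 0), ?_⟩
    ext g
    rw [gen_inl]; rfl
  · refine ⟨LinearMap.proj k ∘ₗ LinearMap.snd F _ _, (0, Pi.single i 1), ?_⟩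
    ext g
    rw [gen_inr]; rfl

theorem diag_prod {A B : Type} [AddCommGroup A] [Module F A] [AddCommGroup B] [Module F B]
    {x : Module.End F A} {y : Module.End F B} (hx : Diag x) (hy : Diag y) :
    Diag (LinearMap.prodMap x y : Module.End F (A × B)) := by
  rw [Diag, eq_top_iff]
  rintro ⟨a, b⟩ _
  have h1 : (a, (0 : B)) ∈ ⨆ μ, Module.End.eigenspace (LinearMap.prodMap x y : Module.End F (A × B)) μ := by
    refine hx.induction (P := fun a => (a, (0 : B)) ∈ ⨆ μ, Module.End.eigenspace (LinearMap.prodMap x y : Module.End F (A × B)) μ) a ?_ ?_ ?_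
    · intro μ v hv
      refine Submodule.mem_iSup_of_mem μ (Module.End.mem_eigenspace_iff.2 ?_)
      simp [LinearMap.prodMap_apply, hv]
    · exact zero_mem _
    · intro v w hv hw
      have := add_mem hv hw
      simpa using this
  have h2 : ((0 : A), b) ∈ ⨆ μ, Module.End.eigenspace (LinearMap.prodMap x y : Module.End F (A × B)) μ := by
    refine hy.induction (P := fun b => ((0 : A), b) ∈ ⨆ μ, Module.End.eigenspace (LinearMap.prodMap x y : Module.End F (A × B)) μ) b ?_ ?_ ?_
    · intro μ v hv
      refine Submodule.mem_iSup_of_mem μ (Module.End.mem_eigenspace_iff.2 ?_)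
      simp [LinearMap.prodMap_apply, hv]
    · exact zero_mem _
    · intro v w hv hw
      have := add_mem hv hw
      simpa using this
  simpa using add_mem h1 h2

theorem diag_transpose [IsAlgClosed F] [CharZero F] (M : Matrix (Fin n) (Fin n) F)
    (h : Diag (Matrix.toLin' M : Module.End F (Fin n → F))) :
    Diag (Matrix.toLin' M.transpose : Module.End F (Fin n → F)) := by
  rw [diag_iff_ss] at h ⊢
  refine Module.End.isSemisimple_of_squarefree_aeval_eq_zero h.minpoly_squarefree ?_
  set p := minpoly F (Matrix.toLin' M : Module.End F (Fin n → F)) with hp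
  have h1 : Polynomial.aeval (Matrix.toLin' M : Module.End F (Fin n → F)) p = 0 := minpoly.aeval _ _
  have h2 : ∀ N : Matrix (Fin n) (Fin n) F, Polynomial.aeval (Matrix.toLin' N : Module.End F (Fin n → F)) p =
      Matrix.toLin' (Polynomial.aeval N p) := by
    intro N
    exact Polynomial.aeval_algHom_apply (Matrix.toLinAlgEquiv' : Matrix (Fin n) (Fin n) F ≃ₐ[F] _).toAlgHom N p
  rw [h2] at h1 ⊢
  have h3 : Polynomial.aeval M p = 0 := by
    apply Matrix.toLin'.injective; rw [h1, map_zero]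
  have h4 : Polynomial.aeval M.transpose p = (Polynomial.aeval M p).transpose := by
    rw [Polynomial.aeval_eq_sum_range, Polynomial.aeval_eq_sum_range, Matrix.transpose_sum]
    refine Finset.sum_congr rfl fun i _ => ?_
    rw [Matrix.transpose_smul, Matrix.transpose_pow]
  rw [h4, h3, Matrix.transpose_zero, map_zero]
end reps

section final
variable {F : Type} [Field F] [IsAlgClosed F] [CharZero F] {n m₁ m₂ : ℕ}

theorem final (G T : Subgroup (GL (Fin n) F))
    (hGcl : IsZClosed (G : Set (GL (Fin n) F)))
    (hGconn : IsZConnected (G : Set (GL (Fin n) F)))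
    (hGred : IsReductive G)
    (hT : IsMaximalTorus G T)
    (ρ₁ : G →* GL (Fin m₁) F) (ρ₂ : G →* GL (Fin m₂) F)
    (halg₁ : IsAlgebraicRep G ρ₁) (halg₂ : IsAlgebraicRep G ρ₂)
    (hmin₁ : IsMinuscule G T ρ₁) (hmin₂ : IsMinuscule G T ρ₂)
    (f : (Fin m₁ → F) →ₗ[F] (Fin m₂ → F)) (hf : f ≠ 0)
    (hfT : ∀ t : G, (t : GL (Fin n) F) ∈ T → ∀ v : Fin m₁ → F,
      f (Matrix.mulVec ((ρ₁ t : GL (Fin m₁) F) : Matrix (Fin m₁) (Fin m₁) F) v) =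
        Matrix.mulVec ((ρ₂ t : GL (Fin m₂) F) : Matrix (Fin m₂) (Fin m₂) F) (f v)) :
    ∃ f' : (Fin m₁ → F) →ₗ[F] (Fin m₂ → F), f' ≠ 0 ∧
      ∀ g : G, ∀ v : Fin m₁ → F,
        f' (Matrix.mulVec ((ρ₁ g : GL (Fin m₁) F) : Matrix (Fin m₁) (Fin m₁) F) v) =
          Matrix.mulVec ((ρ₂ g : GL (Fin m₂) F) : Matrix (Fin m₂) (Fin m₂) F) (f' v) := by
  classical
  let σ := prep (mrep G.subtype) (prep (drep G) (prep (mrep ρ₁) (mrep ρ₂)))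
  have hσ : IsAlgR (reg G) σ := prep_alg std_alg (prep_alg drep_alg (prep_alg (mrep_alg ρ₁ halg₁) (mrep_alg ρ₂ halg₂)))
  have hGen : Gen hσ := gen_prep hσ
  have H : AG (reg G) := ag_reg G hGcl hGconn
  have HT : AG (reg T) := ag_reg T hT.2.1.1 hT.2.1.2.1
  have hd : ∀ t : Tp G T, Diag (σ t) := by
    intro t
    have h1 : Diag (Matrix.toLin' ((t : G) : GL (Fin n) F).val : Module.End F (Fin n → F)) :=
      (ssElem_iff _).1 (hT.2.1.2.2.1 _ t.2)
    refine diag_rep H (prep_alg std_alg drep_alg) (gen_two _) hσ t (diag_prod h1 (diag_transpose _ ?_))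
    exact diag_inv _ h1
  let e₁ : (Fin m₁ → F) →ₗ[F] (Fin n → F) × (Fin n → F) × (Fin m₁ → F) × (Fin m₂ → F) :=
    LinearMap.inr F _ _ ∘ₗ LinearMap.inr F _ _ ∘ₗ LinearMap.inl F _ _
  let e₂ : (Fin m₂ → F) →ₗ[F] (Fin n → F) × (Fin n → F) × (Fin m₁ → F) × (Fin m₂ → F) :=
    LinearMap.inr F _ _ ∘ₗ LinearMap.inr F _ _ ∘ₗ LinearMap.inr F _ _
  let p₁ : (Fin n → F) × (Fin n → F) × (Fin m₁ → F) × (Fin m₂ → F) →ₗ[F] (Fin m₁ → F) :=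
    LinearMap.fst F _ _ ∘ₗ LinearMap.snd F _ _ ∘ₗ LinearMap.snd F _ _
  let p₂ : (Fin n → F) × (Fin n → F) × (Fin m₁ → F) × (Fin m₂ → F) →ₗ[F] (Fin m₂ → F) :=
    LinearMap.snd F _ _ ∘ₗ LinearMap.snd F _ _ ∘ₗ LinearMap.snd F _ _
  have he₁ : ∀ (g : G) v, σ g (e₁ v) = e₁ (((ρ₁ g : GL (Fin m₁) F) : Matrix (Fin m₁) (Fin m₁) F).mulVec v) := by
    intro g v
    simp [σ, e₁, prep, mrep, drep]
  have he₂ : ∀ (g : G) v, σ g (e₂ v) = e₂ (((ρ₂ g : GL (Fin m₂) F) : Matrix (Fin m₂) (Fin m₂) F).mulVec v) := by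
    intro g v
    simp [σ, e₂, prep, mrep, drep]
  have hp₁ : ∀ (g : G) v, p₁ (σ g v) = ((ρ₁ g : GL (Fin m₁) F) : Matrix (Fin m₁) (Fin m₁) F).mulVec (p₁ v) := by
    intro g v; rfl
  have hp₂ : ∀ (g : G) v, p₂ (σ g v) = ((ρ₂ g : GL (Fin m₂) F) : Matrix (Fin m₂) (Fin m₂) F).mulVec (p₂ v) := by
    intro g v; rfl
  have hpe₁ : ∀ v, p₁ (e₁ v) = v := fun v => rfl
  have hpe₂ : ∀ v, p₂ (e₂ v) = v := fun v => rfl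
  have hi₁ : Function.Injective e₁ := Function.LeftInverse.injective hpe₁
  have hi₂ : Function.Injective e₂ := Function.LeftInverse.injective hpe₂
  have hf' : ∃ v, f v ≠ 0 := by
    by_contra! hcon
    exact hf (LinearMap.ext hcon)
  obtain ⟨v₀, hv₀⟩ := hf'
  obtain ⟨ψ, hψc, hψr, x, ⟨a, rfl⟩, hx⟩ := core hGcl hGred hT (H := H) HT hGen (LinearMap.inl F _ _) LinearMap.inl_injective
    (by intro g v; simp [σ, prep, mrep, drep]) hd (LinearMap.range e₁) (LinearMap.range e₂)
    (by rintro g _ ⟨v, rfl⟩; rw [he₁]; exact ⟨_, rfl⟩) (by rintro g _ ⟨v, rfl⟩; rw [he₂]; exact ⟨_, rfl⟩)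
    (minu_tr hT.1 ρ₁ e₁ hi₁ he₁ hmin₁) (minu_tr hT.1 ρ₂ e₂ hi₂ he₂ hmin₂)
    (e₂ ∘ₗ f ∘ₗ p₁) (fun v => ⟨_, rfl⟩) ⟨e₁ v₀, ⟨v₀, rfl⟩, by
      intro h
      apply hv₀
      apply hi₂
      rw [map_zero]; exact h⟩
    (by
      intro t v
      show e₂ (f (p₁ (σ t v))) = σ t (e₂ (f (p₁ v)))
      rw [hp₁, hfT _ t.2, he₂])
  refine ⟨p₂ ∘ₗ ψ ∘ₗ e₁, ?_, ?_⟩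
  · intro h
    apply hx
    obtain ⟨y, hy⟩ := hψr (e₁ a)
    have h1 : p₂ (ψ (e₁ a)) = 0 := LinearMap.congr_fun h a
    rw [← hy, hpe₂] at h1
    rw [← hy, h1, map_zero]
  · intro g v
    show p₂ (ψ (e₁ _)) = Matrix.mulVec _ (p₂ (ψ (e₁ v)))
    rw [← he₁, ← hp₂]
    congr 1
    exact (LinearMap.congr_fun (hψc g).eq _).symm
end final
end Minu

/-- `G` a connected reductive algebraic group over an algebraically closed
field of characteristic 0, `T` a maximal torus, `V₁, V₂` finite-dimensional algebraic
minuscule representations of `G`.  If `Hom_T(V₁,V₂) ≠ 0` then `Hom_G(V₁,V₂) ≠ 0`. -/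
theorem stmt_0 {F : Type} [Field F] [IsAlgClosed F] [CharZero F] {n m₁ m₂ : ℕ}
    (G T : Subgroup (GL (Fin n) F))
    (hGcl : IsZClosed (G : Set (GL (Fin n) F)))
    (hGconn : IsZConnected (G : Set (GL (Fin n) F)))
    (hGred : IsReductive G)
    (hT : IsMaximalTorus G T)
    (ρ₁ : G →* GL (Fin m₁) F) (ρ₂ : G →* GL (Fin m₂) F)
    (halg₁ : IsAlgebraicRep G ρ₁) (halg₂ : IsAlgebraicRep G ρ₂)
    (hmin₁ : IsMinuscule G T ρ₁) (hmin₂ : IsMinuscule G T ρ₂)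
    -- `Hom_T(V₁, V₂) ≠ 0`:
    (f : (Fin m₁ → F) →ₗ[F] (Fin m₂ → F)) (hf : f ≠ 0)
    (hfT : ∀ t : G, (t : GL (Fin n) F) ∈ T → ∀ v : Fin m₁ → F,
      f (Matrix.mulVec ((ρ₁ t : GL (Fin m₁) F) : Matrix (Fin m₁) (Fin m₁) F) v) =
        Matrix.mulVec ((ρ₂ t : GL (Fin m₂) F) : Matrix (Fin m₂) (Fin m₂) F) (f v)) :
    -- then `Hom_G(V₁, V₂) ≠ 0`:
    ∃ f' : (Fin m₁ → F) →ₗ[F] (Fin m₂ → F), f' ≠ 0 ∧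
      ∀ g : G, ∀ v : Fin m₁ → F,
        f' (Matrix.mulVec ((ρ₁ g : GL (Fin m₁) F) : Matrix (Fin m₁) (Fin m₁) F) v) =
          Matrix.mulVec ((ρ₂ g : GL (Fin m₂) F) : Matrix (Fin m₂) (Fin m₂) F) (f' v) := by
  exact Minu.final G T hGcl hGconn hGred hT ρ₁ ρ₂ halg₁ halg₂ hmin₁ hmin₂ f hf hfT
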